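/- Let f and Φ satisfy the hypotheses in the context, and let u be a weak solution of ∂_t u = div(∂Φ(∇_x u)) + f(u) on ℝ^N × (0,∞) with u ∈ L^∞, −1 ≤ u ≤ 1, ∇_x u ∈ L^∞_loc(ℝ^N × [0,∞) → ℝ^N), whose initial datum u₀ satisfies u₀ ∈ BUC(ℝ^N), ∇_x u₀ ∈ BUC(ℝ^N → ℝ^N), −1 ≤ u₀ ≤ 1, and |∇_x u₀(x) − ∇_x u₀(y)| ≤ L |x−y|^β for all x, y ∈ ℝ^N and some β ∈ (0,1]. Then there exists a constant M ≥ 0 such that |∇_x u(t,x)| ≤ M for all x ∈ ℝ^N and all t ≥ 0. -/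

import Mathlib

open MeasureTheory Set Filter RealInnerProductSpace

/-- `u` (with pointwise spatial gradient `gr`) is a weak solution of
`∂ₜ u = div (A (∇ₓ u)) + g(u)`, `u(·,0) = u₀`, in `ℝ^N × (0,∞)`:
`u` is bounded, weakly continuous in time with values in `L¹_loc`,
`∇ₓ u` and `A(∇ₓ u)` are locally-in-time bounded, and the weak (integral)
identity holds for all smooth compactly supported test functions. -/
def IsWeakSol {N : ℕ}
    (A : EuclideanSpace ℝ (Fin N) → EuclideanSpace ℝ (Fin N))
    (g : ℝ → ℝ)
    (u : ℝ → EuclideanSpace ℝ (Fin N) → ℝ)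
    (gr : ℝ → EuclideanSpace ℝ (Fin N) → EuclideanSpace ℝ (Fin N))
    (u₀ : EuclideanSpace ℝ (Fin N) → ℝ) : Prop :=
  (∃ C : ℝ, ∀ t : ℝ, 0 < t → ∀ x : EuclideanSpace ℝ (Fin N), |u t x| ≤ C) ∧
  (∀ φc : EuclideanSpace ℝ (Fin N) → ℝ, Continuous φc → HasCompactSupport φc →
    Continuous fun t : ℝ => ∫ x : EuclideanSpace ℝ (Fin N), u t x * φc x) ∧
  (∀ t : ℝ, 0 < t → ∀ x : EuclideanSpace ℝ (Fin N),
    HasGradientAt (u t) (gr t x) x) ∧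
  (∀ T : ℝ, 0 < T → ∃ C : ℝ, ∀ t ∈ Ioo (0:ℝ) T,
    ∀ x : EuclideanSpace ℝ (Fin N), ‖gr t x‖ ≤ C ∧ ‖A (gr t x)‖ ≤ C) ∧
  (∀ ψ : ℝ → EuclideanSpace ℝ (Fin N) → ℝ,
    ContDiff ℝ (⊤ : ℕ∞) (fun p : ℝ × EuclideanSpace ℝ (Fin N) => ψ p.1 p.2) →
    HasCompactSupport (fun p : ℝ × EuclideanSpace ℝ (Fin N) => ψ p.1 p.2) →
    ∀ T : ℝ, 0 ≤ T →
      (∫ x : EuclideanSpace ℝ (Fin N), u T x * ψ T x)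
          - (∫ x : EuclideanSpace ℝ (Fin N), u₀ x * ψ 0 x)
        = ∫ t in (0:ℝ)..T, ∫ x : EuclideanSpace ℝ (Fin N),
            (u t x * deriv (fun τ => ψ τ x) t
              - ⟪A (gr t x), gradient (ψ t) x⟫
              + g (u t x) * ψ t x))

section Alexandrov

open Topology

variable {H : Type*} [NormedAddCommGroup H] [InnerProductSpace ℝ H] [FiniteDimensional ℝ H]
  [MeasurableSpace H] [BorelSpace H]

omit [InnerProductSpace ℝ H] in
/-- Lipschitz maps send null sets to null sets. -/
theorem LipschitzOnWith.volume_image_eq_zero [NormedSpace ℝ H] [FiniteDimensional ℝ H]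
    (ν : Measure H) [ν.IsAddHaarMeasure]
    {K : NNReal} {g : H → H} {s : Set H} (hg : LipschitzOnWith K g s) (hs : ν s = 0) :
    ν (g '' s) = 0 := by
  have hν : ν = (ν.addHaarScalarFactor (Measure.hausdorffMeasure (Module.finrank ℝ H))) •
      (Measure.hausdorffMeasure (Module.finrank ℝ H) : Measure H) :=
    Measure.isAddLeftInvariant_eq_smul _ _
  have hμ : (Measure.hausdorffMeasure (Module.finrank ℝ H) : Measure H) =
      (Measure.addHaarScalarFactor (Measure.hausdorffMeasure (Module.finrank ℝ H)) ν) • ν :=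
    Measure.isAddLeftInvariant_eq_smul _ _
  have h0 : (Measure.hausdorffMeasure (Module.finrank ℝ H) : Measure H) s = 0 := by
    rw [hμ]; simp [hs]
  have h1 : (Measure.hausdorffMeasure (Module.finrank ℝ H) : Measure H) (g '' s) = 0 := by
    have := hg.hausdorffMeasure_image_le (d := Module.finrank ℝ H) (by positivity)
    rw [h0, mul_zero] at this
    exact le_antisymm this bot_le
  rw [hν]; simp [h1]

omit [FiniteDimensional ℝ H] [MeasurableSpace H] [BorelSpace H] in
/-- A selection of the subdifferential is continuous at differentiability points. -/
theorem continuousAt_subgradient {g : H → ℝ} {ξ : H → H}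
    (hξ : ∀ x y, g x + ⟪ξ x, y - x⟫ ≤ g y) {x : H} (hx : DifferentiableAt ℝ g x) :
    ContinuousAt ξ x := by
  set G := fderiv ℝ g x with hG
  have hGξ : ∀ v, G v = ⟪ξ x, v⟫ := by
    have hmin : IsLocalMin (fun y => g y - ⟪ξ x, y⟫) x := by
      refine Eventually.of_forall fun y => ?_
      have := hξ x y
      rw [inner_sub_right] at this
      simp only
      linarith
    have hd : HasFDerivAt (fun y => g y - ⟪ξ x, y⟫) (G - innerSL ℝ (ξ x)) x :=
      hx.hasFDerivAt.sub (innerSL ℝ (ξ x)).hasFDerivAt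
    have := hmin.hasFDerivAt_eq_zero hd
    intro v
    have := congrArg (fun L => L v) this
    simp at this
    linarith
  rw [Metric.continuousAt_iff]
  intro ε hε
  have ho := hx.hasFDerivAt.isLittleO
  rw [Asymptotics.isLittleO_iff] at ho
  obtain ⟨δ, hδ, hb⟩ := Metric.eventually_nhds_iff.1 (ho (show (0:ℝ) < ε / 4 by positivity))
  refine ⟨δ / 2, by positivity, fun {y} hy => ?_⟩
  rw [dist_eq_norm] at hy ⊢
  by_cases hyx : y = x
  · simpa [hyx] using hε
  have hs : 0 < ‖y - x‖ := norm_pos_iff.2 (sub_ne_zero.2 hyx)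
  set s := ‖y - x‖ with hsdef
  by_cases hd : ξ y - ξ x = 0
  · simpa [hd] using hε
  have hdn : 0 < ‖ξ y - ξ x‖ := norm_pos_iff.2 hd
  set v := (s / ‖ξ y - ξ x‖) • (ξ y - ξ x) with hv
  have hvn : ‖v‖ = s := by
    rw [hv, norm_smul, Real.norm_of_nonneg (by positivity)]
    field_simp
  have hvi : ⟪ξ y - ξ x, v⟫ = s * ‖ξ y - ξ x‖ := by
    rw [hv, inner_smul_right, real_inner_self_eq_norm_sq]
    field_simp
  have h1 := hξ y (y + v)
  have hyv : ‖y + v - x‖ ≤ 2 * s := by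
    calc ‖y + v - x‖ = ‖(y - x) + v‖ := by congr 1; abel
      _ ≤ ‖y - x‖ + ‖v‖ := norm_add_le _ _
      _ = 2 * s := by rw [hvn]; ring
  have h2 := hb (y := y + v) (by rw [dist_eq_norm]; linarith)
  have h3 := hξ x y
  rw [hGξ, Real.norm_eq_abs] at h2
  have h4 := (abs_le.1 h2).2
  have e1 : ⟪ξ x, y + v - x⟫ = ⟪ξ x, y - x⟫ + ⟪ξ x, v⟫ := by
    rw [← inner_add_right]; congr 1; abel
  rw [add_sub_cancel_left] at h1
  rw [inner_sub_left] at hvi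
  have h5 : s * ‖ξ y - ξ x‖ ≤ ε / 4 * (2 * s) := by
    nlinarith
  have : ‖ξ y - ξ x‖ ≤ ε / 2 := by
    by_contra hcon
    push Not at hcon
    nlinarith
  linarith

/-- A selection of the subdifferential of a convex function is differentiable almost everywhere. -/
theorem ae_differentiableAt_subgradient (ν : Measure H) [ν.IsAddHaarMeasure] {g : H → ℝ} {ξ : H → H}
    (hξ : ∀ x y, g x + ⟪ξ x, y - x⟫ ≤ g y) (hg : ∀ᵐ x ∂ν, DifferentiableAt ℝ g x) :
    ∀ᵐ x ∂ν, DifferentiableAt ℝ ξ x := by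
  set Z : H → H := fun x => x + ξ x with hZ
  have hmono : ∀ x y, 0 ≤ ⟪ξ x - ξ y, x - y⟫ := fun x y => by
    have h1 := hξ x y
    have h2 := hξ y x
    rw [← neg_sub x y, inner_neg_right] at h1
    rw [inner_sub_left]
    linarith
  have hexp : ∀ x y, ‖x - y‖ ≤ ‖Z x - Z y‖ := fun x y => by
    have h1 : ⟪Z x - Z y, x - y⟫ = ‖x - y‖ ^ 2 + ⟪ξ x - ξ y, x - y⟫ := by
      rw [← real_inner_self_eq_norm_sq, ← inner_add_left]
      congr 1
      simp only [hZ]; abel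
    have h2 := real_inner_le_norm (Z x - Z y) (x - y)
    have h3 := hmono x y
    by_contra hcon
    push Not at hcon
    have : 0 < ‖x - y‖ := (norm_nonneg _).trans_lt hcon
    nlinarith
  have hinj : Function.Injective Z := fun x y hxy => by
    have := hexp x y
    rw [hxy, sub_self, norm_zero] at this
    exact sub_eq_zero.1 (norm_le_zero_iff.1 this)
  have hJ0 : LipschitzOnWith 1 (Function.invFun Z) (range Z) := by
    refine LipschitzOnWith.of_dist_le_mul ?_
    rintro _ ⟨x, rfl⟩ _ ⟨y, rfl⟩
    rw [Function.leftInverse_invFun hinj, Function.leftInverse_invFun hinj, dist_eq_norm,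
      dist_eq_norm]
    simpa using hexp x y
  obtain ⟨J, hJ, hJe⟩ := hJ0.extend_finite_dimension
  have hJZ : ∀ x, J (Z x) = x := fun x => by
    rw [← hJe (mem_range_self x), Function.leftInverse_invFun hinj]
  have hD : ν {z | ¬ DifferentiableAt ℝ J z} = 0 := hJ.ae_differentiableAt
  have hN1 : ν (J '' {z | ¬ DifferentiableAt ℝ J z}) = 0 :=
    (hJ.lipschitzOnWith (s := {z | ¬ DifferentiableAt ℝ J z})).volume_image_eq_zero ν hD
  have hN2 : ν (J '' {z | DifferentiableAt ℝ J z ∧ (fderiv ℝ J z).det = 0}) = 0 :=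
    addHaar_image_eq_zero_of_det_fderivWithin_eq_zero ν
      (fun z hz => hz.1.hasFDerivAt.hasFDerivWithinAt) (fun z hz => hz.2)
  filter_upwards [hg, measure_eq_zero_iff_ae_notMem.1 hN1, measure_eq_zero_iff_ae_notMem.1 hN2]
    with x hx h1 h2
  have hd : DifferentiableAt ℝ J (Z x) := by
    by_contra hcon
    exact h1 ⟨Z x, hcon, hJZ x⟩
  have hdet : (fderiv ℝ J (Z x)).det ≠ 0 := fun hcon => h2 ⟨Z x, ⟨hd, hcon⟩, hJZ x⟩
  set S := (fderiv ℝ J (Z x)).toContinuousLinearEquivOfDetNeZero hdet with hS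
  have hSd : HasFDerivAt J (S : H →L[ℝ] H) (Z x) := by
    rw [hS, ContinuousLinearMap.coe_toContinuousLinearEquivOfDetNeZero]
    exact hd.hasFDerivAt
  have hZc : ContinuousAt Z x := continuousAt_id.add (continuousAt_subgradient hξ hx)
  have hZd := HasFDerivAt.of_local_left_inverse hZc hSd (Eventually.of_forall hJZ)
  have : ξ = fun y => Z y - y := by ext1 y; simp [hZ]
  rw [this]
  exact hZd.differentiableAt.sub differentiableAt_id

/-- A function on `[0,1]` with small increments has a small total increment. -/
theorem abs_sub_le_of_forall_abs_sub_le {r : ℝ → ℝ} {a b : ℝ}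
    (h : ∀ s t, 0 ≤ s → s ≤ t → t ≤ 1 → |r t - r s| ≤ a * (t - s) + b * (t - s) ^ 2) :
    |r 1 - r 0| ≤ a := by
  have key : ∀ n : ℕ, |r 1 - r 0| ≤ a + b * (1 / ((n : ℝ) + 1)) := fun n => by
    have hn : (0 : ℝ) < (n : ℝ) + 1 := by positivity
    have hsum : r 1 - r 0 =
        ∑ i ∈ Finset.range (n + 1), (r (((i + 1 : ℕ) : ℝ) / (n + 1)) - r ((i : ℝ) / (n + 1))) := by
      rw [Finset.sum_range_sub (fun i : ℕ => r ((i : ℝ) / (n + 1)))]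
      congr 2
      · push_cast; field_simp
      · simp
    rw [hsum]
    refine (Finset.abs_sum_le_sum_abs _ _).trans ?_
    calc ∑ i ∈ Finset.range (n + 1), |r (((i + 1 : ℕ) : ℝ) / (n + 1)) - r ((i : ℝ) / (n + 1))|
        ≤ ∑ i ∈ Finset.range (n + 1), (a * (1 / (n + 1)) + b * (1 / ((n : ℝ) + 1)) ^ 2) := by
          refine Finset.sum_le_sum fun i hi => ?_
          have hi' : (i : ℝ) + 1 ≤ n + 1 := by exact_mod_cast Finset.mem_range.1 hi
          have := h ((i : ℝ) / (n + 1)) (((i + 1 : ℕ) : ℝ) / (n + 1)) (by positivity)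
            (by push_cast; gcongr; linarith) (by push_cast; rw [div_le_one hn]; exact hi')
          have e : (((i + 1 : ℕ) : ℝ) / (n + 1)) - (i : ℝ) / (n + 1) = 1 / (n + 1) := by
            push_cast; ring
          rwa [e] at this
      _ = a + b * (1 / ((n : ℝ) + 1)) := by
          rw [Finset.sum_const, Finset.card_range, nsmul_eq_mul]
          push_cast
          field_simp
  have hlim : Tendsto (fun n : ℕ => a + b * (1 / ((n : ℝ) + 1))) atTop (𝓝 (a + b * 0)) :=
    tendsto_const_nhds.add (tendsto_const_nhds.mul tendsto_one_div_add_atTop_nhds_zero_nat)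
  simpa using ge_of_tendsto' hlim key

omit [MeasurableSpace H] [BorelSpace H] in
/-- Second order expansion of a convex function at a differentiability point of a selection of its
subdifferential. -/
theorem exists_expansion_of_differentiableAt_subgradient {g : H → ℝ} {ξ : H → H}
    (hξ : ∀ x y, g x + ⟪ξ x, y - x⟫ ≤ g y) {x : H} (hx : DifferentiableAt ℝ ξ x) :
    ∃ T : H →L[ℝ] H, (T : H →ₗ[ℝ] H).IsSymmetric ∧ ∀ η > 0, ∀ᶠ h in 𝓝 (0 : H),
      |g (x + h) - g x - ⟪ξ x, h⟫ - ⟪T h, h⟫ / 2| ≤ η * ‖h‖ ^ 2 := by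
  set T₀ := fderiv ℝ ξ x with hT₀
  set T : H →L[ℝ] H := (1 / 2 : ℝ) • (T₀ + ContinuousLinearMap.adjoint T₀) with hT
  have hTq : ∀ u v, ⟪T u, v⟫ = (⟪T₀ u, v⟫ + ⟪T₀ v, u⟫) / 2 := fun u v => by
    rw [hT, smul_apply, add_apply, real_inner_smul_left,
      inner_add_left, ContinuousLinearMap.adjoint_inner_left, real_inner_comm (T₀ v) u]
    ring
  refine ⟨T, fun u v => ?_, fun η hη => ?_⟩
  · simp only [ContinuousLinearMap.coe_coe]
    rw [hTq u v, real_inner_comm (T v) u, hTq v u, add_comm]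
  have ho := hx.hasFDerivAt.isLittleO
  rw [Asymptotics.isLittleO_iff] at ho
  obtain ⟨δ, hδ, hb⟩ := Metric.eventually_nhds_iff.1 (ho hη)
  refine Metric.eventually_nhds_iff.2 ⟨δ, hδ, fun h hh => ?_⟩
  rw [dist_zero_right] at hh
  set r : ℝ → ℝ := fun s => g (x + s • h) - s * ⟪ξ x, h⟫ - s ^ 2 * (⟪T h, h⟫ / 2) with hr
  have hTh : ⟪T h, h⟫ = ⟪T₀ h, h⟫ := by rw [hTq]; ring
  have hslope : ∀ s ∈ Icc (0 : ℝ) 1,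
      |⟪ξ (x + s • h), h⟫ - ⟪ξ x, h⟫ - s * ⟪T₀ h, h⟫| ≤ η * ‖h‖ ^ 2 := fun s hs => by
    have hsn : ‖s • h‖ ≤ ‖h‖ := by
      rw [norm_smul, Real.norm_of_nonneg hs.1]
      exact mul_le_of_le_one_left (norm_nonneg _) hs.2
    have h1 := hb (y := x + s • h) (by rw [dist_eq_norm, add_sub_cancel_left]; linarith)
    rw [add_sub_cancel_left] at h1
    have e : ⟪ξ (x + s • h), h⟫ - ⟪ξ x, h⟫ - s * ⟪T₀ h, h⟫
        = ⟪ξ (x + s • h) - ξ x - T₀ (s • h), h⟫ := by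
      rw [inner_sub_left, inner_sub_left, map_smul, real_inner_smul_left]
    rw [e]
    calc |⟪ξ (x + s • h) - ξ x - T₀ (s • h), h⟫|
        ≤ ‖ξ (x + s • h) - ξ x - T₀ (s • h)‖ * ‖h‖ := abs_real_inner_le_norm _ _
      _ ≤ (η * ‖h‖) * ‖h‖ := by gcongr; exact h1.trans (by gcongr)
      _ = η * ‖h‖ ^ 2 := by ring
  have := abs_sub_le_of_forall_abs_sub_le (r := r) (a := η * ‖h‖ ^ 2) (b := |⟪T₀ h, h⟫|)
    fun s t hs hst ht => by
      have h1 := hslope s ⟨hs, hst.trans ht⟩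
      have h2 := hslope t ⟨hs.trans hst, ht⟩
      have h3 := hξ (x + s • h) (x + t • h)
      have h4 := hξ (x + t • h) (x + s • h)
      have e3 : x + t • h - (x + s • h) = (t - s) • h := by rw [sub_smul]; abel
      have e4 : x + s • h - (x + t • h) = (-(t - s)) • h := by rw [neg_smul, sub_smul]; abel
      rw [e3, inner_smul_right] at h3
      rw [e4, inner_smul_right] at h4
      have h5 := abs_le.1 h1
      have h6 := abs_le.1 h2
      simp only [hr, hTh]
      set q := ⟪T₀ h, h⟫
      set d := t - s with hd
      have hd0 : 0 ≤ d := sub_nonneg.2 hst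
      have hts : t = s + d := by rw [hd]; ring
      have hq := abs_le.1 (le_refl |q|)
      have m1 := mul_le_mul_of_nonneg_left h5.1 hd0
      have m2 := mul_le_mul_of_nonneg_left h5.2 hd0
      have m3 := mul_le_mul_of_nonneg_left h6.1 hd0
      have m4 := mul_le_mul_of_nonneg_left h6.2 hd0
      have m5 := mul_le_mul_of_nonneg_left hq.1 (sq_nonneg d)
      have m6 := mul_le_mul_of_nonneg_left hq.2 (sq_nonneg d)
      have m7 := mul_nonneg (abs_nonneg q) (sq_nonneg d)
      rw [hts] at m3 m4 h4 h3 ⊢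
      rw [abs_le]
      constructor <;> nlinarith
  simp only [hr, one_smul, zero_smul, add_zero, one_mul, zero_mul, one_pow] at this
  convert this using 2
  ring

end Alexandrov

section SupConvolution

open Topology

variable {H : Type*} [NormedAddCommGroup H] [InnerProductSpace ℝ H] [FiniteDimensional ℝ H]
  [MeasurableSpace H] [BorelSpace H]

/-- A function with a locally bounded selection of its subdifferential is differentiable almost
everywhere. -/
theorem ae_differentiableAt_of_subgradient (ν : Measure H) [ν.IsAddHaarMeasure] {g : H → ℝ}
    {ξ : H → H} (hξ : ∀ x y, g x + ⟪ξ x, y - x⟫ ≤ g y) {c : ℝ} (hc : ∀ x, ‖ξ x‖ ≤ ‖x‖ + c) :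
    ∀ᵐ x ∂ν, DifferentiableAt ℝ g x := by
  have hball : ∀ n : ℕ, ∀ᵐ x ∂ν, x ∈ Metric.ball (0 : H) n → DifferentiableAt ℝ g x := fun n => by
    have hlip : LipschitzOnWith (Real.toNNReal (n + c)) g (Metric.ball (0 : H) n) := by
      refine LipschitzOnWith.of_le_add_mul' _ fun x hx y hy => ?_
      have h1 := hξ x y
      have h2 : ⟪ξ x, x - y⟫ ≤ (n + c) * dist x y := by
        rw [dist_eq_norm]
        refine (real_inner_le_norm _ _).trans ?_
        gcongr
        have := hc x
        rw [mem_ball_zero_iff] at hx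
        linarith
      have h3 : ⟪ξ x, y - x⟫ = -⟪ξ x, x - y⟫ := by rw [← inner_neg_right, neg_sub]
      linarith
    filter_upwards [hlip.ae_differentiableWithinAt_of_mem (μ := ν)] with x hx hxb
    exact (hx hxb).differentiableAt (Metric.isOpen_ball.mem_nhds hxb)
  filter_upwards [ae_all_iff.2 hball] with x hx
  obtain ⟨n, hn⟩ := exists_nat_gt ‖x‖
  exact hx n (mem_ball_zero_iff.2 hn)

/-- Sup-convolution of a bounded continuous function, with a selection of maximizers, and its second
order differentiability almost everywhere. -/
theorem exists_supConvolution (ν : Measure H) [ν.IsAddHaarMeasure] {v : H → ℝ} (hv : Continuous v)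
    (hb : ∀ x, |v x| ≤ 1) {ε : ℝ} (hε : 0 < ε) :
    ∃ (U : H → ℝ) (Z : H → H), Continuous U ∧
      (∀ X, U X = v (Z X) - ‖X - Z X‖ ^ 2 / (2 * ε)) ∧
      (∀ X Y, v Y - ‖X - Y‖ ^ 2 / (2 * ε) ≤ U X) ∧
      (∀ X, ‖X - Z X‖ ^ 2 ≤ 4 * ε) ∧
      ∀ᵐ X ∂ν, ∃ T : H →L[ℝ] H, (T : H →ₗ[ℝ] H).IsSymmetric ∧ ∀ η > 0, ∀ᶠ h in 𝓝 (0 : H),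
        |U (X + h) - U X - ⟪ε⁻¹ • (Z X - X), h⟫ - ⟪T h, h⟫ / 2| ≤ η * ‖h‖ ^ 2 := by
  have hmax : ∀ X, ∃ Z, ∀ Y, v Y - ‖X - Y‖ ^ 2 / (2 * ε) ≤ v Z - ‖X - Z‖ ^ 2 / (2 * ε) := fun X => by
    have hcont : Continuous fun Y => v Y - ‖X - Y‖ ^ 2 / (2 * ε) := by fun_prop
    obtain ⟨Z, -, hZ⟩ := (isCompact_closedBall X (2 * √ε)).exists_isMaxOn
      ⟨X, Metric.mem_closedBall_self (by positivity)⟩ hcont.continuousOn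
    refine ⟨Z, fun Y => ?_⟩
    by_cases hY : Y ∈ Metric.closedBall X (2 * √ε)
    · exact hZ hY
    · have h1 : v X - ‖X - X‖ ^ 2 / (2 * ε) ≤ v Z - ‖X - Z‖ ^ 2 / (2 * ε) :=
        hZ (Metric.mem_closedBall_self (by positivity))
      refine le_trans ?_ h1
      rw [mem_closedBall_iff_norm', not_le] at hY
      have h2 : 4 * ε ≤ ‖X - Y‖ ^ 2 := by
        have := pow_le_pow_left₀ (by positivity) hY.le 2
        rwa [mul_pow, Real.sq_sqrt hε.le, show (2 : ℝ) ^ 2 = 4 by norm_num] at this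
      have h3 : 2 ≤ ‖X - Y‖ ^ 2 / (2 * ε) := by
        rw [le_div_iff₀ (by positivity)]; linarith
      have := abs_le.1 (hb X)
      have := abs_le.1 (hb Y)
      simp only [sub_self, norm_zero]
      norm_num
      linarith
  choose Z hZ using hmax
  have hdist : ∀ X, ‖X - Z X‖ ^ 2 ≤ 4 * ε := fun X => by
    have h1 := hZ X X
    have := abs_le.1 (hb X)
    have := abs_le.1 (hb (Z X))
    simp only [sub_self, norm_zero] at h1
    have h3 : ‖X - Z X‖ ^ 2 / (2 * ε) ≤ 2 := by norm_num at h1; linarith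
    rw [div_le_iff₀ (by positivity)] at h3
    linarith
  set U : H → ℝ := fun X => v (Z X) - ‖X - Z X‖ ^ 2 / (2 * ε) with hU
  set g : H → ℝ := fun X => ε * U X + ‖X‖ ^ 2 / 2 with hg
  have hgv : ∀ X Y, ε * (v Y - ‖X - Y‖ ^ 2 / (2 * ε)) + ‖X‖ ^ 2 / 2
      = ε * v Y - ‖Y‖ ^ 2 / 2 + ⟪Y, X⟫ := fun X Y => by
    rw [norm_sub_sq_real, real_inner_comm]; field_simp; ring
  have hξ : ∀ X Y, g X + ⟪Z X, Y - X⟫ ≤ g Y := fun X Y => by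
    have h1 := mul_le_mul_of_nonneg_left (hZ Y (Z X)) hε.le
    have h2 := hgv Y (Z X)
    have h3 := hgv X (Z X)
    simp only [hg, hU]
    rw [inner_sub_right]
    linarith
  have hZn : ∀ X, ‖Z X‖ ≤ ‖X‖ + 2 * √ε := fun X => by
    have h1 : ‖X - Z X‖ ≤ 2 * √ε := by
      refine abs_le_of_sq_le_sq' ?_ (by positivity) |>.2
      rw [mul_pow, Real.sq_sqrt hε.le]; linarith [hdist X]
    have := norm_sub_norm_le (Z X) X
    rw [norm_sub_rev] at this
    linarith
  have hgc : Continuous g := by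
    refine continuous_iff_continuousAt.2 fun x => ?_
    have hlow : ∀ y, |g y - g x| ≤ (‖x‖ + ‖y‖ + 2 * √ε) * ‖y - x‖ := fun y => by
      have h1 := hξ x y
      have h2 := hξ y x
      have h3 := (abs_le.1 (abs_real_inner_le_norm (Z x) (y - x))).1
      have h4 := (abs_le.1 (abs_real_inner_le_norm (Z y) (x - y))).1
      rw [norm_sub_rev x y] at h4
      have h5 : ‖Z x‖ * ‖y - x‖ ≤ (‖x‖ + ‖y‖ + 2 * √ε) * ‖y - x‖ := by
        gcongr; linarith [hZn x, norm_nonneg y]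
      have h6 : ‖Z y‖ * ‖y - x‖ ≤ (‖x‖ + ‖y‖ + 2 * √ε) * ‖y - x‖ := by
        gcongr; linarith [hZn y, norm_nonneg x]
      exact abs_le.2 ⟨by linarith, by linarith⟩
    rw [ContinuousAt, tendsto_iff_dist_tendsto_zero]
    refine squeeze_zero (fun _ => dist_nonneg) hlow ?_
    have : Continuous fun y => (‖x‖ + ‖y‖ + 2 * √ε) * ‖y - x‖ := by fun_prop
    simpa using this.tendsto x
  have hUg : ∀ X, U X = ε⁻¹ * (g X - ‖X‖ ^ 2 / 2) := fun X => by
    simp only [hg]; field_simp; ring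
  refine ⟨U, Z, ?_, fun X => rfl, hZ, hdist, ?_⟩
  · rw [show U = fun X => ε⁻¹ * (g X - ‖X‖ ^ 2 / 2) from funext hUg]
    fun_prop
  filter_upwards [ae_differentiableAt_subgradient ν hξ
    (ae_differentiableAt_of_subgradient ν hξ hZn)] with X hX
  obtain ⟨T, hTs, hT⟩ := exists_expansion_of_differentiableAt_subgradient hξ hX
  refine ⟨ε⁻¹ • (T - ContinuousLinearMap.id ℝ H), fun x y => ?_, fun η hη => ?_⟩
  · have := hTs x y
    simp only [ContinuousLinearMap.coe_coe] at this
    simp only [ContinuousLinearMap.coe_coe, smul_apply, sub_apply, ContinuousLinearMap.id_apply,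
      real_inner_smul_left, real_inner_smul_right, inner_sub_left, inner_sub_right, this]
  filter_upwards [hT (ε * η) (by positivity)] with h hh
  have e : U (X + h) - U X - ⟪ε⁻¹ • (Z X - X), h⟫
      - ⟪(ε⁻¹ • (T - ContinuousLinearMap.id ℝ H)) h, h⟫ / 2
      = ε⁻¹ * (g (X + h) - g X - ⟪Z X, h⟫ - ⟪T h, h⟫ / 2) := by
    rw [hUg, hUg, norm_add_sq_real]
    simp only [smul_apply, sub_apply, ContinuousLinearMap.id_apply,
      real_inner_smul_left, inner_sub_left, real_inner_self_eq_norm_sq]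
    ring
  rw [e, abs_mul, abs_of_pos (inv_pos.2 hε)]
  calc ε⁻¹ * |g (X + h) - g X - ⟪Z X, h⟫ - ⟪T h, h⟫ / 2|
      ≤ ε⁻¹ * (ε * η * ‖h‖ ^ 2) := by gcongr
    _ = η * ‖h‖ ^ 2 := by field_simp

end SupConvolution

section Jensen

variable {V : Type*} [NormedAddCommGroup V] [InnerProductSpace ℝ V]

/-- Slopes of affine functions touching from above a function with a quadratic lower bound depend on
the contact point in a Lipschitz way. -/
theorem norm_sub_slope_le {W : V → ℝ} {lam : ℝ} (hlam : 0 < lam) {x y p q : V}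
    (hp : ∀ z, W z ≤ W x + ⟪p, z - x⟫) (hp' : ∀ z, W x + ⟪p, z - x⟫ - lam * ‖z - x‖ ^ 2 ≤ W z)
    (hq : ∀ z, W z ≤ W y + ⟪q, z - y⟫) : ‖p - q‖ ≤ 4 * lam * ‖x - y‖ := by
  set s : ℝ := 1 / (4 * lam) with hs
  set z := y + s • (p - q) with hz
  have h1 := hp y
  have h2 := hp' z
  have h3 := hq z
  have e1 : ⟪p, z - x⟫ - ⟪p, y - x⟫ - ⟪q, z - y⟫ = s * ‖p - q‖ ^ 2 := by
    rw [← inner_sub_right, show z - x - (y - x) = z - y by abel, ← inner_sub_left, hz,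
      add_sub_cancel_left, real_inner_smul_right, real_inner_self_eq_norm_sq]
  have e2 : ‖z - x‖ ^ 2 ≤ 2 * ‖x - y‖ ^ 2 + 2 * (s ^ 2 * ‖p - q‖ ^ 2) := by
    have e3 : z - x = s • (p - q) - (x - y) := by rw [hz]; abel
    have e4 := parallelogram_law_with_norm ℝ (s • (p - q)) (x - y)
    rw [e3]
    have e5 : ‖s • (p - q)‖ * ‖s • (p - q)‖ = s ^ 2 * ‖p - q‖ ^ 2 := by
      rw [norm_smul, Real.norm_eq_abs, ← sq, mul_pow, sq_abs]
    nlinarith [mul_self_nonneg ‖s • (p - q) + (x - y)‖]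
  have e6 : s * ‖p - q‖ ^ 2 ≤ lam * ‖z - x‖ ^ 2 := by linarith
  have e7 : s * ‖p - q‖ ^ 2 ≤ lam * (2 * ‖x - y‖ ^ 2 + 2 * (s ^ 2 * ‖p - q‖ ^ 2)) :=
    e6.trans (by gcongr)
  have hsl : s * (4 * lam) = 1 := by rw [hs]; field_simp
  have e8 : ‖p - q‖ ^ 2 ≤ (4 * lam * ‖x - y‖) ^ 2 := by
    have := mul_le_mul_of_nonneg_left e7 (show 0 ≤ 8 * lam by positivity)
    have r1 : 8 * lam * (s * ‖p - q‖ ^ 2) = 2 * (s * (4 * lam)) * ‖p - q‖ ^ 2 := by ring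
    have r2 : 8 * lam * (lam * (2 * ‖x - y‖ ^ 2 + 2 * (s ^ 2 * ‖p - q‖ ^ 2)))
      = 16 * lam ^ 2 * ‖x - y‖ ^ 2 + (s * (4 * lam)) ^ 2 * ‖p - q‖ ^ 2 := by ring
    rw [r1, r2, hsl] at this
    linarith
  exact (abs_le_of_sq_le_sq' e8 (by positivity)).2

/-- **Jensen's lemma**: a null set cannot contain all the points where a function with quadratic
lower bounds is touched from above by affine functions of small slope. -/
theorem exists_contact_notMem_of_measure_zero [FiniteDimensional ℝ V] [MeasurableSpace V]
    [BorelSpace V] (ν : Measure V) [ν.IsAddHaarMeasure] {W : V → ℝ}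
    (hW : Continuous W) {k₀ : V} {R κ lam : ℝ} (hκ : 0 < κ) (hlam : 0 < lam)
    (hR : ∀ k, R ≤ ‖k - k₀‖ → W k ≤ W k₀ - ‖k - k₀‖)
    (hlow : ∀ k P, ‖P‖ ≤ 1 → W k₀ - κ ≤ W k → (∀ z, W z ≤ W k + ⟪P, z - k⟫) →
      ∀ z, W k + ⟪P, z - k⟫ - lam * ‖z - k‖ ^ 2 ≤ W z)
    {S : Set V} (hS : ν S = 0) {ρ : ℝ} (hρ : 0 < ρ) :
    ∃ k, k ∉ S ∧ ∃ P, ‖P‖ ≤ ρ ∧ W k₀ - κ ≤ W k ∧ ∀ z, W z ≤ W k + ⟪P, z - k⟫ := by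
  set R' := max R 1 with hR'
  have hR'1 : 1 ≤ R' := le_max_right _ _
  set ρ' := min ρ (min 1 (κ / R')) with hρ'
  have hρ'pos : 0 < ρ' := lt_min hρ (lt_min one_pos (by positivity))
  have hρ'1 : ρ' ≤ 1 := (min_le_right _ _).trans (min_le_left _ _)
  have hρ'κ : ρ' * R' ≤ κ := by
    rw [← le_div_iff₀ (by positivity)]
    exact (min_le_right _ _).trans (min_le_right _ _)
  by_contra! hcon
  set C : V → V → Prop := fun k P => ‖P‖ ≤ ρ' ∧ W k₀ - κ ≤ W k ∧ ∀ z, W z ≤ W k + ⟪P, z - k⟫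
    with hC
  have hex : ∀ P : V, ‖P‖ ≤ ρ' → ∃ k, C k P := fun P hP => by
    have hcont : Continuous fun k => W k - ⟪P, k - k₀⟫ := by fun_prop
    obtain ⟨k, hkR, hk⟩ := (isCompact_closedBall k₀ R').exists_isMaxOn
      ⟨k₀, Metric.mem_closedBall_self (by positivity)⟩ hcont.continuousOn
    have hk0 : W k₀ - ⟪P, k₀ - k₀⟫ ≤ W k - ⟪P, k - k₀⟫ :=
      hk (Metric.mem_closedBall_self (by positivity))
    rw [sub_self, inner_zero_right, sub_zero] at hk0
    refine ⟨k, hP, ?_, fun z => ?_⟩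
    · have h1 := (abs_le.1 (abs_real_inner_le_norm P (k - k₀))).1
      have h2 : ‖P‖ * ‖k - k₀‖ ≤ ρ' * R' := by
        gcongr
        exact mem_closedBall_iff_norm.1 hkR
      linarith
    · have hsplit : ⟪P, z - k⟫ = ⟪P, z - k₀⟫ - ⟪P, k - k₀⟫ := by
        rw [← inner_sub_right]; congr 1; abel
      by_cases hz : z ∈ Metric.closedBall k₀ R'
      · have : W z - ⟪P, z - k₀⟫ ≤ W k - ⟪P, k - k₀⟫ := hk hz
        linarith
      · rw [mem_closedBall_iff_norm, not_le] at hz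
        have h1 := hR z ((le_max_left _ _).trans hz.le)
        have h2 := (abs_le.1 (abs_real_inner_le_norm P (z - k₀))).1
        have h3 : ‖P‖ * ‖z - k₀‖ ≤ 1 * ‖z - k₀‖ := by gcongr; linarith
        linarith
  have hlip : ∀ x p y q, C x p → C y q → ‖p - q‖ ≤ 4 * lam * ‖x - y‖ := fun x p y q hx hy =>
    norm_sub_slope_le hlam hx.2.2 (hlow x p (hx.1.trans hρ'1) hx.2.1 hx.2.2) hy.2.2
  set K : Set V := {k | ∃ P, C k P} with hK
  have hKS : K ⊆ S := fun k ⟨P, hP⟩ => by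
    by_contra hkS
    obtain ⟨z, hz⟩ := hcon k hkS P (hP.1.trans (min_le_left _ _)) hP.2.1
    exact absurd (hP.2.2 z) (not_le.2 hz)
  choose! P hP using fun k (hk : k ∈ K) => hk
  have hPlip : LipschitzOnWith (Real.toNNReal (4 * lam)) P K :=
    LipschitzOnWith.of_dist_le_mul fun x hx y hy => by
      rw [dist_eq_norm, dist_eq_norm, Real.coe_toNNReal _ (by positivity)]
      exact hlip x _ y _ (hP x hx) (hP y hy)
  have himg : ν (P '' K) = 0 := hPlip.volume_image_eq_zero ν (measure_mono_null hKS hS)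
  have hsub : Metric.closedBall (0 : V) ρ' ⊆ P '' K := fun p hp => by
    obtain ⟨k, hk⟩ := hex p (mem_closedBall_zero_iff.1 hp)
    refine ⟨k, ⟨p, hk⟩, ?_⟩
    have := hlip k _ k p (hP k ⟨p, hk⟩) hk
    rw [sub_self, norm_zero, mul_zero] at this
    exact sub_eq_zero.1 (norm_le_zero_iff.1 this)
  exact (Metric.measure_closedBall_pos ν 0 hρ'pos).ne' (measure_mono_null hsub himg)

/-- Jensen's lemma in a product, where both components of the contact point can be taken in a set of
full measure. -/
theorem exists_contact_prod {H : Type*} [NormedAddCommGroup H] [InnerProductSpace ℝ H]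
    [FiniteDimensional ℝ H] [MeasurableSpace H] [BorelSpace H] (ν : Measure H) [ν.IsAddHaarMeasure]
    {W : H → H → ℝ} (hW : Continuous fun k : H × H => W k.1 k.2) {X₀ Y₀ : H} {R κ lam : ℝ}
    (hκ : 0 < κ) (hlam : 0 < lam)
    (hR : ∀ X Y, R ≤ ‖X - X₀‖ + ‖Y - Y₀‖ → W X Y ≤ W X₀ Y₀ - (‖X - X₀‖ + ‖Y - Y₀‖))
    (hlow : ∀ X Y P Q, ‖P‖ ≤ 1 → ‖Q‖ ≤ 1 → W X₀ Y₀ - κ ≤ W X Y →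
      (∀ X' Y', W X' Y' ≤ W X Y + ⟪P, X' - X⟫ + ⟪Q, Y' - Y⟫) →
      ∀ X' Y', W X Y + ⟪P, X' - X⟫ + ⟪Q, Y' - Y⟫ - lam * (‖X' - X‖ ^ 2 + ‖Y' - Y‖ ^ 2) ≤ W X' Y')
    {G₁ G₂ : H → Prop} (hG₁ : ∀ᵐ X ∂ν, G₁ X) (hG₂ : ∀ᵐ X ∂ν, G₂ X) {ρ : ℝ} (hρ : 0 < ρ) :
    ∃ X Y P Q, G₁ X ∧ G₂ Y ∧ ‖P‖ ≤ ρ ∧ ‖Q‖ ≤ ρ ∧ W X₀ Y₀ - κ ≤ W X Y ∧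
      ∀ X' Y', W X' Y' ≤ W X Y + ⟪P, X' - X⟫ + ⟪Q, Y' - Y⟫ := by
  let V := WithLp 2 (H × H)
  let _ : MeasurableSpace V := borel V
  have _ : BorelSpace V := ⟨rfl⟩
  let νV : Measure V := (stdOrthonormalBasis ℝ V).toBasis.addHaar
  let L₁ : V →ₗ[ℝ] H := LinearMap.fst ℝ H H ∘ₗ (WithLp.linearEquiv 2 ℝ (H × H)).toLinearMap
  let L₂ : V →ₗ[ℝ] H := LinearMap.snd ℝ H H ∘ₗ (WithLp.linearEquiv 2 ℝ (H × H)).toLinearMap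
  have hL₁ : Function.Surjective L₁ := fun x => ⟨WithLp.toLp 2 (x, 0), rfl⟩
  have hL₂ : Function.Surjective L₂ := fun x => ⟨WithLp.toLp 2 (0, x), rfl⟩
  have hnull : ∀ L : V →ₗ[ℝ] H, Function.Surjective L → ∀ G : H → Prop, (∀ᵐ X ∂ν, G X) →
      ∀ᵐ k ∂νV, G (L k) := fun L hL G hG => by
    obtain ⟨s, hsub, hs, hs0⟩ := exists_measurable_superset_of_null (ae_iff.1 hG)
    have h1 : ∀ᵐ y ∂ν, y ∈ sᶜ := measure_eq_zero_iff_ae_notMem.1 hs0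
    filter_upwards [(ae_comp_linearMap_mem_iff L νV ν hL hs.compl).2 h1] with k hk
    by_contra hG
    exact hk (hsub hG)
  have hgood : ∀ᵐ k ∂νV, G₁ k.fst ∧ G₂ k.snd :=
    (hnull L₁ hL₁ G₁ hG₁).and (hnull L₂ hL₂ G₂ hG₂)
  have hinner : ∀ P k k' : V, ⟪P, k' - k⟫ = ⟪P.fst, k'.fst - k.fst⟫ + ⟪P.snd, k'.snd - k.snd⟫ :=
    fun P k k' => by rw [WithLp.prod_inner_apply]; rfl
  have hnorm : ∀ k k' : V, ‖k' - k‖ ^ 2 = ‖k'.fst - k.fst‖ ^ 2 + ‖k'.snd - k.snd‖ ^ 2 :=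
    fun k k' => by rw [WithLp.prod_norm_sq_eq_of_L2]; rfl
  have hfst : ∀ k : V, ‖k.fst‖ ≤ ‖k‖ := fun k => by
    have := WithLp.prod_norm_sq_eq_of_L2 k
    exact (abs_le_of_sq_le_sq' (by nlinarith [sq_nonneg ‖k.snd‖]) (norm_nonneg _)).2
  have hsnd : ∀ k : V, ‖k.snd‖ ≤ ‖k‖ := fun k => by
    have := WithLp.prod_norm_sq_eq_of_L2 k
    exact (abs_le_of_sq_le_sq' (by nlinarith [sq_nonneg ‖k.fst‖]) (norm_nonneg _)).2
  have hle : ∀ k k' : V, ‖k' - k‖ ≤ ‖k'.fst - k.fst‖ + ‖k'.snd - k.snd‖ := fun k k' => by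
    refine (abs_le_of_sq_le_sq' ?_ (by positivity)).2
    rw [hnorm]
    nlinarith [mul_nonneg (norm_nonneg (k'.fst - k.fst)) (norm_nonneg (k'.snd - k.snd))]
  obtain ⟨k, hk, P, hP, hval, hcon⟩ := exists_contact_notMem_of_measure_zero νV
    (W := fun k : V => W k.fst k.snd) (k₀ := WithLp.toLp 2 (X₀, Y₀)) (R := R) (κ := κ) (lam := lam)
    (hW.comp (WithLp.prod_continuous_ofLp 2 H H)) hκ hlam
    (fun k hk => by
      have h1 := hle (WithLp.toLp 2 (X₀, Y₀)) k
      have := hR k.fst k.snd (hk.trans h1)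
      change _ ≤ ‖k.fst - X₀‖ + ‖k.snd - Y₀‖ at h1
      change W k.fst k.snd ≤ W X₀ Y₀ - _
      linarith)
    (fun k P hP hval hcon z => by
      have := hlow k.fst k.snd P.fst P.snd ((hfst P).trans hP) ((hsnd P).trans hP) hval
        (fun X' Y' => by
          have := hcon (WithLp.toLp 2 (X', Y'))
          rw [hinner, ← add_assoc] at this
          exact this) z.fst z.snd
      rw [hinner, hnorm]
      linarith)
    (ae_iff.1 hgood) hρ
  have hk' : G₁ k.fst ∧ G₂ k.snd := by
    by_contra h
    exact hk h
  refine ⟨k.fst, k.snd, P.fst, P.snd, hk'.1, hk'.2, (hfst P).trans hP, (hsnd P).trans hP, hval,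
    fun X' Y' => ?_⟩
  have := hcon (WithLp.toLp 2 (X', Y'))
  rw [hinner, ← add_assoc] at this
  exact this

end Jensen

section Mollification

open Topology

variable {E : Type*} [NormedAddCommGroup E] [InnerProductSpace ℝ E] [FiniteDimensional ℝ E]
  [MeasurableSpace E] [BorelSpace E]

open scoped Convolution in
theorem ContDiffBump.norm_normed_convolution_le {F : Type*} [NormedAddCommGroup F] [NormedSpace ℝ F]
    (φ : ContDiffBump (0 : E)) {g : E → F} {C : ℝ} (hg : ∀ x, ‖g x‖ ≤ C) (x : E) :
    ‖(φ.normed volume ⋆[ContinuousLinearMap.lsmul ℝ ℝ, volume] g) x‖ ≤ C := by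
  rw [convolution_def]
  calc ‖∫ t, ContinuousLinearMap.lsmul ℝ ℝ (φ.normed volume t) (g (x - t))‖
      ≤ ∫ t, φ.normed volume t * C := by
        refine norm_integral_le_of_norm_le (φ.integrable_normed.mul_const C)
          (Eventually.of_forall fun t => ?_)
        rw [ContinuousLinearMap.lsmul_apply, norm_smul, Real.norm_of_nonneg (φ.nonneg_normed t)]
        exact mul_le_mul_of_nonneg_left (hg _) (φ.nonneg_normed t)
    _ = C := by rw [integral_mul_const, φ.integral_normed, one_mul]

open scoped Convolution in
/-- The gradient of a mollification is the mollification of the gradient, for a differentiable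
function with bounded gradient. -/
theorem ContDiffBump.hasGradientAt_normed_convolution (φ : ContDiffBump (0 : E)) {ζ : E → ℝ}
    {Z : E → E} (hζ : ∀ x, HasGradientAt ζ (Z x) x) (hZm : Measurable Z) {C : ℝ}
    (hC : ∀ x, ‖Z x‖ ≤ C) (x : E) :
    HasGradientAt (φ.normed volume ⋆[ContinuousLinearMap.lsmul ℝ ℝ, volume] ζ)
      ((φ.normed volume ⋆[ContinuousLinearMap.lsmul ℝ ℝ, volume] Z) x) x := by
  have hcont : Continuous ζ := continuous_iff_continuousAt.2 fun x => (hζ x).continuousAt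
  rw [hasGradientAt_iff_hasFDerivAt]
  have hintg : Integrable fun t => (φ.normed volume t) • Z (x - t) := by
    refine (φ.integrable_normed.mul_const C).mono' ?_ (Eventually.of_forall fun t => ?_)
    · exact (φ.continuous_normed.measurable.smul
        (hZm.comp (measurable_const.sub measurable_id))).aestronglyMeasurable
    · rw [norm_smul, Real.norm_of_nonneg (φ.nonneg_normed t)]
      exact mul_le_mul_of_nonneg_left (hC _) (φ.nonneg_normed t)
  have e : (InnerProductSpace.toDual ℝ E)
      ((φ.normed volume ⋆[ContinuousLinearMap.lsmul ℝ ℝ, volume] Z) x)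
      = ∫ t, φ.normed volume t • (InnerProductSpace.toDual ℝ E) (Z (x - t)) := by
    rw [convolution_def]
    have hintZ : Integrable fun t =>
        φ.normed volume t • (InnerProductSpace.toDual ℝ E) (Z (x - t)) := by
      refine hintg.norm.mono' ?_ (Eventually.of_forall fun t => ?_)
      · exact (φ.continuous_normed.measurable.smul
          ((InnerProductSpace.toDual ℝ E).continuous.measurable.comp
          (hZm.comp (measurable_const.sub measurable_id)))).aestronglyMeasurable
      · rw [norm_smul, norm_smul, LinearIsometryEquiv.norm_map]
    ext y
    rw [ContinuousLinearMap.integral_apply hintZ, InnerProductSpace.toDual_apply_apply,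
      real_inner_comm]
    simp only [ContinuousLinearMap.lsmul_apply]
    rw [← integral_inner hintg]
    refine integral_congr_ae (Eventually.of_forall fun t => ?_)
    simp [real_inner_smul_right, real_inner_comm]
  rw [e]
  refine hasFDerivAt_integral_of_dominated_of_fderiv_le
    (F' := fun x t => φ.normed volume t • (InnerProductSpace.toDual ℝ E) (Z (x - t)))
    (bound := fun t => φ.normed volume t * C) univ_mem ?_ ?_ ?_ ?_ ?_ ?_
  · exact Eventually.of_forall fun y => (φ.continuous_normed.mul
      (hcont.comp (continuous_const.sub continuous_id))).aestronglyMeasurable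
  · exact (φ.continuous_normed.mul (hcont.comp (continuous_const.sub
      continuous_id))).integrable_of_hasCompactSupport φ.hasCompactSupport_normed.mul_right
  · exact (φ.continuous_normed.measurable.smul ((InnerProductSpace.toDual ℝ E).continuous.measurable.comp
      (hZm.comp (measurable_const.sub measurable_id)))).aestronglyMeasurable
  · refine Eventually.of_forall fun t y _ => ?_
    rw [norm_smul, Real.norm_of_nonneg (φ.nonneg_normed t), LinearIsometryEquiv.norm_map]
    exact mul_le_mul_of_nonneg_left (hC _) (φ.nonneg_normed t)
  · exact φ.integrable_normed.mul_const C
  · refine Eventually.of_forall fun t y _ => ?_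
    have h1 := (hζ (y - t)).hasFDerivAt.comp y ((hasFDerivAt_id y).sub_const t)
    rw [ContinuousLinearMap.comp_id] at h1
    exact h1.const_smul (φ.normed volume t)

/-- Approximation of a compactly supported differentiable function with bounded gradient by smooth
functions, with almost everywhere convergence of the gradients. -/
theorem exists_contDiff_approx {ζ : E → ℝ} {Z : E → E} (hζ : ∀ x, HasGradientAt ζ (Z x) x)
    (hZm : Measurable Z) {C B R : ℝ} (hC : ∀ x, ‖Z x‖ ≤ C) (hB : ∀ x, ‖ζ x‖ ≤ B)
    (hR : ∀ x, R ≤ ‖x‖ → ζ x = 0) :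
    ∃ (ζs : ℕ → E → ℝ) (Zs : ℕ → E → E), (∀ n, ContDiff ℝ (⊤ : ℕ∞) (ζs n)) ∧
      (∀ n x, HasGradientAt (ζs n) (Zs n x) x) ∧
      (∀ n x, R + 1 ≤ ‖x‖ → ζs n x = 0) ∧ (∀ n x, ‖ζs n x‖ ≤ B) ∧ (∀ n x, ‖Zs n x‖ ≤ C) ∧
      (∀ x, Tendsto (fun n => ζs n x) atTop (𝓝 (ζ x))) ∧
      ∀ᵐ x, Tendsto (fun n => Zs n x) atTop (𝓝 (Z x)) := by
  have hcont : Continuous ζ := continuous_iff_continuousAt.2 fun x => (hζ x).continuousAt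
  let φ : ℕ → ContDiffBump (0 : E) := fun n =>
    { rIn := 1 / (2 * ((n : ℝ) + 1)), rOut := 1 / ((n : ℝ) + 1), rIn_pos := by positivity
      rIn_lt_rOut := by gcongr; linarith [(n.cast_nonneg : (0 : ℝ) ≤ n)] }
  have hlim : Tendsto (fun n => (φ n).rOut) atTop (𝓝 0) := tendsto_one_div_add_atTop_nhds_zero_nat
  have hr1 : ∀ n, (φ n).rOut ≤ 1 := fun n => by
    change 1 / ((n : ℝ) + 1) ≤ 1
    rw [div_le_one (by positivity)]
    linarith [(n.cast_nonneg : (0 : ℝ) ≤ n)]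
  refine ⟨fun n => convolution ((φ n).normed volume) ζ (ContinuousLinearMap.lsmul ℝ ℝ) volume,
    fun n => convolution ((φ n).normed volume) Z (ContinuousLinearMap.lsmul ℝ ℝ) volume,
    fun n => ?_, fun n x => (φ n).hasGradientAt_normed_convolution hζ hZm hC x, fun n x hx => ?_,
    fun n x => (φ n).norm_normed_convolution_le hB x,
    fun n x => (φ n).norm_normed_convolution_le hC x, fun x => ?_, ?_⟩
  · exact (φ n).hasCompactSupport_normed.contDiff_convolution_left _ (φ n).contDiff_normed
      hcont.locallyIntegrable
  · simp only [convolution_def]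
    refine integral_eq_zero_of_ae (Eventually.of_forall fun t => ?_)
    by_cases ht : t ∈ Metric.ball (0 : E) (φ n).rOut
    · have h1 := mem_ball_zero_iff.1 ht
      have h2 := norm_sub_norm_le x t
      simp only [ContinuousLinearMap.lsmul_apply, Pi.zero_apply]
      rw [hR _ (by linarith [hr1 n]), smul_zero]
    · rw [← (φ n).support_normed_eq (μ := volume), Function.notMem_support] at ht
      simp [ht]
  · exact ContDiffBump.convolution_tendsto_right_of_continuous hlim hcont x
  · refine ContDiffBump.ae_convolution_tendsto_right_of_locallyIntegrable (K := 2) hlim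
      (Eventually.of_forall fun n => ?_) ?_
    · change 1 / ((n : ℝ) + 1) ≤ 2 * (1 / (2 * ((n : ℝ) + 1)))
      apply le_of_eq; field_simp
    · refine (locallyIntegrable_const C).mono hZm.aestronglyMeasurable
        (Eventually.of_forall fun x => ?_)
      exact (hC x).trans (le_abs_self C)

end Mollification

section DivForm

open Topology

variable {E : Type*} [NormedAddCommGroup E] [InnerProductSpace ℝ E] [FiniteDimensional ℝ E]
  [MeasurableSpace E] [BorelSpace E]

theorem measurable_of_hasGradientAt {ζ : E → ℝ} {Z : E → E} (hζ : ∀ x, HasGradientAt ζ (Z x) x) :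
    Measurable Z := by
  have h : Z = fun x => (InnerProductSpace.toDual ℝ E).symm (fderiv ℝ ζ x) := funext fun x => by
    rw [(hζ x).hasFDerivAt.fderiv, LinearIsometryEquiv.symm_apply_apply]
  rw [h]
  exact (InnerProductSpace.toDual ℝ E).symm.continuous.measurable.comp (measurable_fderiv ℝ ζ)

omit [FiniteDimensional ℝ E] [MeasurableSpace E] [BorelSpace E] in
theorem HasGradientAt.eq_zero_of_lt_norm [CompleteSpace E] {ζ : E → ℝ} {z x : E} {R : ℝ}
    (hζ : HasGradientAt ζ z x) (hR : ∀ x, R ≤ ‖x‖ → ζ x = 0) (hx : R < ‖x‖) : z = 0 := by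
  have h : ζ =ᶠ[𝓝 x] fun _ => 0 := by
    filter_upwards [continuous_norm.continuousAt.eventually (lt_mem_nhds hx)] with y hy
    exact hR y hy.le
  exact hζ.unique ((hasGradientAt_const (𝕜 := ℝ) x (0 : ℝ)).congr_of_eventuallyEq h)

/-- `∂ₜ v = div a + g` for times in `I`, tested against time independent smooth functions, for
bounded measurable data. -/
structure IsDivFormSol (I : Set ℝ) (v : ℝ → E → ℝ) (a : ℝ → E → E) (g : ℝ → E → ℝ) (C : ℝ) :
    Prop where
  continuous : Continuous fun p : ℝ × E => v p.1 p.2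
  measurable_flux : Measurable fun p : ℝ × E => a p.1 p.2
  measurable_source : Measurable fun p : ℝ × E => g p.1 p.2
  abs_value_le : ∀ t x, |v t x| ≤ C
  norm_flux_le : ∀ t x, ‖a t x‖ ≤ C
  abs_source_le : ∀ t x, |g t x| ≤ C
  weak : ∀ s ∈ I, ∀ t ∈ I, s ≤ t → ∀ (ζ : E → ℝ) (Z : E → E), ContDiff ℝ (⊤ : ℕ∞) ζ →
    HasCompactSupport ζ → (∀ x, HasGradientAt ζ (Z x) x) →
    ∫ x, (v t x - v s x) * ζ x = ∫ τ in s..t, ∫ x, (-⟪a τ x, Z x⟫ + g τ x * ζ x)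

variable {I : Set ℝ} {v : ℝ → E → ℝ} {a : ℝ → E → E} {g : ℝ → E → ℝ} {C : ℝ}

/-- The equation can be tested against differentiable functions with bounded gradient. -/
theorem IsDivFormSol.weak_of_hasGradientAt (h : IsDivFormSol I v a g C) {s t : ℝ} (hs : s ∈ I)
    (ht : t ∈ I) (hst : s ≤ t) {ζ : E → ℝ} {Z : E → E} (hζ : ∀ x, HasGradientAt ζ (Z x) x)
    {B R : ℝ} (hZ : ∀ x, ‖Z x‖ ≤ B) (hB : ∀ x, ‖ζ x‖ ≤ B) (hR : ∀ x, R ≤ ‖x‖ → ζ x = 0) :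
    ∫ x, (v t x - v s x) * ζ x = ∫ τ in s..t, ∫ x, (-⟪a τ x, Z x⟫ + g τ x * ζ x) := by
  have hC0 : 0 ≤ C := (abs_nonneg _).trans (h.abs_value_le 0 0)
  have hB0 : 0 ≤ B := (norm_nonneg _).trans (hZ 0)
  obtain ⟨ζs, Zs, hsm, hgs, hRs, hBs, hZs, hlim, hlimZ⟩ :=
    exists_contDiff_approx hζ (measurable_of_hasGradientAt hζ) hZ hB hR
  have hvt : ∀ τ, Continuous (v τ) := fun τ => h.continuous.comp (by fun_prop : Continuous fun x => (τ, x))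
  set bd : E → ℝ := (Metric.closedBall (0 : E) (R + 1)).indicator fun _ => 2 * C * B with hbd
  have hbdi : Integrable bd := by
    rw [integrable_indicator_iff measurableSet_closedBall]
    exact integrableOn_const measure_closedBall_lt_top.ne
  have hcs : ∀ n, HasCompactSupport (ζs n) := fun n =>
    HasCompactSupport.of_support_subset_isCompact (isCompact_closedBall (0 : E) (R + 1))
      fun x hx => by
        by_contra hx'
        rw [mem_closedBall_zero_iff, not_le] at hx'
        exact hx (hRs n x hx'.le)
  have hl1 : Tendsto (fun n => ∫ x, (v t x - v s x) * ζs n x) atTop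
      (𝓝 (∫ x, (v t x - v s x) * ζ x)) := by
    refine tendsto_integral_of_dominated_convergence bd (fun n => ?_) hbdi (fun n => ?_) ?_
    · exact (((hvt t).sub (hvt s)).mul (hsm n).continuous).aestronglyMeasurable
    · refine Eventually.of_forall fun x => ?_
      by_cases hx : x ∈ Metric.closedBall (0 : E) (R + 1)
      · rw [hbd, indicator_of_mem hx, norm_mul]
        gcongr
        · have := abs_le.1 (h.abs_value_le t x)
          have := abs_le.1 (h.abs_value_le s x)
          exact abs_le.2 ⟨by linarith, by linarith⟩
        · exact hBs n x
      · rw [hbd, indicator_of_notMem hx]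
        rw [mem_closedBall_zero_iff, not_le] at hx
        simp [hRs n x hx.le]
    · exact Eventually.of_forall fun x => (hlim x).const_mul _
  have hmeasI : ∀ (ζ' : E → ℝ) (Z' : E → E), Measurable ζ' → Measurable Z' →
      Measurable fun p : ℝ × E => -⟪a p.1 p.2, Z' p.2⟫ + g p.1 p.2 * ζ' p.2 := fun ζ' Z' h1 h2 =>
    (h.measurable_flux.inner (h2.comp measurable_snd)).neg.add
      (h.measurable_source.mul (h1.comp measurable_snd))
  have hbound : ∀ n τ x, ‖-⟪a τ x, Zs n x⟫ + g τ x * ζs n x‖ ≤ bd x := fun n τ x => by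
    by_cases hx : x ∈ Metric.closedBall (0 : E) (R + 1)
    · rw [hbd, indicator_of_mem hx]
      have h1 : ‖-⟪a τ x, Zs n x⟫‖ ≤ C * B := by
        rw [norm_neg]
        refine (norm_inner_le_norm _ _).trans ?_
        gcongr
        exacts [h.norm_flux_le τ x, hZs n x]
      have h2 : ‖g τ x * ζs n x‖ ≤ C * B := by
        rw [norm_mul]
        gcongr
        exacts [h.abs_source_le τ x, hBs n x]
      refine (norm_add_le _ _).trans ?_
      linarith
    · rw [hbd, indicator_of_notMem hx]
      rw [mem_closedBall_zero_iff, not_le] at hx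
      rw [hRs n x hx.le, (hgs n x).eq_zero_of_lt_norm (hRs n) hx]
      simp
  have hl2 : Tendsto (fun n => ∫ τ in s..t, ∫ x, (-⟪a τ x, Zs n x⟫ + g τ x * ζs n x)) atTop
      (𝓝 (∫ τ in s..t, ∫ x, (-⟪a τ x, Z x⟫ + g τ x * ζ x))) := by
    refine intervalIntegral.tendsto_integral_filter_of_dominated_convergence
      (fun _ => ∫ x, bd x) (Eventually.of_forall fun n => ?_) (Eventually.of_forall fun n => ?_)
      intervalIntegrable_const ?_
    · exact ((hmeasI (ζs n) (Zs n) (hsm n).continuous.measurable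
        (measurable_of_hasGradientAt (hgs n))).stronglyMeasurable.integral_prod_right
        (f := fun τ x => -⟪a τ x, Zs n x⟫ + g τ x * ζs n x)).aestronglyMeasurable
    · exact Eventually.of_forall fun τ _ => norm_integral_le_of_norm_le hbdi
        (Eventually.of_forall fun x => hbound n τ x)
    · refine Eventually.of_forall fun τ _ => ?_
      refine tendsto_integral_of_dominated_convergence bd (fun n => ?_) hbdi
        (fun n => Eventually.of_forall fun x => hbound n τ x) ?_
      · exact ((hmeasI (ζs n) (Zs n) (hsm n).continuous.measurable
          (measurable_of_hasGradientAt (hgs n))).comp measurable_prodMk_left).aestronglyMeasurable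
      · filter_upwards [hlimZ] with x hx
        exact (tendsto_const_nhds.inner hx).neg.add ((hlim x).const_mul _)
  refine tendsto_nhds_unique hl1 (hl2.congr fun n => ?_)
  exact (h.weak s hs t ht hst (ζs n) (Zs n) (hsm n) (hcs n) (hgs n)).symm

end DivForm

section BackwardAverage

open Topology

variable {E F : Type*} [NormedAddCommGroup F] [NormedSpace ℝ F]

/-- Average of `a · x` over the time interval `[t - h, t]`. -/
noncomputable def backAvg (h : ℝ) (a : ℝ → E → F) (t : ℝ) (x : E) : F :=
  h⁻¹ • ∫ τ in (t - h)..t, a τ x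

theorem norm_backAvg_le {h : ℝ} (hh : 0 < h) {a : ℝ → E → F} {C : ℝ} (hC : ∀ t x, ‖a t x‖ ≤ C)
    (t : ℝ) (x : E) : ‖backAvg h a t x‖ ≤ C := by
  have h1 := intervalIntegral.norm_integral_le_of_norm_le_const (a := t - h) (b := t)
    (f := fun τ => a τ x) (C := C) fun τ _ => hC τ x
  rw [sub_sub_cancel, abs_of_pos hh] at h1
  rw [backAvg, norm_smul, norm_inv, Real.norm_of_nonneg hh.le, inv_mul_le_iff₀ hh]
  linarith

variable [MeasurableSpace E] [MeasurableSpace F] [BorelSpace F] [SecondCountableTopology F]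

theorem measurable_backAvg {h : ℝ} (hh : 0 < h) {a : ℝ → E → F}
    (ha : Measurable fun p : ℝ × E => a p.1 p.2) :
    Measurable fun p : ℝ × E => backAvg h a p.1 p.2 := by
  have e : (fun p : ℝ × E => backAvg h a p.1 p.2)
      = fun p : ℝ × E => h⁻¹ • ∫ σ in Ioc 0 h, a (p.1 - σ) p.2 := funext fun p => by
    rw [backAvg, ← intervalIntegral.integral_of_le hh.le,
      intervalIntegral.integral_comp_sub_left (fun τ => a τ p.2) p.1, sub_zero]
  rw [e]
  have hm : Measurable fun q : (ℝ × E) × ℝ => a (q.1.1 - q.2) q.1.2 :=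
    ha.comp (((measurable_fst.comp measurable_fst).sub measurable_snd).prodMk
      (measurable_snd.comp measurable_fst))
  exact ((hm.stronglyMeasurable.integral_prod_right'
    (ν := volume.restrict (Ioc 0 h))).measurable).const_smul _

/-- Lebesgue differentiation in time. -/
theorem ae_tendsto_backAvg [CompleteSpace F] (ν : Measure E) [SFinite ν] {a : ℝ → E → F}
    (ha : Measurable fun p : ℝ × E => a p.1 p.2) {C : ℝ} (hC : ∀ t x, ‖a t x‖ ≤ C) :
    ∀ᵐ p : ℝ × E ∂(volume.prod ν),
      Tendsto (fun n : ℕ => backAvg (1 / ((n : ℝ) + 1)) a p.1 p.2) atTop (𝓝 (a p.1 p.2)) := by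
  have hms : MeasurableSet {p : ℝ × E | Tendsto
      (fun n : ℕ => backAvg (1 / ((n : ℝ) + 1)) a p.1 p.2 - a p.1 p.2) atTop (𝓝 0)} :=
    measurableSet_tendsto _ fun n => (measurable_backAvg (by positivity) ha).sub ha
  have hms' : MeasurableSet {p : ℝ × E | Tendsto
      (fun n : ℕ => backAvg (1 / ((n : ℝ) + 1)) a p.1 p.2) atTop (𝓝 (a p.1 p.2))} := by
    simpa only [tendsto_sub_nhds_zero_iff] using hms
  rw [Measure.ae_prod_iff_ae_ae hms',
    Measure.ae_ae_comm (p := fun t x => Tendsto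
      (fun n : ℕ => backAvg (1 / ((n : ℝ) + 1)) a t x) atTop (𝓝 (a t x))) hms']
  refine Eventually.of_forall fun x => ?_
  have hax : Measurable fun τ => a τ x := ha.comp measurable_prodMk_right
  have hloc : LocallyIntegrable (fun τ => a τ x) volume :=
    (locallyIntegrable_const C).mono hax.aestronglyMeasurable
      (Eventually.of_forall fun τ => (hC τ x).trans (le_abs_self C))
  have hintg : ∀ s t, IntervalIntegrable (fun τ => a τ x) volume s t := fun s t =>
    (intervalIntegrable_const (c := C)).mono_fun hax.aestronglyMeasurable
      (Eventually.of_forall fun τ => (hC τ x).trans (le_abs_self C))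
  filter_upwards [_root_.LocallyIntegrable.ae_hasDerivAt_integral hloc] with t ht
  have hd := (ht 0).tendsto_slope_zero
  have hseq : Tendsto (fun n : ℕ => -(1 / ((n : ℝ) + 1))) atTop (𝓝[≠] 0) := by
    refine tendsto_nhdsWithin_iff.2 ⟨?_, Eventually.of_forall fun n => ?_⟩
    · simpa using (tendsto_one_div_add_atTop_nhds_zero_nat (𝕜 := ℝ)).neg
    · have : (0 : ℝ) < 1 / ((n : ℝ) + 1) := by positivity
      exact (neg_lt_zero.2 this).ne
  refine (hd.comp hseq).congr fun n => ?_
  simp only [Function.comp_apply, backAvg]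
  rw [intervalIntegral.integral_interval_sub_left (hintg _ _) (hintg _ _), ← sub_eq_add_neg,
    intervalIntegral.integral_symm, inv_neg, neg_smul, smul_neg, neg_neg]

end BackwardAverage

section DivForm

open Topology

variable {E : Type*} [NormedAddCommGroup E] [InnerProductSpace ℝ E] [FiniteDimensional ℝ E]
  [MeasurableSpace E] [BorelSpace E]
variable {S₁ S₂ : ℝ} {v : ℝ → E → ℝ} {a : ℝ → E → E} {g : ℝ → E → ℝ} {C : ℝ}

/-- Testing the equation at time `t` with `w t` and integrating in time. -/
theorem IsDivFormSol.tendsto_integral_difference_quotient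
    (h : IsDivFormSol (Ioo S₁ S₂) v a g C) {w : ℝ → E → ℝ} {Z : ℝ → E → E}
    (hw : Continuous fun p : ℝ × E => w p.1 p.2) (hZm : Measurable fun p : ℝ × E => Z p.1 p.2)
    (hwZ : ∀ t x, HasGradientAt (w t) (Z t x) x) {B R τ₁ τ₂ : ℝ} (hB : ∀ t x, ‖w t x‖ ≤ B)
    (hZB : ∀ t x, ‖Z t x‖ ≤ B) (hR : ∀ t x, R ≤ ‖x‖ → w t x = 0)
    (hτ : ∀ t x, t ∉ Icc τ₁ τ₂ → w t x = 0) (hτ₁ : S₁ < τ₁) (hτ₂ : τ₂ < S₂) :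
    Tendsto (fun n : ℕ => ∫ p : ℝ × E, (v p.1 p.2 - v (p.1 - 1 / ((n : ℝ) + 1)) p.2)
      / (1 / ((n : ℝ) + 1)) * w p.1 p.2) atTop
      (𝓝 (∫ p : ℝ × E, (-⟪a p.1 p.2, Z p.1 p.2⟫ + g p.1 p.2 * w p.1 p.2))) := by
  have hC0 : 0 ≤ C := (abs_nonneg _).trans (h.abs_value_le 0 0)
  have hB0 : 0 ≤ B := (norm_nonneg _).trans (hB 0 0)
  have hZ0 : ∀ t x, (t, x) ∉ Icc τ₁ τ₂ ×ˢ Metric.closedBall (0 : E) R → w t x = 0 ∧ Z t x = 0 :=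
    fun t x hx => by
      by_cases ht : t ∈ Icc τ₁ τ₂
      · have hx' : R < ‖x‖ := by
          by_contra hx'
          exact hx ⟨ht, mem_closedBall_zero_iff.2 (not_lt.1 hx')⟩
        exact ⟨hR t x hx'.le, (hwZ t x).eq_zero_of_lt_norm (hR t) hx'⟩
      · refine ⟨hτ t x ht, (hwZ t x).unique ?_⟩
        rw [show w t = fun _ => 0 from funext fun y => hτ t y ht]
        exact hasGradientAt_const (𝕜 := ℝ) x (0 : ℝ)
  set Q : Set (ℝ × E) := Icc τ₁ τ₂ ×ˢ Metric.closedBall (0 : E) R with hQ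
  have hQm : MeasurableSet Q := measurableSet_Icc.prod measurableSet_closedBall
  have hQf : volume Q ≠ ⊤ := (isCompact_Icc.prod (isCompact_closedBall 0 R)).measure_lt_top.ne
  set K : ℕ → ℝ × E → ℝ := fun n p => -⟪backAvg (1 / ((n : ℝ) + 1)) a p.1 p.2, Z p.1 p.2⟫
    + backAvg (1 / ((n : ℝ) + 1)) g p.1 p.2 * w p.1 p.2 with hK
  have hKm : ∀ n, Measurable (K n) := fun n =>
    ((measurable_backAvg (by positivity) h.measurable_flux).inner hZm).neg.add
      ((measurable_backAvg (by positivity) h.measurable_source).mul hw.measurable)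
  have hbound : ∀ (α : E) (β : ℝ) p, ‖α‖ ≤ C → ‖β‖ ≤ C →
      ‖-⟪α, Z p.1 p.2⟫ + β * w p.1 p.2‖ ≤ Q.indicator (fun _ => 2 * C * B) p :=
    fun α β p hα hβ => by
      by_cases hp : p ∈ Q
      · rw [indicator_of_mem hp]
        have h1 : ‖-⟪α, Z p.1 p.2⟫‖ ≤ C * B := by
          rw [norm_neg]
          refine (norm_inner_le_norm _ _).trans ?_
          gcongr
          exact hZB _ _
        have h2 : ‖β * w p.1 p.2‖ ≤ C * B := by
          rw [norm_mul]
          gcongr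
          exact hB _ _
        refine (norm_add_le _ _).trans ?_
        linarith
      · rw [indicator_of_notMem hp, (hZ0 p.1 p.2 hp).1, (hZ0 p.1 p.2 hp).2]
        simp
  have hQi : Integrable (Q.indicator fun _ => 2 * C * B) := by
    rw [integrable_indicator_iff hQm]
    exact integrableOn_const hQf
  have hKb : ∀ n p, ‖K n p‖ ≤ Q.indicator (fun _ => 2 * C * B) p := fun n p =>
    hbound _ _ p (norm_backAvg_le (by positivity) h.norm_flux_le _ _)
      (norm_backAvg_le (by positivity) h.abs_source_le _ _)
  have hlim : Tendsto (fun n => ∫ p, K n p) atTop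
      (𝓝 (∫ p : ℝ × E, (-⟪a p.1 p.2, Z p.1 p.2⟫ + g p.1 p.2 * w p.1 p.2))) := by
    refine tendsto_integral_of_dominated_convergence _ (fun n => (hKm n).aestronglyMeasurable) hQi
      (fun n => Eventually.of_forall (hKb n)) ?_
    filter_upwards [ae_tendsto_backAvg volume h.measurable_flux h.norm_flux_le,
      ae_tendsto_backAvg volume h.measurable_source h.abs_source_le] with p hp1 hp2
    exact (hp1.inner tendsto_const_nhds).neg.add (hp2.mul_const _)
  refine hlim.congr' ?_
  have hsmall : ∀ᶠ n : ℕ in atTop, 1 / ((n : ℝ) + 1) < τ₁ - S₁ :=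
    tendsto_one_div_add_atTop_nhds_zero_nat.eventually (gt_mem_nhds (sub_pos.2 hτ₁))
  filter_upwards [hsmall] with n hn
  set d : ℝ := 1 / ((n : ℝ) + 1) with hd
  have hd0 : 0 < d := by positivity
  have hL : Integrable fun p : ℝ × E => (v p.1 p.2 - v (p.1 - d) p.2) / d * w p.1 p.2 := by
    have hc : Continuous fun p : ℝ × E => (v p.1 p.2 - v (p.1 - d) p.2) / d * w p.1 p.2 := by
      have h1 : Continuous fun p : ℝ × E => v (p.1 - d) p.2 :=
        h.continuous.comp (by fun_prop : Continuous fun p : ℝ × E => (p.1 - d, p.2))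
      exact ((h.continuous.sub h1).div_const d).mul hw
    refine hc.integrable_of_hasCompactSupport (HasCompactSupport.of_support_subset_isCompact
      ((isCompact_Icc (a := τ₁) (b := τ₂)).prod (isCompact_closedBall (0 : E) R)) fun p hp => ?_)
    by_contra hpQ
    exact hp (by simp [(hZ0 p.1 p.2 hpQ).1])
  have hKi : Integrable (K n) := hQi.mono' (hKm n).aestronglyMeasurable
    (Eventually.of_forall (hKb n))
  rw [Measure.volume_eq_prod] at hL hKi ⊢
  rw [integral_prod _ hL, integral_prod _ hKi]
  refine integral_congr_ae (Eventually.of_forall fun t => ?_)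
  by_cases ht : t ∈ Icc τ₁ τ₂
  swap
  · have hz : ∀ x, w t x = 0 ∧ Z t x = 0 := fun x => hZ0 t x fun hx => ht hx.1
    simp [hK, hz]
  have hax : ∀ x, Measurable fun τ => a τ x := fun x =>
    h.measurable_flux.comp measurable_prodMk_right
  have hgx : ∀ x, Measurable fun τ => g τ x := fun x =>
    h.measurable_source.comp measurable_prodMk_right
  have haint : ∀ x, IntervalIntegrable (fun τ => a τ x) volume (t - d) t := fun x =>
    (intervalIntegrable_const (c := C)).mono_fun (hax x).aestronglyMeasurable
      (Eventually.of_forall fun τ => (h.norm_flux_le τ x).trans (le_abs_self C))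
  have hgint : ∀ x, IntervalIntegrable (fun τ => g τ x) volume (t - d) t := fun x =>
    (intervalIntegrable_const (c := C)).mono_fun (hgx x).aestronglyMeasurable
      (Eventually.of_forall fun τ => (h.abs_source_le τ x).trans (le_abs_self C))
  have hinner : ∀ x, K n (t, x) = d⁻¹ * ∫ τ in (t - d)..t, (-⟪a τ x, Z t x⟫ + g τ x * w t x) :=
    fun x => by
      have h1 : IntervalIntegrable (fun τ => ⟪a τ x, Z t x⟫) volume (t - d) t := by
        simp only [real_inner_comm (Z t x)]
        exact ⟨(haint x).1.const_inner _, (haint x).2.const_inner _⟩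
      have h2 : ∫ τ in (t - d)..t, ⟪a τ x, Z t x⟫ = ⟪∫ τ in (t - d)..t, a τ x, Z t x⟫ := by
        rw [intervalIntegral.integral_of_le (by linarith),
          intervalIntegral.integral_of_le (by linarith), real_inner_comm]
        simp only [real_inner_comm (Z t x)]
        exact integral_inner (haint x).1 _
      have h1n : IntervalIntegrable (fun τ => -⟪a τ x, Z t x⟫) volume (t - d) t := h1.neg
      rw [intervalIntegral.integral_add h1n ((hgint x).mul_const _),
        intervalIntegral.integral_neg, intervalIntegral.integral_mul_const, h2]
      simp only [hK, backAvg, real_inner_smul_left, smul_eq_mul]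
      ring
  have hwk := h.weak_of_hasGradientAt (s := t - d) (t := t)
    ⟨by linarith [ht.1], by linarith [ht.2]⟩ ⟨by linarith [ht.1], by linarith [ht.2]⟩
    (by linarith) (hwZ t) (hZB t) (hB t) (hR t)
  have hswap : ∫ τ in (t - d)..t, ∫ x, (-⟪a τ x, Z t x⟫ + g τ x * w t x)
      = ∫ x, ∫ τ in (t - d)..t, (-⟪a τ x, Z t x⟫ + g τ x * w t x) := by
    simp only [intervalIntegral.integral_of_le (show t - d ≤ t by linarith)]
    refine integral_integral_swap ?_
    have hm : Measurable fun p : ℝ × E => -⟪a p.1 p.2, Z t p.2⟫ + g p.1 p.2 * w t p.2 :=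
      (h.measurable_flux.inner (hZm.comp (measurable_const.prodMk measurable_snd))).neg.add
        (h.measurable_source.mul (hw.measurable.comp (measurable_const.prodMk measurable_snd)))
    refine Integrable.mono' (g := (univ ×ˢ Metric.closedBall (0 : E) R).indicator
      fun _ => 2 * C * B) ?_ hm.aestronglyMeasurable (Eventually.of_forall fun p => ?_)
    · rw [integrable_indicator_iff (MeasurableSet.univ.prod measurableSet_closedBall)]
      refine integrableOn_const ?_
      rw [Measure.prod_prod]
      refine ENNReal.mul_ne_top ?_ measure_closedBall_lt_top.ne
      simp
    · refine (hbound (a p.1 p.2) (g p.1 p.2) (t, p.2) (h.norm_flux_le _ _)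
        (h.abs_source_le _ _)).trans ?_
      by_cases hp : p.2 ∈ Metric.closedBall (0 : E) R
      · rw [indicator_of_mem (show (t, p.2) ∈ Q from ⟨ht, hp⟩),
          indicator_of_mem (show p ∈ univ ×ˢ Metric.closedBall (0 : E) R from ⟨mem_univ _, hp⟩)]
      · rw [indicator_of_notMem fun hq : (t, p.2) ∈ Q => hp hq.2,
          indicator_of_notMem fun hq => hp hq.2]
  simp only [hinner]
  rw [integral_const_mul, ← hswap, ← hwk, ← integral_const_mul]
  refine integral_congr_ae (Eventually.of_forall fun x => ?_)
  simp only
  ring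

end DivForm

section Divergence

open Topology

variable {E : Type*} [NormedAddCommGroup E] [InnerProductSpace ℝ E]

/-- The trace of an endomorphism, as a function of continuous linear maps. -/
noncomputable def trCLM (T : E →L[ℝ] E) : ℝ := LinearMap.trace ℝ E (T : E →ₗ[ℝ] E)

theorem trCLM_add (S T : E →L[ℝ] E) : trCLM (S + T) = trCLM S + trCLM T := by
  simp [trCLM]

theorem trCLM_smul (r : ℝ) (T : E →L[ℝ] E) : trCLM (r • T) = r * trCLM T := by
  simp [trCLM]

theorem trCLM_eq_sum {ι : Type*} [Fintype ι] (b : OrthonormalBasis ι ℝ E) (T : E →L[ℝ] E) :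
    trCLM T = ∑ i, ⟪b i, T (b i)⟫ :=
  LinearMap.trace_eq_sum_inner _ b

variable [FiniteDimensional ℝ E]

theorem continuous_trCLM : Continuous (trCLM : (E →L[ℝ] E) → ℝ) :=
  ((LinearMap.trace ℝ E).comp
    (ContinuousLinearMap.coeLM (R := ℝ) (M := E) (N₃ := E) ℝ)).continuous_of_finiteDimensional

variable [MeasurableSpace E] [BorelSpace E]

/-- Integration by parts against a function vanishing outside the domain of the vector field. -/
theorem integral_inner_gradient_eq_neg {b Z : E → E} {B : E → E →L[ℝ] E} {w : E → ℝ} {c : ℝ}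
    (hw : ∀ x, HasGradientAt w (Z x) x) (hZ : ∀ x, ‖Z x‖ ≤ c) (hcs : HasCompactSupport w)
    (hb : ∀ x ∈ tsupport w, HasFDerivAt b (B x) x) (hB : ∀ x ∈ tsupport w, ContinuousAt B x) :
    ∫ x, ⟪b x, Z x⟫ = -∫ x, trCLM (B x) * w x := by
  have hwc : Continuous w := continuous_iff_continuousAt.2 fun x => (hw x).hasFDerivAt.continuousAt
  have hZm : Measurable Z := measurable_of_hasGradientAt hw
  have hZ0 : ∀ x, x ∉ tsupport w → Z x = 0 := fun x hx =>
    (hw x).unique (((hasGradientAt_const (𝕜 := ℝ) x (0 : ℝ))).congr_of_eventuallyEq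
      (notMem_tsupport_iff_eventuallyEq.1 hx))
  have hcw : ∀ k : E → ℝ, (∀ x ∈ tsupport w, ContinuousAt k x) →
      Integrable fun x => k x * w x := fun k hk => by
    refine Continuous.integrable_of_hasCompactSupport (continuous_of_tsupport fun x hx => ?_)
      hcs.mul_left
    exact (hk x (tsupport_mul_subset_right hx)).mul hwc.continuousAt
  have hcZ : ∀ k : E → ℝ, (∀ x ∈ tsupport w, ContinuousAt k x) → ∀ e : E,
      Integrable fun x => k x * ⟪Z x, e⟫ := fun k hk e => by
    have h1 : IntegrableOn (fun x => k x * ⟪Z x, e⟫) (tsupport w) := by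
      refine Integrable.mul_bdd (c := c * ‖e‖)
        (ContinuousOn.integrableOn_compact hcs fun x hx => (hk x hx).continuousWithinAt)
        (hZm.inner measurable_const).aestronglyMeasurable (Eventually.of_forall fun x => ?_)
      exact (norm_inner_le_norm _ _).trans (by gcongr; exact hZ x)
    refine (integrableOn_iff_integrable_of_support_subset fun x hx => ?_).1 h1
    by_contra hx'
    exact hx (by simp [hZ0 x hx'])
  set e := stdOrthonormalBasis ℝ E
  have key : ∀ i, ∫ x, ⟪b x, e i⟫ * ⟪Z x, e i⟫ = -∫ x, ⟪e i, B x (e i)⟫ * w x := fun i => by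
    have hbi : ∀ x ∈ tsupport w, HasFDerivAt (fun x => ⟪b x, e i⟫)
        ((innerSL ℝ (e i)).comp (B x)) x := fun x hx =>
      ((innerSL ℝ (e i)).hasFDerivAt.comp x (hb x hx)).congr_of_eventuallyEq
        (Eventually.of_forall fun y => real_inner_comm _ _)
    have := integral_bilinear_hasFDerivAt_right_eq_neg_left_of_integrable (μ := (volume : Measure E))
      (f := fun x => ⟪b x, e i⟫) (f' := fun x => (innerSL ℝ (e i)).comp (B x))
      (g := w) (g' := fun x => InnerProductSpace.toDual ℝ E (Z x)) (v := e i)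
      (B := ContinuousLinearMap.mul ℝ ℝ) ?_ ?_ ?_ hbi fun x _ => (hw x).hasFDerivAt
    · simpa using this
    · refine hcw (fun x => ⟪e i, B x (e i)⟫) fun x hx => ?_
      exact continuousAt_const.inner ((hB x hx).clm_apply continuousAt_const)
    · exact hcZ _ (fun x hx => (hbi x hx).continuousAt) (e i)
    · exact hcw _ fun x hx => (hbi x hx).continuousAt
  have e1 : ∀ x, ⟪b x, Z x⟫ = ∑ i, ⟪b x, e i⟫ * ⟪Z x, e i⟫ := fun x => by
    rw [← e.sum_inner_mul_inner]
    exact Finset.sum_congr rfl fun i _ => by rw [real_inner_comm (e i) (Z x)]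
  simp only [e1, trCLM_eq_sum e, Finset.sum_mul]
  rw [integral_finsetSum _ fun i _ => ?_, integral_finsetSum _ fun i _ => ?_,
    Finset.sum_congr rfl fun i _ => key i, Finset.sum_neg_distrib]
  · exact hcw (fun x => ⟪e i, B x (e i)⟫) fun x hx =>
      continuousAt_const.inner ((hB x hx).clm_apply continuousAt_const)
  · exact hcZ _ (fun x hx => (hb x hx).continuousAt.inner continuousAt_const) (e i)

end Divergence

section Comparison

open Topology

theorem hasDerivAt_max_zero_sq (r : ℝ) : HasDerivAt (fun s : ℝ => max s 0 ^ 2) (2 * max r 0) r := by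
  rcases lt_trichotomy r 0 with h | rfl | h
  · rw [max_eq_right h.le, mul_zero]
    refine (hasDerivAt_const r (0 : ℝ)).congr_of_eventuallyEq ?_
    filter_upwards [gt_mem_nhds h] with s hs
    simp [max_eq_right hs.le]
  · rw [max_self, mul_zero, hasDerivAt_iff_isLittleO_nhds_zero]
    refine Asymptotics.IsBigO.trans_isLittleO (g := fun h : ℝ => h ^ 2) ?_ ?_
    · refine Asymptotics.isBigO_of_le _ fun s => ?_
      simp only [zero_add, max_self, smul_zero, sub_zero, norm_pow]
      rw [zero_pow two_ne_zero, sub_zero, norm_pow]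
      gcongr
      rw [Real.norm_eq_abs, Real.norm_eq_abs, abs_of_nonneg (le_max_right _ _)]
      exact max_le (le_abs_self s) (abs_nonneg s)
    · exact Asymptotics.isLittleO_pow_id one_lt_two
  · rw [max_eq_left h.le]
    have := (hasDerivAt_id r).pow 2
    simp only [id, Nat.cast_ofNat, mul_one] at this
    refine HasDerivAt.congr_of_eventuallyEq (by simpa using this) ?_
    filter_upwards [lt_mem_nhds h] with s hs
    simp [max_eq_left hs.le]

theorem max_zero_cube_sub_le (a b : ℝ) :
    (max a 0 ^ 3 - max b 0 ^ 3) / 3 ≤ (a - b) * max a 0 ^ 2 := by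
  rcases le_total a 0 with ha | ha
  · have : 0 ≤ max b 0 ^ 3 := by positivity
    rw [max_eq_right ha]
    rw [zero_pow three_ne_zero, zero_pow two_ne_zero, mul_zero, zero_sub]
    linarith
  · rw [max_eq_left ha]
    rcases le_total b 0 with hb | hb
    · rw [max_eq_right hb]
      nlinarith [pow_nonneg ha 3, mul_nonneg (neg_nonneg.2 hb) (sq_nonneg a)]
    · rw [max_eq_left hb]
      nlinarith [mul_nonneg (sq_nonneg (a - b)) (by linarith : 0 ≤ 2 * a + b)]

variable {E : Type*} [NormedAddCommGroup E] [InnerProductSpace ℝ E] [FiniteDimensional ℝ E]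
  [MeasurableSpace E] [BorelSpace E]
variable {S₁ S₂ : ℝ} {v : ℝ → E → ℝ} {A : E → E} {G : ℝ → E → E} {g : ℝ → E → ℝ} {C F : ℝ}
  {DA : E → E →L[ℝ] E}

set_option maxHeartbeats 1000000 in
/-- A smooth function which is a strict supersolution wherever it does not exceed the
solution `v`, and exceeds `v` outside a compact set, lies above `v`. -/
theorem IsDivFormSol.le_of_strict_supersolution
    (h : IsDivFormSol (Ioo S₁ S₂) v (fun t x => A (G t x)) g C)
    (hG : ∀ t x, HasGradientAt (v t) (G t x) x) (hGm : Measurable fun p : ℝ × E => G p.1 p.2)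
    (hGC : ∀ t x, ‖G t x‖ ≤ C) (hgF : ∀ t x, g t x ≤ F)
    (hmono : ∀ y z, 0 ≤ ⟪A y - A z, y - z⟫)
    (hA : ∀ z ≠ 0, HasFDerivAt A (DA z) z) (hDA : ContinuousOn DA {0}ᶜ)
    {φ φt : ℝ → E → ℝ} {P : ℝ → E → E} {H : ℝ → E → E →L[ℝ] E}
    (hφ : Continuous fun p : ℝ × E => φ p.1 p.2)
    (hφt : ∀ t x, HasDerivAt (fun s => φ s x) (φt t x) t)
    (hφtc : Continuous fun p : ℝ × E => φt p.1 p.2)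
    (hP : ∀ t x, HasGradientAt (φ t) (P t x) x) (hPc : Continuous fun p : ℝ × E => P p.1 p.2)
    (hH : ∀ t x, HasFDerivAt (P t) (H t x) x) (hHc : Continuous fun p : ℝ × E => H p.1 p.2)
    {τ₁ τ₂ R : ℝ} (hτ₁ : S₁ < τ₁) (hτ₂ : τ₂ < S₂)
    (hloc : ∀ t x, φ t x ≤ v t x → t ∈ Icc τ₁ τ₂ ∧ ‖x‖ ≤ R)
    (hP0 : ∀ t x, φ t x ≤ v t x → P t x ≠ 0)
    (hstrict : ∀ t x, φ t x ≤ v t x → trCLM (DA (P t x) ∘L H t x) + F < φt t x) (t : ℝ) (x : E) :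
    v t x ≤ φ t x := by
  set s : ℝ × E → ℝ := fun p => max (v p.1 p.2 - φ p.1 p.2) 0 with hs
  have hsc : Continuous s := (h.continuous.sub hφ).max continuous_const
  have hs0 : ∀ p, 0 ≤ s p := fun p => le_max_right _ _
  set w : ℝ → E → ℝ := fun t x => s (t, x) ^ 2 with hw
  set Z : ℝ → E → E := fun t x => (2 * s (t, x)) • (G t x - P t x) with hZ
  have hwc : Continuous fun p : ℝ × E => w p.1 p.2 := hsc.pow 2
  set Q : Set (ℝ × E) := Icc τ₁ τ₂ ×ˢ Metric.closedBall (0 : E) R with hQ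
  have hQc : IsCompact Q := isCompact_Icc.prod (isCompact_closedBall 0 R)
  have hmemQ : ∀ p : ℝ × E, φ p.1 p.2 ≤ v p.1 p.2 → p ∈ Q := fun p hp =>
    ⟨(hloc p.1 p.2 hp).1, mem_closedBall_zero_iff.2 (hloc p.1 p.2 hp).2⟩
  have hsQ : ∀ p, p ∉ Q → s p = 0 := fun p hp =>
    max_eq_right (sub_nonpos.2 (not_le.1 fun hle => hp (hmemQ p hle)).le)
  have hclosed : IsClosed {p : ℝ × E | φ p.1 p.2 ≤ v p.1 p.2} := isClosed_le hφ h.continuous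
  have hts : tsupport s ⊆ {p : ℝ × E | φ p.1 p.2 ≤ v p.1 p.2} := by
    refine closure_minimal (fun p hp => ?_) hclosed
    by_contra hlt
    exact hp (max_eq_right (sub_nonpos.2 (not_le.1 hlt).le))
  have hcss : HasCompactSupport s := HasCompactSupport.of_support_subset_isCompact hQc fun p hp => by
    by_contra hpQ
    exact hp (hsQ p hpQ)
  have hcsw : HasCompactSupport fun p : ℝ × E => w p.1 p.2 :=
    hcss.comp_left (g := fun r : ℝ => r ^ 2) (by simp)
  have hwi : Integrable fun p : ℝ × E => w p.1 p.2 := hwc.integrable_of_hasCompactSupport hcsw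
  have hwZ : ∀ t x, HasGradientAt (w t) (Z t x) x := fun t x => by
    have h1 := (hG t x).hasFDerivAt.sub (hP t x).hasFDerivAt
    have h2 := (hasDerivAt_max_zero_sq (v t x - φ t x)).comp_hasFDerivAt x h1
    rw [hasGradientAt_iff_hasFDerivAt]
    rw [← map_sub, ← LinearIsometryEquiv.map_smul] at h2
    exact h2
  have hPcont : ∀ t, Continuous (P t) := fun t => hPc.comp (by fun_prop : Continuous fun x => (t, x))
  have hwtc : ∀ t, Continuous (w t) := fun t => hwc.comp (by fun_prop : Continuous fun x => (t, x))
  have hZm : Measurable fun p : ℝ × E => Z p.1 p.2 :=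
    (hsc.measurable.const_mul 2).smul (hGm.sub hPc.measurable)
  obtain ⟨B₁, hB₁⟩ := hcsw.exists_bound_of_continuous hwc
  obtain ⟨B₂, hB₂⟩ := (HasCompactSupport.mul_right (f' := fun p : ℝ × E => C + ‖P p.1 p.2‖)
    hcss).exists_bound_of_continuous (hsc.mul (continuous_const.add hPc.norm))
  have hC0 : 0 ≤ C := (abs_nonneg _).trans (h.abs_value_le 0 0)
  have hZB : ∀ t x, ‖Z t x‖ ≤ max B₁ (2 * B₂) := fun t x => by
    refine le_max_of_le_right ?_
    have h1 := hB₂ (t, x)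
    rw [Pi.mul_apply, norm_mul, Real.norm_of_nonneg (hs0 _),
      Real.norm_of_nonneg (add_nonneg hC0 (norm_nonneg _))] at h1
    have h2 : ‖G t x - P t x‖ ≤ C + ‖P t x‖ := (norm_sub_le _ _).trans (by linarith [hGC t x])
    rw [hZ]
    simp only [norm_smul, norm_mul, Real.norm_of_nonneg (hs0 _), Real.norm_two]
    have := mul_le_mul_of_nonneg_left h2 (hs0 (t, x))
    linarith
  have hlimv := h.tendsto_integral_difference_quotient hwc hZm hwZ (B := max B₁ (2 * B₂))
    (R := R + 1) (τ₁ := τ₁) (τ₂ := τ₂) (fun t x => (hB₁ (t, x)).trans (le_max_left _ _)) hZB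
    (fun t x hx => by
      have : s (t, x) = 0 := hsQ _ fun hq => by
        have := mem_closedBall_zero_iff.1 hq.2
        simp only at this
        linarith
      simp [hw, this])
    (fun t x ht => by
      have : s (t, x) = 0 := hsQ _ fun hq => ht hq.1
      simp [hw, this]) hτ₁ hτ₂
  have hlimφ : Tendsto (fun n : ℕ => ∫ p : ℝ × E, (φ p.1 p.2 - φ (p.1 - 1 / ((n : ℝ) + 1)) p.2)
      / (1 / ((n : ℝ) + 1)) * w p.1 p.2) atTop (𝓝 (∫ p : ℝ × E, φt p.1 p.2 * w p.1 p.2)) := by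
    obtain ⟨K, hK⟩ := ((isCompact_Icc (a := τ₁ - 1) (b := τ₂)).prod
      (isCompact_closedBall (0 : E) R)).exists_bound_of_continuousOn hφtc.continuousOn
    refine tendsto_integral_of_dominated_convergence (fun p => K * ‖w p.1 p.2‖) (fun n => ?_)
      (hwi.norm.const_mul K) (fun n => Eventually.of_forall fun p => ?_)
      (Eventually.of_forall fun p => ?_)
    · have h1 : Continuous fun p : ℝ × E => φ (p.1 - 1 / ((n : ℝ) + 1)) p.2 :=
        hφ.comp (by fun_prop : Continuous fun p : ℝ × E => (p.1 - 1 / ((n : ℝ) + 1), p.2))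
      exact (((hφ.sub h1).div_const _).mul hwc).aestronglyMeasurable
    · by_cases hp : p ∈ Q
      swap
      · simp [hw, hsQ p hp]
      have hd : 0 < 1 / ((n : ℝ) + 1) := by positivity
      have hd1 : 1 / ((n : ℝ) + 1) ≤ 1 := by
        rw [div_le_one (by positivity)]
        linarith [n.cast_nonneg (α := ℝ)]
      rw [norm_mul]
      gcongr
      have hmvt := Convex.norm_image_sub_le_of_norm_hasDerivWithin_le (C := K)
        (f := fun τ => φ τ p.2) (f' := fun τ => φt τ p.2) (s := Icc (τ₁ - 1) τ₂)
        (x := p.1 - 1 / ((n : ℝ) + 1)) (y := p.1)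
        (fun τ _ => (hφt τ p.2).hasDerivWithinAt) (fun τ hτ => hK (τ, p.2) ⟨hτ, hp.2⟩)
        (convex_Icc _ _) ⟨by linarith [hp.1.1], by linarith [hp.1.2]⟩
        ⟨by linarith [hp.1.1], hp.1.2⟩
      rw [sub_sub_cancel, Real.norm_of_nonneg hd.le] at hmvt
      rw [norm_div, Real.norm_of_nonneg hd.le, div_le_iff₀ hd]
      exact hmvt
    · refine Tendsto.mul_const _ ?_
      have hseq : Tendsto (fun n : ℕ => -(1 / ((n : ℝ) + 1))) atTop (𝓝[≠] 0) := by
        refine tendsto_nhdsWithin_iff.2 ⟨?_, Eventually.of_forall fun n => ?_⟩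
        · simpa using (tendsto_one_div_add_atTop_nhds_zero_nat (𝕜 := ℝ)).neg
        · have : (0 : ℝ) < 1 / ((n : ℝ) + 1) := by positivity
          exact (neg_lt_zero.2 this).ne
      refine ((hφt p.1 p.2).tendsto_slope_zero.comp hseq).congr fun n => ?_
      simp only [Function.comp_apply, smul_eq_mul, ← sub_eq_add_neg]
      have : (n : ℝ) + 1 ≠ 0 := by positivity
      field_simp
      ring
  have hle1 : ∫ p : ℝ × E, φt p.1 p.2 * w p.1 p.2
      ≤ ∫ p : ℝ × E, (-⟪A (G p.1 p.2), Z p.1 p.2⟫ + g p.1 p.2 * w p.1 p.2) := by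
    refine le_of_tendsto_of_tendsto' hlimφ hlimv fun n => ?_
    set d : ℝ := 1 / ((n : ℝ) + 1) with hd
    have hd0 : 0 < d := by positivity
    have hsh : Continuous fun p : ℝ × E => (p.1 - d, p.2) := by fun_prop
    have hci : ∀ k : ℝ → E → ℝ, (Continuous fun p : ℝ × E => k p.1 p.2) →
        Integrable fun p : ℝ × E => (k p.1 p.2 - k (p.1 - d) p.2) / d * w p.1 p.2 := fun k hk =>
      Continuous.integrable_of_hasCompactSupport
        (((hk.sub (hk.comp hsh)).div_const d).mul hwc) hcsw.mul_left
    have hs3 : Integrable fun p => s p ^ 3 :=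
      Continuous.integrable_of_hasCompactSupport (f := fun p => s p ^ 3) (hsc.pow 3)
        (hcss.comp_left (g := fun r : ℝ => r ^ 3) (by simp))
    have e : ∀ p : ℝ × E, (p.1 - d, p.2) = p - (d, (0 : E)) := fun p => by ext <;> simp
    have hs3' : Integrable fun p : ℝ × E => s (p.1 - d, p.2) ^ 3 := by
      simp only [e]
      rw [Measure.volume_eq_prod] at hs3 ⊢
      exact hs3.comp_sub_right (d, (0 : E))
    have hz : ∫ p : ℝ × E, (s p ^ 3 - s (p.1 - d, p.2) ^ 3) / (3 * d) = 0 := by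
      rw [integral_div, integral_sub hs3 hs3']
      simp only [e]
      rw [Measure.volume_eq_prod, integral_sub_right_eq_self (fun p => s p ^ 3) (d, (0 : E)),
        sub_self, zero_div]
    have hmain : ∫ p : ℝ × E, (s p ^ 3 - s (p.1 - d, p.2) ^ 3) / (3 * d)
        ≤ ∫ p : ℝ × E, ((v p.1 p.2 - v (p.1 - d) p.2) / d * w p.1 p.2
          - (φ p.1 p.2 - φ (p.1 - d) p.2) / d * w p.1 p.2) := by
      refine integral_mono ((hs3.sub hs3').div_const _) ((hci v h.continuous).sub (hci φ hφ))
        fun p => ?_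
      have := max_zero_cube_sub_le (v p.1 p.2 - φ p.1 p.2) (v (p.1 - d) p.2 - φ (p.1 - d) p.2)
      have := div_le_div_of_nonneg_right this hd0.le
      simp only [hw, hs]
      calc _ = _ := ?_
        _ ≤ _ := this
        _ = _ := ?_
      · rw [div_div]
      · ring
    rw [hz, integral_sub (hci v h.continuous) (hci φ hφ)] at hmain
    linarith
  have hsAP : Continuous fun p : ℝ × E => s p • A (P p.1 p.2) := by
    refine continuous_of_tsupport fun p hp => ?_
    have hp' := hts (tsupport_smul_subset_left s _ hp)
    exact hsc.continuousAt.smul ((hA _ (hP0 _ _ hp')).continuousAt.comp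
      (f := fun p : ℝ × E => P p.1 p.2) hPc.continuousAt)
  have hsAPi : Integrable fun p : ℝ × E => ⟪A (P p.1 p.2), Z p.1 p.2⟫ := by
    have hcs1 : HasCompactSupport fun p : ℝ × E => s p • A (P p.1 p.2) := hcss.smul_right
    have h1 : Integrable fun p : ℝ × E => ⟪s p • A (P p.1 p.2), G p.1 p.2⟫ := by
      refine ((hsAP.integrable_of_hasCompactSupport hcs1).norm.mul_const C).mono'
        (hsAP.measurable.inner hGm).aestronglyMeasurable (Eventually.of_forall fun p => ?_)
      exact (norm_inner_le_norm _ _).trans (by gcongr; exact hGC _ _)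
    have h2 : Integrable fun p : ℝ × E => ⟪s p • A (P p.1 p.2), P p.1 p.2⟫ :=
      (hsAP.inner hPc).integrable_of_hasCompactSupport (by
        refine hcs1.mono fun p hp => ?_
        intro h0
        exact hp (by simp only at h0 ⊢; rw [h0, inner_zero_left]))
    refine ((h1.sub h2).const_mul 2).congr (Eventually.of_forall fun p => ?_)
    simp only [hZ, Pi.sub_apply, real_inner_smul_left, real_inner_smul_right, inner_sub_right]
    ring
  have htrc : Continuous fun p : ℝ × E => trCLM (DA (P p.1 p.2) ∘L H p.1 p.2) * w p.1 p.2 := by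
    refine continuous_of_tsupport fun p hp => ?_
    have hsub : (Function.support fun p : ℝ × E => w p.1 p.2) ⊆ Function.support s :=
      fun y hy h0 => hy (by simp [hw, h0])
    have hp1 : p ∈ tsupport s := closure_mono hsub (tsupport_mul_subset_right hp)
    have hp0 := hP0 _ _ (hts hp1)
    have h1 : ContinuousAt (fun p : ℝ × E => DA (P p.1 p.2)) p :=
      (hDA.continuousAt (isOpen_compl_singleton.mem_nhds hp0)).comp
        (f := fun p : ℝ × E => P p.1 p.2) hPc.continuousAt
    exact (continuous_trCLM.continuousAt.comp (h1.clm_comp hHc.continuousAt)).mul hwc.continuousAt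
  have htri : Integrable fun p : ℝ × E => trCLM (DA (P p.1 p.2) ∘L H p.1 p.2) * w p.1 p.2 :=
    htrc.integrable_of_hasCompactSupport hcsw.mul_left
  have hibp : ∫ p : ℝ × E, ⟪A (P p.1 p.2), Z p.1 p.2⟫
      = -∫ p : ℝ × E, trCLM (DA (P p.1 p.2) ∘L H p.1 p.2) * w p.1 p.2 := by
    rw [Measure.volume_eq_prod] at hsAPi htri ⊢
    rw [integral_prod _ hsAPi, integral_prod _ htri, ← integral_neg]
    refine integral_congr_ae (Eventually.of_forall fun t => ?_)
    have hin : ∀ x ∈ tsupport (w t), P t x ≠ 0 := fun x hx => by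
      have : IsClosed {x : E | φ t x ≤ v t x} :=
        hclosed.preimage (by fun_prop : Continuous fun x : E => (t, x))
      refine hP0 _ _ ((closure_minimal (fun y hy => ?_) this) hx)
      by_contra hlt
      refine hy ?_
      have : s (t, y) = 0 := max_eq_right (sub_nonpos.2 (not_le.1 hlt).le)
      simp [hw, this]
    refine integral_inner_gradient_eq_neg (hwZ t) (hZB t) ?_ (fun x hx => ?_) fun x hx => ?_
    · refine HasCompactSupport.of_support_subset_isCompact (isCompact_closedBall (0 : E) R)
        fun x hx => ?_
      by_contra hxR
      exact hx (by simp [hw, hsQ (t, x) fun hq => hxR hq.2])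
    · exact (hA _ (hin x hx)).comp x (hH t x)
    · exact ((hDA.continuousAt (isOpen_compl_singleton.mem_nhds (hin x hx))).comp
        (hPcont t).continuousAt).clm_comp
        (hHc.comp (by fun_prop : Continuous fun x => (t, x))).continuousAt
  have hint2 : Integrable fun p : ℝ × E => -⟪A (P p.1 p.2), Z p.1 p.2⟫ + F * w p.1 p.2 :=
    hsAPi.neg.add (hwi.const_mul F)
  have hle2 : ∫ p : ℝ × E, (-⟪A (G p.1 p.2), Z p.1 p.2⟫ + g p.1 p.2 * w p.1 p.2)
      ≤ ∫ p : ℝ × E, (-⟪A (P p.1 p.2), Z p.1 p.2⟫ + F * w p.1 p.2) := by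
    refine integral_mono ?_ hint2 fun p => ?_
    · refine Integrable.add (Integrable.neg ?_) ?_
      · have hb : ∀ p : ℝ × E, ‖⟪A (G p.1 p.2), Z p.1 p.2⟫‖
            ≤ C * (Q.indicator (fun _ => max B₁ (2 * B₂)) p) := fun p => by
          refine (norm_inner_le_norm _ _).trans ?_
          by_cases hp : p ∈ Q
          · rw [indicator_of_mem hp]
            gcongr
            · exact h.norm_flux_le _ _
            · exact hZB _ _
          · rw [indicator_of_notMem hp]
            simp [hZ, hsQ p hp]
        refine Integrable.mono' (Integrable.const_mul ?_ C)
          (h.measurable_flux.inner hZm).aestronglyMeasurable (Eventually.of_forall hb)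
        rw [integrable_indicator_iff hQc.measurableSet]
        exact integrableOn_const hQc.measure_lt_top.ne
      · exact hwi.bdd_mul h.measurable_source.aestronglyMeasurable
          (Eventually.of_forall fun p => h.abs_source_le _ _)
    · have h1 := mul_nonneg (hs0 p) (hmono (G p.1 p.2) (P p.1 p.2))
      have h2 := mul_le_mul_of_nonneg_right (hgF p.1 p.2) (sq_nonneg (s p))
      simp only [hZ, hw, real_inner_smul_right]
      rw [inner_sub_left] at h1
      linarith
  have hfin : ∫ p : ℝ × E, (φt p.1 p.2 - trCLM (DA (P p.1 p.2) ∘L H p.1 p.2) - F) * w p.1 p.2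
      ≤ 0 := by
    have hi : Integrable fun p : ℝ × E => φt p.1 p.2 * w p.1 p.2 :=
      (hφtc.mul hwc).integrable_of_hasCompactSupport hcsw.mul_left
    simp only [sub_mul]
    have hi' : Integrable fun p : ℝ × E =>
        φt p.1 p.2 * w p.1 p.2 - trCLM (DA (P p.1 p.2) ∘L H p.1 p.2) * w p.1 p.2 := hi.sub htri
    rw [integral_sub hi' (hwi.const_mul F), integral_sub hi htri]
    rw [integral_add hsAPi.fun_neg (hwi.const_mul F), integral_neg, hibp, neg_neg] at hle2
    linarith
  by_contra hlt
  rw [not_le] at hlt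
  have hcont : Continuous fun p : ℝ × E =>
      (φt p.1 p.2 - trCLM (DA (P p.1 p.2) ∘L H p.1 p.2) - F) * w p.1 p.2 := by
    simp only [sub_mul]
    exact ((hφtc.mul hwc).sub htrc).sub (continuous_const.mul hwc)
  refine absurd (Continuous.integral_pos_of_hasCompactSupport_nonneg_nonzero (x := (t, x)) hcont
    hcsw.mul_left (fun p => ?_) ?_ (μ := (volume : Measure ℝ).prod (volume : Measure E))) (not_lt.2 hfin)
  · by_cases hp : φ p.1 p.2 ≤ v p.1 p.2
    · exact mul_nonneg (by linarith [hstrict _ _ hp]) (sq_nonneg _)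
    · have : s p = 0 := max_eq_right (sub_nonpos.2 (not_le.1 hp).le)
      simp [hw, this]
  · have h1 := hstrict t x hlt.le
    have h2 : 0 < s (t, x) := lt_max_of_lt_left (sub_pos.2 hlt)
    exact (mul_pos (by simp only; linarith) (pow_pos h2 2)).ne'

end Comparison

section Viscosity

open Topology

section QuarticTest

variable {E : Type*} [NormedAddCommGroup E] [InnerProductSpace ℝ E]
  (t₀ : ℝ) (x₀ : E) (v₀ b a : ℝ) (c p : E) (M : E →L[ℝ] E) (η K : ℝ)

/-- A quadratic polynomial in `(t, x)` plus radial quadratic and quartic terms. -/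
noncomputable def quarticTest (t : ℝ) (x : E) : ℝ :=
  v₀ + b * (t - t₀) + ⟪p, x - x₀⟫
    + (a * (t - t₀) ^ 2 + 2 * (t - t₀) * ⟪c, x - x₀⟫ + ⟪M (x - x₀), x - x₀⟫) / 2
    + η * ((t - t₀) ^ 2 + ‖x - x₀‖ ^ 2) + K * ((t - t₀) ^ 2 + ‖x - x₀‖ ^ 2) ^ 2

/-- Time derivative of `quarticTest`. -/
noncomputable def quarticTestTime (t : ℝ) (x : E) : ℝ :=
  b + a * (t - t₀) + ⟪c, x - x₀⟫ + 2 * η * (t - t₀)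
    + 4 * K * ((t - t₀) ^ 2 + ‖x - x₀‖ ^ 2) * (t - t₀)

/-- Spatial gradient of `quarticTest`. -/
noncomputable def quarticTestGrad (t : ℝ) (x : E) : E :=
  p + (t - t₀) • c + M (x - x₀) + (2 * η + 4 * K * ((t - t₀) ^ 2 + ‖x - x₀‖ ^ 2)) • (x - x₀)

/-- Spatial Hessian of `quarticTest`. -/
noncomputable def quarticTestHess (t : ℝ) (x : E) : E →L[ℝ] E :=
  M + (2 * η + 4 * K * ((t - t₀) ^ 2 + ‖x - x₀‖ ^ 2)) • ContinuousLinearMap.id ℝ E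
    + (8 * K) • (innerSL ℝ (x - x₀)).smulRight (x - x₀)

theorem continuous_quarticTest :
    Continuous fun q : ℝ × E => quarticTest t₀ x₀ v₀ b a c p M η K q.1 q.2 := by
  unfold quarticTest
  fun_prop

theorem continuous_quarticTestTime :
    Continuous fun q : ℝ × E => quarticTestTime t₀ x₀ b a c η K q.1 q.2 := by
  unfold quarticTestTime
  fun_prop

theorem continuous_quarticTestGrad :
    Continuous fun q : ℝ × E => quarticTestGrad t₀ x₀ c p M η K q.1 q.2 := by
  unfold quarticTestGrad
  fun_prop

theorem continuous_quarticTestHess :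
    Continuous fun q : ℝ × E => quarticTestHess t₀ x₀ M η K q.1 q.2 := by
  unfold quarticTestHess
  have hs : Continuous fun q : ℝ × E => q.2 - x₀ := by fun_prop
  have h : Continuous fun q : ℝ × E => (8 * K) • (innerSL ℝ (q.2 - x₀)).smulRight (q.2 - x₀) :=
    (((ContinuousLinearMap.smulRightL ℝ E E).continuous.comp
      ((innerSL ℝ).continuous.comp hs)).clm_apply hs).const_smul (8 * K)
  exact (continuous_const.add (by fun_prop)).add h

theorem hasDerivAt_quarticTest (t : ℝ) (x : E) :
    HasDerivAt (fun s => quarticTest t₀ x₀ v₀ b a c p M η K s x)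
      (quarticTestTime t₀ x₀ b a c η K t x) t := by
  have h0 : HasDerivAt (fun s : ℝ => s - t₀) 1 t := (hasDerivAt_id t).sub_const t₀
  have h2 := h0.pow 2
  have h3 := h2.add_const (‖x - x₀‖ ^ 2)
  have := ((((h0.const_mul b).const_add v₀).add_const ⟪p, x - x₀⟫).add
    ((((h2.const_mul a).add ((h0.const_mul 2).mul_const ⟪c, x - x₀⟫)).add_const
      ⟪M (x - x₀), x - x₀⟫).div_const 2)).add (h3.const_mul η) |>.add ((h3.pow 2).const_mul K)
  refine this.congr_deriv ?_
  simp only [quarticTestTime, Pi.pow_apply]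
  push_cast
  ring

theorem hasGradientAt_quarticTest [CompleteSpace E] (hM : ∀ x y, ⟪M x, y⟫ = ⟪x, M y⟫)
    (t : ℝ) (x : E) :
    HasGradientAt (quarticTest t₀ x₀ v₀ b a c p M η K t)
      (quarticTestGrad t₀ x₀ c p M η K t x) x := by
  have h0 : HasFDerivAt (fun y : E => y - x₀) (ContinuousLinearMap.id ℝ E) x :=
    (hasFDerivAt_id x).sub_const x₀
  have h1 := h0.norm_sq
  have h2 := h1.const_add ((t - t₀) ^ 2)
  have hp := (hasFDerivAt_const p x).inner ℝ h0
  have hc := (hasFDerivAt_const c x).inner ℝ h0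
  have hq := (M.hasFDerivAt.comp x h0).inner ℝ h0
  have := ((((hp.const_add (v₀ + b * (t - t₀))).add
    ((((hc.const_mul (2 * (t - t₀))).const_add (a * (t - t₀) ^ 2)).add hq).mul_const
      (1 / 2)))).add (h2.const_mul η)).add ((h2.pow 2).const_mul K)
  rw [hasGradientAt_iff_hasFDerivAt]
  refine (this.congr_of_eventuallyEq (Eventually.of_forall fun y => ?_)).congr_fderiv ?_
  · simp only [quarticTest, Pi.add_apply, Function.comp_apply]
    ring
  · ext k
    simp only [quarticTestGrad, InnerProductSpace.toDual_apply_apply, inner_add_left,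
      real_inner_smul_left, Function.comp_apply]
    generalize x - x₀ = y
    simp
    rw [hM k, real_inner_comm (M y) k]
    ring

theorem hasFDerivAt_quarticTestGrad (t : ℝ) (x : E) :
    HasFDerivAt (quarticTestGrad t₀ x₀ c p M η K t) (quarticTestHess t₀ x₀ M η K t x) x := by
  have h0 : HasFDerivAt (fun y : E => y - x₀) (ContinuousLinearMap.id ℝ E) x :=
    (hasFDerivAt_id x).sub_const x₀
  have h2 := ((h0.norm_sq.const_add ((t - t₀) ^ 2)).const_mul (4 * K)).const_add (2 * η)
  have := ((M.hasFDerivAt.comp x h0).const_add (p + (t - t₀) • c)).add (h2.smul h0)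
  refine this.congr_fderiv ?_
  ext k
  simp [quarticTestHess, smul_smul, add_assoc]
  ring_nf

end QuarticTest

section

variable {E : Type*} [NormedAddCommGroup E] [InnerProductSpace ℝ E]

/-- A quadratic polynomial in `(r, y)` is bounded below by a multiple of `1 + r ^ 2 + ‖y‖ ^ 2`. -/
theorem neg_mul_one_add_le_quadratic (b a r : ℝ) (p c y : E) (M : E →L[ℝ] E) :
    -((|b| + ‖p‖ + |a| + ‖c‖ + ‖M‖) * (1 + (r ^ 2 + ‖y‖ ^ 2)))
      ≤ b * r + ⟪p, y⟫ + (a * r ^ 2 + 2 * r * ⟪c, y⟫ + ⟪M y, y⟫) / 2 := by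
  set n := r ^ 2 + ‖y‖ ^ 2 with hn
  have hn0 : 0 ≤ n := by positivity
  have hr1 : |r| ≤ 1 + n := by nlinarith [sq_abs r, sq_nonneg (|r| - 1), sq_nonneg ‖y‖]
  have hy1 : ‖y‖ ≤ 1 + n := by nlinarith [sq_nonneg (‖y‖ - 1), sq_nonneg r]
  have hry : 2 * (|r| * ‖y‖) ≤ 1 + n := by nlinarith [sq_abs r, sq_nonneg (|r| - ‖y‖)]
  have e1 : -(|b| * (1 + n)) ≤ b * r := by
    have := neg_abs_le (b * r)
    rw [abs_mul] at this
    nlinarith [abs_nonneg b]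
  have e2 : -(‖p‖ * (1 + n)) ≤ ⟪p, y⟫ := by
    have := (abs_le.1 (abs_real_inner_le_norm p y)).1
    nlinarith [norm_nonneg p]
  have e3 : -(|a| * (1 + n)) ≤ a * r ^ 2 := by
    have h1 := neg_abs_le (a * r ^ 2)
    rw [abs_mul, abs_of_nonneg (sq_nonneg r)] at h1
    nlinarith [mul_nonneg (abs_nonneg a) (sq_nonneg ‖y‖), abs_nonneg a]
  have e4 : -(‖c‖ * (1 + n)) ≤ 2 * r * ⟪c, y⟫ := by
    have h1 := neg_abs_le (2 * r * ⟪c, y⟫)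
    rw [abs_mul, abs_mul, abs_two] at h1
    have h2 := mul_le_mul_of_nonneg_left (abs_real_inner_le_norm c y) (abs_nonneg r)
    nlinarith [mul_le_mul_of_nonneg_left hry (norm_nonneg c)]
  have e5 : -(‖M‖ * (1 + n)) ≤ ⟪M y, y⟫ := by
    have h1 := (abs_le.1 (abs_real_inner_le_norm (M y) y)).1
    have h2 := mul_le_mul_of_nonneg_right (M.le_opNorm y) (norm_nonneg y)
    nlinarith [mul_nonneg (norm_nonneg M) (sq_nonneg r), norm_nonneg M]
  have e9 : 0 ≤ |a| * (1 + n) + ‖c‖ * (1 + n) + ‖M‖ * (1 + n) := by positivity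
  linarith

end


variable {E : Type*} [NormedAddCommGroup E] [InnerProductSpace ℝ E] [FiniteDimensional ℝ E]
  [MeasurableSpace E] [BorelSpace E]
variable {S₁ S₂ : ℝ} {v : ℝ → E → ℝ} {A : E → E} {G : ℝ → E → E} {g : ℝ → E → ℝ} {C F : ℝ}
  {DA : E → E →L[ℝ] E}

set_option maxHeartbeats 1000000 in
/-- A bounded weak solution is a viscosity subsolution: the equation holds as an inequality at
a second order expansion from above with nonzero slope. -/
theorem IsDivFormSol.le_of_expansion
    (h : IsDivFormSol (Ioo S₁ S₂) v (fun t x => A (G t x)) g C)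
    (hG : ∀ t x, HasGradientAt (v t) (G t x) x) (hGm : Measurable fun p : ℝ × E => G p.1 p.2)
    (hGC : ∀ t x, ‖G t x‖ ≤ C) (hgF : ∀ t x, g t x ≤ F)
    (hmono : ∀ y z, 0 ≤ ⟪A y - A z, y - z⟫)
    (hA : ∀ z ≠ 0, HasFDerivAt A (DA z) z) (hDA : ContinuousOn DA {0}ᶜ)
    {t₀ b a : ℝ} {x₀ c p : E} {M : E →L[ℝ] E} (ht₀ : t₀ ∈ Ioo S₁ S₂) (hp : p ≠ 0)
    (hM : ∀ x y, ⟪M x, y⟫ = ⟪x, M y⟫)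
    (htouch : ∀ η > 0, ∀ᶠ k in 𝓝 (0 : ℝ × E), v (t₀ + k.1) (x₀ + k.2)
      ≤ v t₀ x₀ + b * k.1 + ⟪p, k.2⟫ + (a * k.1 ^ 2 + 2 * k.1 * ⟪c, k.2⟫ + ⟪M k.2, k.2⟫) / 2
        + η * (k.1 ^ 2 + ‖k.2‖ ^ 2)) :
    b ≤ trCLM (DA p ∘L M) + F := by
  by_contra! hlt
  set τ := trCLM (DA p) with hτ
  set gap := b - (trCLM (DA p ∘L M) + F) with hgap
  have hgap0 : 0 < gap := sub_pos.2 hlt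
  set η := gap / (4 * (|τ| + 1)) with hη
  have hη0 : 0 < η := by positivity
  have hητ : 4 * η * τ < gap := by
    have h1 : 4 * η * (|τ| + 1) = gap := by
      rw [hη]
      field_simp
    nlinarith [le_abs_self τ]
  obtain ⟨ρ, hρ, hball⟩ := Metric.eventually_nhds_iff_ball.1 (htouch η hη0)
  set c₀ := |b| + ‖p‖ + |a| + ‖c‖ + ‖M‖ with hc₀
  have hC0 : 0 ≤ C := (abs_nonneg _).trans (h.abs_value_le 0 0)
  set K := (2 * C + c₀) / ρ ^ 4 + c₀ / ρ ^ 2 with hK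
  have hK0 : 0 ≤ K := by positivity
  have hglob : ∀ t x, v t x ≤ quarticTest t₀ x₀ (v t₀ x₀) b a c p M (2 * η) K t x
      - η * ((t - t₀) ^ 2 + ‖x - x₀‖ ^ 2) := fun t x => by
    have hexp := hball (t - t₀, x - x₀)
    simp only [quarticTest]
    simp only [add_sub_cancel] at hexp
    generalize t - t₀ = r at hexp ⊢
    generalize x - x₀ = y at hexp ⊢
    set n := r ^ 2 + ‖y‖ ^ 2 with hn
    have hn0 : 0 ≤ n := by positivity
    rcases lt_or_ge n (ρ ^ 2) with hnρ | hnρ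
    · have hr : |r| < ρ := abs_lt_of_sq_lt_sq (by nlinarith [sq_nonneg ‖y‖]) hρ.le
      have hy : ‖y‖ < ρ := by
        have := abs_lt_of_sq_lt_sq (a := ‖y‖) (b := ρ) (by nlinarith [sq_nonneg r]) hρ.le
        rwa [abs_norm] at this
      have := hexp (by
        rw [mem_ball_zero_iff, Prod.norm_def]
        exact max_lt hr hy)
      have : 0 ≤ K * n ^ 2 := by positivity
      linarith
    · have hv := abs_le.1 (h.abs_value_le t x)
      have hv0 := abs_le.1 (h.abs_value_le t₀ x₀)
      have hq := neg_mul_one_add_le_quadratic b a r p c y M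
      rw [← hc₀, ← hn] at hq
      have e6 : 2 * C + c₀ * (1 + n) ≤ K * n ^ 2 := by
        have h1 : (2 * C + c₀) / ρ ^ 4 * n ^ 2 ≥ 2 * C + c₀ := by
          rw [ge_iff_le, div_mul_eq_mul_div, le_div_iff₀ (by positivity)]
          refine mul_le_mul_of_nonneg_left ?_ (by positivity)
          nlinarith [sq_nonneg ρ]
        have h2 : c₀ / ρ ^ 2 * n ^ 2 ≥ c₀ * n := by
          rw [ge_iff_le, div_mul_eq_mul_div, le_div_iff₀ (by positivity), sq n, mul_assoc]
          exact mul_le_mul_of_nonneg_left (mul_le_mul_of_nonneg_left hnρ hn0) (by positivity)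
        rw [hK, add_mul]
        linarith
      have e8 : 0 ≤ η * n := by positivity
      linarith
  have hPc := continuous_quarticTestGrad t₀ x₀ c p M (2 * η) K
  have hHc := continuous_quarticTestHess t₀ x₀ M (2 * η) K
  have hTc := continuous_quarticTestTime t₀ x₀ b a c (2 * η) K
  have hP₀ : quarticTestGrad t₀ x₀ c p M (2 * η) K t₀ x₀ = p := by simp [quarticTestGrad]
  have hT₀ : quarticTestTime t₀ x₀ b a c (2 * η) K t₀ x₀ = b := by simp [quarticTestTime]
  have hH₀ : trCLM (DA p ∘L quarticTestHess t₀ x₀ M (2 * η) K t₀ x₀)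
      = trCLM (DA p ∘L M) + 4 * η * τ := by
    have : DA p ∘L quarticTestHess t₀ x₀ M (2 * η) K t₀ x₀ = DA p ∘L M + (4 * η) • DA p := by
      ext k
      simp [quarticTestHess]
      ring_nf
    rw [this, trCLM_add, trCLM_smul]
  have hnear : ∀ᶠ q in 𝓝 (t₀, x₀), quarticTestGrad t₀ x₀ c p M (2 * η) K q.1 q.2 ≠ 0 ∧
      trCLM (DA (quarticTestGrad t₀ x₀ c p M (2 * η) K q.1 q.2)
        ∘L quarticTestHess t₀ x₀ M (2 * η) K q.1 q.2) + F
        < quarticTestTime t₀ x₀ b a c (2 * η) K q.1 q.2 ∧ q.1 ∈ Ioo S₁ S₂ := by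
    refine (hPc.continuousAt.eventually_ne (by simpa only [hP₀] using hp)).and
      (Eventually.and ?_ (continuous_fst.continuousAt.eventually (Ioo_mem_nhds ht₀.1 ht₀.2)))
    have h1 : ContinuousAt (fun q : ℝ × E => DA (quarticTestGrad t₀ x₀ c p M (2 * η) K q.1 q.2))
        (t₀, x₀) :=
      (hDA.continuousAt (isOpen_compl_singleton.mem_nhds (by
        simpa only [hP₀, mem_compl_iff, mem_singleton_iff] using hp))).comp
        (f := fun q : ℝ × E => quarticTestGrad t₀ x₀ c p M (2 * η) K q.1 q.2) hPc.continuousAt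
    refine ((continuous_trCLM.continuousAt.comp (h1.clm_comp hHc.continuousAt)).add
      continuousAt_const).eventually_lt hTc.continuousAt ?_
    simp only [Pi.add_apply, Function.comp_apply, hP₀, hT₀, hH₀]
    linarith
  obtain ⟨δ₀, hδ₀, hδball⟩ := Metric.eventually_nhds_iff_ball.1 hnear
  set δ := δ₀ / 2 with hδ
  have hδ0 : 0 < δ := by positivity
  have hin : ∀ t x, quarticTest t₀ x₀ (v t₀ x₀) b a c p M (2 * η) K t x - η * δ ^ 2 ≤ v t x →
      |t - t₀| ≤ δ ∧ ‖x - x₀‖ ≤ δ := fun t x htx => by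
    have h1 : η * ((t - t₀) ^ 2 + ‖x - x₀‖ ^ 2) ≤ η * δ ^ 2 := by linarith [hglob t x]
    have h2 := le_of_mul_le_mul_left h1 hη0
    refine ⟨abs_le_of_sq_le_sq (by nlinarith [sq_nonneg ‖x - x₀‖]) hδ0.le, ?_⟩
    have := abs_le_of_sq_le_sq (a := ‖x - x₀‖) (b := δ) (by nlinarith [sq_nonneg (t - t₀)]) hδ0.le
    rwa [abs_norm] at this
  have hin' : ∀ t x, quarticTest t₀ x₀ (v t₀ x₀) b a c p M (2 * η) K t x - η * δ ^ 2 ≤ v t x →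
      (t, x) ∈ Metric.ball (t₀, x₀) δ₀ := fun t x htx => by
    obtain ⟨h1, h2⟩ := hin t x htx
    rw [Metric.mem_ball, Prod.dist_eq, max_lt_iff, Real.dist_eq, dist_eq_norm]
    exact ⟨by linarith, by linarith⟩
  have hτm : ∀ r, |r - t₀| ≤ δ → r ∈ Ioo S₁ S₂ := fun r hr =>
    (hδball (r, x₀) (by
      rw [Metric.mem_ball, Prod.dist_eq, max_lt_iff, Real.dist_eq, dist_self]
      exact ⟨by simp only; linarith, hδ₀⟩)).2.2
  have hfin := h.le_of_strict_supersolution hG hGm hGC hgF hmono hA hDA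
    (φ := fun t x => quarticTest t₀ x₀ (v t₀ x₀) b a c p M (2 * η) K t x - η * δ ^ 2)
    ((continuous_quarticTest t₀ x₀ (v t₀ x₀) b a c p M (2 * η) K).sub continuous_const)
    (fun t x => (hasDerivAt_quarticTest t₀ x₀ (v t₀ x₀) b a c p M (2 * η) K t x).sub_const _) hTc
    (fun t x => by
      have := hasGradientAt_quarticTest t₀ x₀ (v t₀ x₀) b a c p M (2 * η) K hM t x
      rw [hasGradientAt_iff_hasFDerivAt] at this ⊢
      exact this.sub_const _)
    hPc (hasFDerivAt_quarticTestGrad t₀ x₀ c p M (2 * η) K) hHc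
    (τ₁ := t₀ - δ) (τ₂ := t₀ + δ) (R := ‖x₀‖ + δ)
    (hτm (t₀ - δ) (by simp [abs_of_pos hδ0])).1 (hτm (t₀ + δ) (by simp [abs_of_pos hδ0])).2
    (fun t x htx => by
      obtain ⟨h1, h2⟩ := hin t x htx
      obtain ⟨h3, h4⟩ := abs_le.1 h1
      refine ⟨⟨by linarith, by linarith⟩, ?_⟩
      linarith [norm_sub_norm_le x x₀])
    (fun t x htx => (hδball _ (hin' t x htx)).1) (fun t x htx => (hδball _ (hin' t x htx)).2.1) t₀ x₀
  have h0 : quarticTest t₀ x₀ (v t₀ x₀) b a c p M (2 * η) K t₀ x₀ = v t₀ x₀ := by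
    simp [quarticTest]
  rw [h0] at hfin
  have : 0 < η * δ ^ 2 := by positivity
  linarith

end Viscosity

section SecondVariation

open Topology

variable {H : Type*} [NormedAddCommGroup H] [InnerProductSpace ℝ H]

theorem eq_of_forall_inner_sub_mul_sq_le {a b : H} {C : ℝ}
    (h : ∀ x, ⟪a, x⟫ - C * ‖x‖ ^ 2 ≤ ⟪b, x⟫) : a = b := by
  by_contra hne
  have hd : 0 < ‖a - b‖ := norm_pos_iff.2 (sub_ne_zero.2 hne)
  set s := (2 * (|C| + 1))⁻¹ with hs
  have hs0 : 0 < s := by positivity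
  have h1 := h (s • (a - b))
  have h2 : ⟪a, s • (a - b)⟫ - ⟪b, s • (a - b)⟫ = s * ‖a - b‖ ^ 2 := by
    rw [← inner_sub_left, real_inner_smul_right, real_inner_self_eq_norm_sq]
  rw [norm_smul, Real.norm_of_nonneg hs0.le] at h1
  have h3 : s * ‖a - b‖ ^ 2 ≤ C * (s * ‖a - b‖) ^ 2 := by linarith
  have h4 : C * s ≤ 1 / 2 := by
    have : (|C| + 1) * s = 1 / 2 := by
      rw [hs]
      field_simp
    nlinarith [le_abs_self C]
  have h5 : 0 < s * ‖a - b‖ ^ 2 := by positivity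
  nlinarith [mul_le_mul_of_nonneg_right h4 h5.le]

theorem le_of_eventually_quadratic_le {a b a' b' : ℝ}
    (h : ∀ η > 0, ∀ᶠ s in 𝓝 (0 : ℝ), a * s + b * s ^ 2 / 2 - η * s ^ 2 ≤ a' * s + b' * s ^ 2 / 2) :
    b ≤ b' := by
  refine le_of_forall_pos_le_add fun η hη => ?_
  have h1 := h (η / 2) (by positivity)
  have h2 : ∀ᶠ s in 𝓝 (0 : ℝ), a * (-s) + b * (-s) ^ 2 / 2 - η / 2 * (-s) ^ 2
      ≤ a' * (-s) + b' * (-s) ^ 2 / 2 := by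
    have : Tendsto (fun s : ℝ => -s) (𝓝 0) (𝓝 0) := by
      simpa using (continuous_neg (G := ℝ)).tendsto 0
    exact this.eventually h1
  obtain ⟨s, ⟨h3, h4⟩, hs⟩ := ((h1.and h2).filter_mono nhdsWithin_le_nhds).and
    (self_mem_nhdsWithin (a := (0 : ℝ)) (s := Ioi 0)) |>.exists
  have hs0 : (0 : ℝ) < s ^ 2 := pow_pos hs 2
  nlinarith

/-- `U` has a second order expansion at `X` with slope `q` and Hessian `T`. -/
def HasSecondOrderExpansion (U : H → ℝ) (q : H) (T : H →L[ℝ] H) (X : H) : Prop :=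
  ∀ η > 0, ∀ᶠ h in 𝓝 (0 : H), |U (X + h) - U X - ⟪q, h⟫ - ⟪T h, h⟫ / 2| ≤ η * ‖h‖ ^ 2

theorem HasSecondOrderExpansion.eventually_line {U : H → ℝ} {q : H} {T : H →L[ℝ] H} {X : H}
    (hU : HasSecondOrderExpansion U q T X) (h : H) {η : ℝ} (hη : 0 < η) :
    ∀ᶠ s in 𝓝 (0 : ℝ), |U (X + s • h) - U X - ⟪q, h⟫ * s - ⟪T h, h⟫ * s ^ 2 / 2| ≤ η * s ^ 2 := by
  have ht : Tendsto (fun s : ℝ => s • h) (𝓝 0) (𝓝 0) := by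
    have : Continuous fun s : ℝ => s • h := by fun_prop
    simpa using this.tendsto 0
  have hη' : 0 < η / (‖h‖ ^ 2 + 1) := by positivity
  filter_upwards [ht.eventually (hU _ hη')] with s hs
  rw [map_smul, real_inner_smul_right, real_inner_smul_right, real_inner_smul_left, norm_smul,
    mul_pow, Real.norm_eq_abs, sq_abs] at hs
  have h1 : η / (‖h‖ ^ 2 + 1) * (s ^ 2 * ‖h‖ ^ 2) ≤ η * s ^ 2 := by
    have : η / (‖h‖ ^ 2 + 1) * ‖h‖ ^ 2 ≤ η := by
      rw [div_mul_eq_mul_div, div_le_iff₀ (by positivity)]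
      nlinarith
    nlinarith [sq_nonneg s]
  refine le_trans (le_of_eq ?_) (hs.trans h1)
  ring_nf

theorem HasSecondOrderExpansion.neg_mul_le {U : H → ℝ} {q : H} {T : H →L[ℝ] H} {X : H}
    (hU : HasSecondOrderExpansion U q T X) {c : ℝ}
    (hlow : ∀ h, U X + ⟪q, h⟫ - c * ‖h‖ ^ 2 / 2 ≤ U (X + h)) (h : H) :
    -(c * ‖h‖ ^ 2) ≤ ⟪T h, h⟫ := by
  refine le_of_eventually_quadratic_le (a := ⟪q, h⟫) (a' := ⟪q, h⟫) fun η hη => ?_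
  filter_upwards [hU.eventually_line h hη] with s hs
  have h1 := hlow (s • h)
  rw [real_inner_smul_right, norm_smul, mul_pow, Real.norm_eq_abs, sq_abs] at h1
  have := (abs_le.1 hs).2
  linarith

/-- Second order necessary condition at a contact point of `U X + U' Y - Ψ X Y` with a
hyperplane, along a direction in which `Ψ` has an upper parabola. -/
theorem HasSecondOrderExpansion.add_le {U U' : H → ℝ} {Ψ : H → H → ℝ} {X Y P Q q q' : H}
    {T T' : H →L[ℝ] H} (hU : HasSecondOrderExpansion U q T X)
    (hU' : HasSecondOrderExpansion U' q' T' Y)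
    (hW : ∀ X' Y', U X' + U' Y' - Ψ X' Y' ≤ U X + U' Y - Ψ X Y + ⟪P, X' - X⟫ + ⟪Q, Y' - Y⟫)
    {h k : H} {l B : ℝ}
    (hΨ : ∀ᶠ s in 𝓝 (0 : ℝ), Ψ (X + s • h) (Y + s • k) ≤ Ψ X Y + l * s + B * s ^ 2 / 2) :
    ⟪T h, h⟫ + ⟪T' k, k⟫ ≤ B := by
  refine le_of_eventually_quadratic_le (a := ⟪q, h⟫ + ⟪q', k⟫) (a' := l + ⟪P, h⟫ + ⟪Q, k⟫)
    fun η hη => ?_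
  filter_upwards [hU.eventually_line h (half_pos hη), hU'.eventually_line k (half_pos hη), hΨ]
    with s h1 h2 h3
  have h4 := hW (X + s • h) (Y + s • k)
  simp only [add_sub_cancel_left, real_inner_smul_right] at h4
  have := (abs_le.1 h1).1
  have := (abs_le.1 h2).1
  linarith

/-- First order conditions at a contact point of `U X + U' Y - Ψ X Y` with a hyperplane. -/
theorem slope_eq_of_contact {U U' : H → ℝ} {Ψ : H → H → ℝ} {X Y P Q q q' l l' : H} {c CΨ : ℝ}
    (hU : ∀ h, U X + ⟪q, h⟫ - c * ‖h‖ ^ 2 / 2 ≤ U (X + h))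
    (hU' : ∀ h, U' Y + ⟪q', h⟫ - c * ‖h‖ ^ 2 / 2 ≤ U' (Y + h))
    (hΨ : ∀ h k, Ψ (X + h) (Y + k) ≤ Ψ X Y + ⟪l, h⟫ + ⟪l', k⟫ + CΨ * (‖h‖ ^ 2 + ‖k‖ ^ 2))
    (hW : ∀ X' Y', U X' + U' Y' - Ψ X' Y' ≤ U X + U' Y - Ψ X Y + ⟪P, X' - X⟫ + ⟪Q, Y' - Y⟫) :
    q = l + P ∧ q' = l' + Q := by
  have key : ∀ h k, ⟪q, h⟫ + ⟪q', k⟫ - (c / 2 + CΨ) * (‖h‖ ^ 2 + ‖k‖ ^ 2)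
      ≤ ⟪l + P, h⟫ + ⟪l' + Q, k⟫ := fun h k => by
    have h4 := hW (X + h) (Y + k)
    simp only [add_sub_cancel_left] at h4
    rw [inner_add_left, inner_add_left]
    linarith [hU h, hU' k, hΨ h k]
  constructor
  · refine eq_of_forall_inner_sub_mul_sq_le (C := c / 2 + CΨ) fun h => ?_
    simpa using key h 0
  · refine eq_of_forall_inner_sub_mul_sq_le (C := c / 2 + CΨ) fun h => ?_
    simpa using key 0 h

theorem opNorm_le_of_isSymmetric {T : H →L[ℝ] H} (hT : (T : H →ₗ[ℝ] H).IsSymmetric) {C : ℝ}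
    (hC : 0 ≤ C) (h : ∀ x, |⟪T x, x⟫| ≤ C * ‖x‖ ^ 2) : ‖T‖ ≤ C := by
  have hs : ∀ x y, ⟪T x, y⟫ = ⟪x, T y⟫ := fun x y => hT x y
  refine T.opNorm_le_of_unit_norm hC fun x hx => ?_
  rcases eq_or_ne (T x) 0 with h0 | h0
  · simpa [h0] using hC
  set y := ‖T x‖⁻¹ • T x with hy
  have hy1 : ‖y‖ = 1 := norm_smul_inv_norm h0
  have h1 : ⟪T x, y⟫ = ‖T x‖ := by
    rw [hy, real_inner_smul_right, real_inner_self_eq_norm_sq]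
    field_simp
  have h2 := (abs_le.1 (h (x + y))).2
  have h3 := (abs_le.1 (h (x - y))).1
  have h4 : ⟪T (x + y), x + y⟫ - ⟪T (x - y), x - y⟫ = 4 * ⟪T x, y⟫ := by
    simp only [map_add, map_sub, inner_add_left, inner_add_right, inner_sub_left, inner_sub_right]
    rw [hs y x, real_inner_comm y (T x)]
    rw [real_inner_comm (T x) y]
    ring
  have h5 := parallelogram_law_with_norm ℝ x y
  rw [hx, hy1] at h5
  rw [← h1]
  nlinarith

/-- A second order expansion of the sup-convolution touches the function from above at the
maximizing point. -/
theorem HasSecondOrderExpansion.eventually_le_of_supConvolution {V U : H → ℝ} {X Z q : H} {ε : ℝ}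
    {T : H →L[ℝ] H} (hU : HasSecondOrderExpansion U q T X)
    (hZ : U X = V Z - ‖X - Z‖ ^ 2 / (2 * ε)) (hle : ∀ X Y, V Y - ‖X - Y‖ ^ 2 / (2 * ε) ≤ U X)
    {η : ℝ} (hη : 0 < η) :
    ∀ᶠ h in 𝓝 (0 : H), V (Z + h) ≤ V Z + ⟪q, h⟫ + ⟪T h, h⟫ / 2 + η * ‖h‖ ^ 2 := by
  filter_upwards [hU η hη] with h hh
  have h1 := hle (X + h) (Z + h)
  rw [add_sub_add_right_eq_sub] at h1
  have := (abs_le.1 hh).2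
  linarith

end SecondVariation

section TraceBounds

variable {E : Type*} [NormedAddCommGroup E] [InnerProductSpace ℝ E]

/-- The operator with eigenvalue `a₁` along `e` and `a₂` on its orthogonal complement. -/
noncomputable def uniaxial (a₁ a₂ : ℝ) (e : E) : E →L[ℝ] E :=
  a₂ • ContinuousLinearMap.id ℝ E + (a₁ - a₂) • (innerSL ℝ e).smulRight e

theorem uniaxial_neg (a₁ a₂ : ℝ) (e : E) : uniaxial a₁ a₂ (-e) = uniaxial a₁ a₂ e := by
  ext x
  simp [uniaxial]

variable [FiniteDimensional ℝ E]

theorem abs_trCLM_le (T : E →L[ℝ] E) : |trCLM T| ≤ Module.finrank ℝ E * ‖T‖ := by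
  rw [trCLM_eq_sum (stdOrthonormalBasis ℝ E)]
  refine (Finset.abs_sum_le_sum_abs _ _).trans ?_
  refine (Finset.sum_le_card_nsmul _ _ ‖T‖ fun i _ => ?_).trans (by simp)
  refine (abs_real_inner_le_norm _ _).trans ?_
  have := T.le_opNorm (stdOrthonormalBasis ℝ E i)
  simpa using this

theorem trCLM_uniaxial_comp_le {a₁ a₂ : ℝ} (h₁ : 0 ≤ a₁) (h₂ : 0 ≤ a₂) {e : E} (he : ‖e‖ = 1)
    {Z : E →L[ℝ] E} {β γ : ℝ} (hβ : 0 ≤ β) (hZ : ∀ w, ⟪Z w, w⟫ ≤ β * ‖w‖ ^ 2) (hZe : ⟪Z e, e⟫ ≤ γ) :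
    trCLM (uniaxial a₁ a₂ e ∘L Z) ≤ a₁ * γ + a₂ * (Module.finrank ℝ E * β) := by
  classical
  have ho : Orthonormal ℝ ((↑) : ({e} : Set E) → E) := by
    rw [orthonormal_subtype_iff_ite]
    intro v hv w hw
    rw [mem_singleton_iff.1 hv, mem_singleton_iff.1 hw, if_pos rfl, real_inner_self_eq_norm_sq, he]
    norm_num
  obtain ⟨u, b, heu, hb⟩ := ho.exists_orthonormalBasis_extension
  set i₀ : u := ⟨e, heu rfl⟩ with hi₀
  have hbe : b i₀ = e := by rw [hb]
  rw [trCLM_eq_sum b, ← Finset.add_sum_erase _ _ (Finset.mem_univ i₀)]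
  have h3 : ⟪b i₀, (uniaxial a₁ a₂ e ∘L Z) (b i₀)⟫ = a₁ * ⟪Z e, e⟫ := by
    rw [hbe]
    simp only [uniaxial, ContinuousLinearMap.comp_apply, add_apply,
      smul_apply, ContinuousLinearMap.id_apply,
      ContinuousLinearMap.smulRight_apply, innerSL_apply_apply, inner_add_right,
      real_inner_smul_right, real_inner_self_eq_norm_sq, he, real_inner_comm (Z e) e]
    ring
  have h4 : ∀ i ∈ Finset.univ.erase i₀, ⟪b i, (uniaxial a₁ a₂ e ∘L Z) (b i)⟫ ≤ a₂ * β := by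
    intro i hi
    have h5 : ⟪b i, e⟫ = 0 := by
      rw [← hbe]
      exact b.orthonormal.2 (Finset.ne_of_mem_erase hi)
    have h6 : ⟪b i, (uniaxial a₁ a₂ e ∘L Z) (b i)⟫ = a₂ * ⟪Z (b i), b i⟫ := by
      simp only [uniaxial, ContinuousLinearMap.comp_apply, add_apply,
        smul_apply, ContinuousLinearMap.id_apply,
        ContinuousLinearMap.smulRight_apply, innerSL_apply_apply, inner_add_right,
        real_inner_smul_right, h5, real_inner_comm (Z (b i)) (b i)]
      ring
    rw [h6]
    refine mul_le_mul_of_nonneg_left ?_ h₂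
    simpa using hZ (b i)
  have h7 := Finset.sum_le_card_nsmul _ _ _ h4
  rw [h3]
  have h8 : (((Finset.univ.erase i₀).card : ℕ) : ℝ) ≤ Module.finrank ℝ E := by
    have : (Finset.univ.erase i₀).card ≤ Module.finrank ℝ E := by
      rw [Module.finrank_eq_card_basis b.toBasis]
      exact Finset.card_le_univ _
    exact_mod_cast this
  rw [nsmul_eq_mul] at h7
  have h9 : ((Finset.univ.erase i₀).card : ℝ) * (a₂ * β) ≤ Module.finrank ℝ E * (a₂ * β) :=
    mul_le_mul_of_nonneg_right h8 (by positivity)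
  have := mul_le_mul_of_nonneg_left hZe h₁
  nlinarith

end TraceBounds

section DoublingPenalty

open Topology

/-- The concave function `D r - D² r² / 20`, frozen at `r = 5 / D`. -/
noncomputable def concaveModulus (D r : ℝ) : ℝ :=
  D * min r (5 / D) - D ^ 2 * min r (5 / D) ^ 2 / 20

theorem continuous_concaveModulus (D : ℝ) : Continuous (concaveModulus D) := by
  unfold concaveModulus
  fun_prop

theorem concaveModulus_of_le {D r : ℝ} (hr : r ≤ 5 / D) :
    concaveModulus D r = D * r - D ^ 2 * r ^ 2 / 20 := by
  rw [concaveModulus, min_eq_left hr]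

theorem concaveModulus_of_ge {D r : ℝ} (hD : 0 < D) (hr : 5 / D ≤ r) :
    concaveModulus D r = 15 / 4 := by
  rw [concaveModulus, min_eq_right hr]
  field_simp
  norm_num

theorem concaveModulus_nonneg {D r : ℝ} (hD : 0 < D) (hr : 0 ≤ r) : 0 ≤ concaveModulus D r := by
  have h1 : 0 ≤ min r (5 / D) := le_min hr (by positivity)
  have h2 : D * min r (5 / D) ≤ 5 := by
    have := mul_le_mul_of_nonneg_left (min_le_right r (5 / D)) hD.le
    rwa [mul_div_cancel₀ _ hD.ne'] at this
  have h3 : 0 ≤ D * min r (5 / D) := by positivity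
  rw [concaveModulus]
  nlinarith

theorem concaveModulus_le_tangent {D r r' : ℝ} (hD : 0 < D) (hr : r ≤ 5 / D) :
    concaveModulus D r' ≤ concaveModulus D r + (D - D ^ 2 * r / 10) * (r' - r) := by
  rw [concaveModulus_of_le hr, concaveModulus]
  have h1 := min_le_left r' (5 / D)
  have h2 : D * r ≤ 5 := by
    rwa [le_div_iff₀ hD, mul_comm] at hr
  have h3 : 0 ≤ D - D ^ 2 * r / 10 := by nlinarith
  nlinarith [mul_nonneg h3 (sub_nonneg.2 h1), sq_nonneg (D * (min r' (5 / D) - r))]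

theorem fst_toLp_pair {F : Type*} (a : ℝ) (b : F) : (WithLp.toLp 2 (a, b)).fst = a := rfl

theorem snd_toLp_pair {F : Type*} (a : ℝ) (b : F) : (WithLp.toLp 2 (a, b)).snd = b := rfl

variable {E : Type*} [NormedAddCommGroup E]

/-- The penalty function in the doubling of variables. -/
noncomputable def doublingPenalty (D η α T : ℝ) (X Y : WithLp 2 (ℝ × E)) : ℝ :=
  concaveModulus D ‖X.snd - Y.snd‖ + (X.fst - Y.fst) ^ 2 / (2 * η) + 4 * (X.fst - T) ^ 2
    + α * (‖X.snd‖ ^ 2 + ‖Y.snd‖ ^ 2)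

theorem continuous_doublingPenalty (D η α T : ℝ) :
    Continuous fun k : WithLp 2 (ℝ × E) × WithLp 2 (ℝ × E) =>
      doublingPenalty D η α T k.1 k.2 := by
  have h1 : Continuous fun X : WithLp 2 (ℝ × E) => X.fst :=
    continuous_fst.comp (WithLp.prod_continuous_ofLp 2 ℝ E)
  have h2 : Continuous fun X : WithLp 2 (ℝ × E) => X.snd :=
    continuous_snd.comp (WithLp.prod_continuous_ofLp 2 ℝ E)
  have h3 := continuous_concaveModulus D
  unfold doublingPenalty
  fun_prop

theorem abs_fst_le_norm (X : WithLp 2 (ℝ × E)) : |X.fst| ≤ ‖X‖ := by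
  refine abs_le_of_sq_le_sq' ?_ (norm_nonneg X) |> abs_le.2
  rw [WithLp.prod_norm_sq_eq_of_L2]
  simp only [Real.norm_eq_abs, sq_abs]
  linarith [sq_nonneg ‖X.snd‖]

theorem norm_snd_le_norm (X : WithLp 2 (ℝ × E)) : ‖X.snd‖ ≤ ‖X‖ := by
  refine le_of_sq_le_sq ?_ (norm_nonneg X)
  rw [WithLp.prod_norm_sq_eq_of_L2]
  simp only [Real.norm_eq_abs, sq_abs]
  linarith [sq_nonneg X.fst]

/-- Localization of points where the penalty is less than two. -/
theorem bounds_of_doublingPenalty_lt {D η α T : ℝ} (hD : 0 < D) (hη : 0 < η) (hα : 0 < α)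
    {X Y : WithLp 2 (ℝ × E)} (h : doublingPenalty D η α T X Y < 2) :
    ‖X.snd - Y.snd‖ < 5 / D ∧ |X.fst - T| < 1 ∧ (X.fst - Y.fst) ^ 2 < 4 * η ∧
      α * ‖X.snd‖ ^ 2 < 2 ∧ α * ‖Y.snd‖ ^ 2 < 2 := by
  rw [doublingPenalty] at h
  have h1 := concaveModulus_nonneg hD (norm_nonneg (X.snd - Y.snd))
  have h2 : 0 ≤ (X.fst - Y.fst) ^ 2 / (2 * η) := by positivity
  have h3 : 0 ≤ α * ‖X.snd‖ ^ 2 := by positivity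
  have h4 : 0 ≤ α * ‖Y.snd‖ ^ 2 := by positivity
  have h5 := sq_nonneg (X.fst - T)
  rw [mul_add] at h
  refine ⟨?_, ?_, ?_, by linarith, by linarith⟩
  · by_contra! hge
    rw [concaveModulus_of_ge hD hge] at h
    linarith
  · exact abs_lt_of_sq_lt_sq (by linarith) zero_le_one
  · have : (X.fst - Y.fst) ^ 2 / (2 * η) < 2 := by linarith
    rw [div_lt_iff₀ (by positivity)] at this
    linarith

variable [InnerProductSpace ℝ E]

theorem norm_add_sub_norm_le {z : E} (hz : z ≠ 0) (k : E) :
    ‖z + k‖ - ‖z‖ ≤ ⟪‖z‖⁻¹ • z, k⟫ + ‖k‖ ^ 2 / (2 * ‖z‖) := by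
  have hr : 0 < ‖z‖ := norm_pos_iff.2 hz
  have h1 := norm_add_sq_real z k
  have h2 : ‖z‖ * (⟪‖z‖⁻¹ • z, k⟫ + ‖k‖ ^ 2 / (2 * ‖z‖)) = ⟪z, k⟫ + ‖k‖ ^ 2 / 2 := by
    rw [real_inner_smul_left]
    field_simp
  refine le_of_mul_le_mul_left ?_ hr
  rw [h2]
  nlinarith [sq_nonneg (‖z + k‖ - ‖z‖)]

/-- The linear part of `doublingPenalty` in the first variable. -/
noncomputable def doublingSlopeLeft (D η α T : ℝ) (X Y : WithLp 2 (ℝ × E)) : WithLp 2 (ℝ × E) :=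
  WithLp.toLp 2 ((X.fst - Y.fst) / η + 8 * (X.fst - T),
    (D - D ^ 2 * ‖X.snd - Y.snd‖ / 10) • (‖X.snd - Y.snd‖⁻¹ • (X.snd - Y.snd)) + (2 * α) • X.snd)

/-- The linear part of `doublingPenalty` in the second variable. -/
noncomputable def doublingSlopeRight (D η α : ℝ) (X Y : WithLp 2 (ℝ × E)) : WithLp 2 (ℝ × E) :=
  WithLp.toLp 2 (-((X.fst - Y.fst) / η),
    -((D - D ^ 2 * ‖X.snd - Y.snd‖ / 10) • (‖X.snd - Y.snd‖⁻¹ • (X.snd - Y.snd)))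
      + (2 * α) • Y.snd)

theorem doublingPenalty_add_le {D η α T r₀ : ℝ} (hD : 0 < D) (hη : 0 < η) (hα : 0 ≤ α)
    (hr₀ : 0 < r₀) {X Y : WithLp 2 (ℝ × E)} (h₀ : r₀ ≤ ‖X.snd - Y.snd‖)
    (h₁ : ‖X.snd - Y.snd‖ ≤ 5 / D) (h k : WithLp 2 (ℝ × E)) :
    doublingPenalty D η α T (X + h) (Y + k) ≤ doublingPenalty D η α T X Y
      + ⟪doublingSlopeLeft D η α T X Y, h⟫ + ⟪doublingSlopeRight D η α X Y, k⟫
      + (D / r₀ + 1 / η + 4 + α) * (‖h‖ ^ 2 + ‖k‖ ^ 2) := by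
  simp only [doublingPenalty, doublingSlopeLeft, doublingSlopeRight, WithLp.prod_inner_apply,
    WithLp.prod_norm_sq_eq_of_L2, WithLp.add_fst, WithLp.add_snd, WithLp.ofLp_fst, WithLp.ofLp_snd]
  have hz : X.snd + h.snd - (Y.snd + k.snd) = (X.snd - Y.snd) + (h.snd - k.snd) := by abel
  have hx := norm_add_sq_real X.snd h.snd
  have hy := norm_add_sq_real Y.snd k.snd
  rw [hz, hx, hy]
  set z := X.snd - Y.snd with hzd
  have hz0 : z ≠ 0 := by
    intro h
    rw [h, norm_zero] at h₀
    linarith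
  set σ := D - D ^ 2 * ‖z‖ / 10 with hσ
  have hDz : D * ‖z‖ ≤ 5 := by
    rwa [le_div_iff₀ hD, mul_comm] at h₁
  have hσ0 : 0 ≤ σ := by nlinarith
  have hσD : σ ≤ D := by
    have : 0 ≤ D ^ 2 * ‖z‖ / 10 := by positivity
    linarith
  have e1 := concaveModulus_le_tangent (r' := ‖z + (h.snd - k.snd)‖) hD h₁
  rw [← hσ, mul_sub] at e1
  have e2 := mul_le_mul_of_nonneg_left (norm_add_sub_norm_le hz0 (h.snd - k.snd)) hσ0
  have e3 : ‖h.snd - k.snd‖ ^ 2 ≤ 2 * (‖h.snd‖ ^ 2 + ‖k.snd‖ ^ 2) := by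
    have := parallelogram_law_with_norm ℝ h.snd k.snd
    nlinarith [sq_nonneg ‖h.snd + k.snd‖]
  have e4 : σ * (‖h.snd - k.snd‖ ^ 2 / (2 * ‖z‖)) ≤ D / r₀ * (‖h.snd‖ ^ 2 + ‖k.snd‖ ^ 2) := by
    calc σ * (‖h.snd - k.snd‖ ^ 2 / (2 * ‖z‖))
        ≤ D * (2 * (‖h.snd‖ ^ 2 + ‖k.snd‖ ^ 2) / (2 * r₀)) := by gcongr
      _ = _ := by field_simp
  have e5 : (X.fst + h.fst - (Y.fst + k.fst)) ^ 2 / (2 * η) ≤ (X.fst - Y.fst) ^ 2 / (2 * η)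
      + (X.fst - Y.fst) / η * h.fst - (X.fst - Y.fst) / η * k.fst
      + 1 / η * (h.fst ^ 2 + k.fst ^ 2) := by
    have : (X.fst - Y.fst) ^ 2 / (2 * η)
      + (X.fst - Y.fst) / η * h.fst - (X.fst - Y.fst) / η * k.fst
      + 1 / η * (h.fst ^ 2 + k.fst ^ 2) - (X.fst + h.fst - (Y.fst + k.fst)) ^ 2 / (2 * η)
      = (h.fst + k.fst) ^ 2 / (2 * η) := by
      field_simp
      ring
    have h2 : 0 ≤ (h.fst + k.fst) ^ 2 / (2 * η) := by positivity
    linarith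
  have e6 : 0 ≤ D / r₀ * (h.fst ^ 2 + k.fst ^ 2) := by positivity
  have e7 : 0 ≤ 1 / η * (‖h.snd‖ ^ 2 + ‖k.snd‖ ^ 2) := by positivity
  have e8 : 0 ≤ α * (h.fst ^ 2 + k.fst ^ 2) := by positivity
  rw [inner_sub_right, mul_add, mul_sub] at e2
  simp only [inner_add_left, inner_neg_left, Real.norm_eq_abs, sq_abs, real_inner_smul_left _ _ σ, real_inner_smul_left _ _ (2 * α), RCLike.inner_apply,
    conj_trivial]
  linarith [sq_nonneg ‖h.snd‖, sq_nonneg ‖k.snd‖, sq_nonneg k.fst]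

theorem doublingPenalty_add_diagonal_le (D η α T : ℝ) (X Y : WithLp 2 (ℝ × E)) (w : E) (s : ℝ) :
    doublingPenalty D η α T (X + s • WithLp.toLp 2 (0, w)) (Y + s • WithLp.toLp 2 (0, w))
      ≤ doublingPenalty D η α T X Y + 2 * α * ⟪X.snd + Y.snd, w⟫ * s
        + 4 * α * ‖w‖ ^ 2 * s ^ 2 / 2 := by
  simp only [doublingPenalty, WithLp.add_fst, WithLp.add_snd, WithLp.smul_fst, WithLp.smul_snd,
    fst_toLp_pair, snd_toLp_pair, smul_zero, add_zero, add_sub_add_right_eq_sub, inner_add_left]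
  rw [norm_add_sq_real, norm_add_sq_real, norm_smul, real_inner_smul_right, real_inner_smul_right,
    mul_pow, Real.norm_eq_abs, sq_abs]
  linarith

theorem doublingPenalty_add_antidiagonal_le {D η α T : ℝ} {X Y : WithLp 2 (ℝ × E)} (h₀ : 0 < ‖X.snd - Y.snd‖) (h₁ : ‖X.snd - Y.snd‖ < 5 / D) {e : E}
    (he : e = ‖X.snd - Y.snd‖⁻¹ • (X.snd - Y.snd)) :
    ∀ᶠ s in 𝓝 (0 : ℝ), doublingPenalty D η α T (X + s • WithLp.toLp 2 (0, e))
        (Y + s • WithLp.toLp 2 (0, -e))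
      ≤ doublingPenalty D η α T X Y
        + (2 * (D - D ^ 2 * ‖X.snd - Y.snd‖ / 10) + 2 * α * ⟪X.snd - Y.snd, e⟫) * s
        + (-(2 * D ^ 2 / 5) + 4 * α) * s ^ 2 / 2 := by
  set z := X.snd - Y.snd with hz
  have hev : ∀ᶠ s in 𝓝 (0 : ℝ), 0 < ‖z‖ + 2 * s ∧ ‖z‖ + 2 * s < 5 / D := by
    have hc : Continuous fun s : ℝ => ‖z‖ + 2 * s := by fun_prop
    exact hc.continuousAt.eventually (Ioo_mem_nhds (by simpa using h₀) (by simpa using h₁))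
  have hze : z = ‖z‖ • e := by
    rw [he, smul_smul, mul_inv_cancel₀ h₀.ne', one_smul]
  have he1 : ‖e‖ = 1 := by
    rw [he]
    exact norm_smul_inv_norm (norm_pos_iff.1 h₀)
  filter_upwards [hev] with s hs
  simp only [doublingPenalty, WithLp.add_fst, WithLp.add_snd, WithLp.smul_fst, WithLp.smul_snd,
    fst_toLp_pair, snd_toLp_pair, smul_zero, add_zero]
  have h2 : X.snd + s • e - (Y.snd + s • -e) = (‖z‖ + 2 * s) • e := by
    rw [add_smul, ← hze, hz, smul_neg, two_mul, add_smul]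
    abel
  rw [h2, norm_smul, he1, mul_one, Real.norm_of_nonneg hs.1.le, concaveModulus_of_le hs.2.le,
    concaveModulus_of_le h₁.le, norm_add_sq_real, norm_add_sq_real, norm_smul, norm_smul,
    norm_neg, he1, real_inner_smul_right, real_inner_smul_right, inner_neg_right, hz,
    inner_sub_left, mul_one, Real.norm_eq_abs, sq_abs]
  linarith

/-- The doubled function decays linearly away from the base points. -/
theorem le_sub_of_doublingPenalty {D η α T κ : ℝ} (hD : 0 < D) (hη : 0 < η) (hη4 : η ≤ 1 / 4)
    (hα : 0 < α) (hα1 : α ≤ 1) {x₀ y₀ : E} (hx : α * (‖x₀‖ ^ 2 + ‖y₀‖ ^ 2) ≤ 1)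
    {X Y : WithLp 2 (ℝ × E)}
    (hR : 16 / α ≤ ‖X - WithLp.toLp 2 (T, x₀)‖ + ‖Y - WithLp.toLp 2 (T, y₀)‖) (hκ : 0 ≤ κ) :
    2 - doublingPenalty D η α T X Y
      ≤ κ - (‖X - WithLp.toLp 2 (T, x₀)‖ + ‖Y - WithLp.toLp 2 (T, y₀)‖) := by
  set A := ‖X - WithLp.toLp 2 (T, x₀)‖ with hA
  set B := ‖Y - WithLp.toLp 2 (T, y₀)‖ with hB
  have hA2 : A ^ 2 = (X.fst - T) ^ 2 + ‖X.snd - x₀‖ ^ 2 := by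
    rw [hA, WithLp.prod_norm_sq_eq_of_L2]
    simp
  have hB2 : B ^ 2 = (Y.fst - T) ^ 2 + ‖Y.snd - y₀‖ ^ 2 := by
    rw [hB, WithLp.prod_norm_sq_eq_of_L2]
    simp
  have e1 : ‖X.snd - x₀‖ ^ 2 ≤ 2 * ‖X.snd‖ ^ 2 + 2 * ‖x₀‖ ^ 2 := by
    have := parallelogram_law_with_norm ℝ X.snd x₀
    nlinarith [sq_nonneg ‖X.snd + x₀‖]
  have e2 : ‖Y.snd - y₀‖ ^ 2 ≤ 2 * ‖Y.snd‖ ^ 2 + 2 * ‖y₀‖ ^ 2 := by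
    have := parallelogram_law_with_norm ℝ Y.snd y₀
    nlinarith [sq_nonneg ‖Y.snd + y₀‖]
  have e3 : 2 * (X.fst - Y.fst) ^ 2 ≤ (X.fst - Y.fst) ^ 2 / (2 * η) := by
    rw [le_div_iff₀ (by positivity)]
    nlinarith [sq_nonneg (X.fst - Y.fst)]
  have e4 := concaveModulus_nonneg hD (norm_nonneg (X.snd - Y.snd))
  have e5 : (Y.fst - T) ^ 2 ≤ 2 * (X.fst - T) ^ 2 + 2 * (X.fst - Y.fst) ^ 2 := by
    nlinarith [sq_nonneg ((X.fst - T) + (X.fst - Y.fst))]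
  have e6 : α * (A ^ 2 + B ^ 2) ≤ 2 * (doublingPenalty D η α T X Y + 1) := by
    rw [hA2, hB2, doublingPenalty]
    have h1 : α * (X.fst - T) ^ 2 ≤ (X.fst - T) ^ 2 :=
      mul_le_of_le_one_left (sq_nonneg _) hα1
    have h2 : α * (Y.fst - T) ^ 2 ≤ (Y.fst - T) ^ 2 :=
      mul_le_of_le_one_left (sq_nonneg _) hα1
    have h3 := mul_le_mul_of_nonneg_left e1 hα.le
    have h4 := mul_le_mul_of_nonneg_left e2 hα.le
    nlinarith [sq_nonneg (X.fst - T), sq_nonneg (X.fst - Y.fst)]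
  have e7 : 16 ≤ α * (A + B) := by
    rwa [div_le_iff₀ hα, mul_comm] at hR
  have e8 : 0 ≤ A + B := add_nonneg (norm_nonneg _) (norm_nonneg _)
  have e9 : 16 ≤ A + B := e7.trans (mul_le_of_le_one_left e8 hα1)
  have e10 : 16 * (A + B) ≤ α * (A + B) * (A + B) := mul_le_mul_of_nonneg_right e7 e8
  have e11 : α * (A + B) * (A + B) ≤ 2 * (α * (A ^ 2 + B ^ 2)) := by
    nlinarith [mul_nonneg hα.le (sq_nonneg (A - B))]
  linarith

end DoublingPenalty

section IshiiLions

open Topology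

variable {E : Type*} [NormedAddCommGroup E] [InnerProductSpace ℝ E]

/-- `v` satisfies `∂ₜ v ≤ tr (DA(∇v) D²v) + F` at times in `I`, at second order expansions from
above with nonzero slope. -/
def IsViscositySub (I : Set ℝ) (v : ℝ → E → ℝ) (DA : E → E →L[ℝ] E) (F : ℝ) : Prop :=
  ∀ ⦃t₀ b a : ℝ⦄ ⦃x₀ c p : E⦄ ⦃M : E →L[ℝ] E⦄, t₀ ∈ I → p ≠ 0 → (∀ x y, ⟪M x, y⟫ = ⟪x, M y⟫) →
    (∀ η > 0, ∀ᶠ k in 𝓝 (0 : ℝ × E), v (t₀ + k.1) (x₀ + k.2)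
      ≤ v t₀ x₀ + b * k.1 + ⟪p, k.2⟫ + (a * k.1 ^ 2 + 2 * k.1 * ⟪c, k.2⟫ + ⟪M k.2, k.2⟫) / 2
        + η * (k.1 ^ 2 + ‖k.2‖ ^ 2)) →
    b ≤ trCLM (DA p ∘L M) + F

/-- The spatial block of an operator on space-time. -/
noncomputable def spatialBlock (T : WithLp 2 (ℝ × E) →L[ℝ] WithLp 2 (ℝ × E)) : E →L[ℝ] E :=
  (ContinuousLinearMap.snd ℝ ℝ E ∘L (WithLp.prodContinuousLinearEquiv 2 ℝ ℝ E).toContinuousLinearMap)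
    ∘L T ∘L ((WithLp.prodContinuousLinearEquiv 2 ℝ ℝ E).symm.toContinuousLinearMap
      ∘L ContinuousLinearMap.inr ℝ ℝ E)

theorem spatialBlock_apply (T : WithLp 2 (ℝ × E) →L[ℝ] WithLp 2 (ℝ × E)) (w : E) :
    spatialBlock T w = (T (WithLp.toLp 2 (0, w))).snd := rfl

theorem inner_toLp_zero_pair (X : WithLp 2 (ℝ × E)) (w : E) :
    ⟪X, WithLp.toLp 2 (0, w)⟫ = ⟪X.snd, w⟫ := by
  simp [WithLp.prod_inner_apply]

theorem inner_spatialBlock (T : WithLp 2 (ℝ × E) →L[ℝ] WithLp 2 (ℝ × E)) (w z : E) :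
    ⟪spatialBlock T w, z⟫ = ⟪T (WithLp.toLp 2 (0, w)), WithLp.toLp 2 (0, z)⟫ := by
  rw [inner_toLp_zero_pair, spatialBlock_apply]

theorem norm_toLp_zero_pair {F : Type*} [NormedAddCommGroup F] (w : F) : ‖(WithLp.toLp 2 ((0 : ℝ), w) : WithLp 2 (ℝ × F))‖ = ‖w‖ := by
  rw [← sq_eq_sq₀ (norm_nonneg _) (norm_nonneg _), WithLp.prod_norm_sq_eq_of_L2]
  simp

theorem norm_spatialBlock_le (T : WithLp 2 (ℝ × E) →L[ℝ] WithLp 2 (ℝ × E)) :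
    ‖spatialBlock T‖ ≤ ‖T‖ := by
  refine ContinuousLinearMap.opNorm_le_bound _ T.opNorm_nonneg fun w => ?_
  rw [spatialBlock_apply]
  refine (norm_snd_le_norm _).trans ((T.le_opNorm _).trans_eq ?_)
  rw [norm_toLp_zero_pair]

theorem IsViscositySub.le_of_supConvolution {I : Set ℝ} {v : ℝ → E → ℝ} {DA : E → E →L[ℝ] E}
    {F : ℝ} (hv : IsViscositySub I v DA F) {U : WithLp 2 (ℝ × E) → ℝ} {X Z q : WithLp 2 (ℝ × E)}
    {T : WithLp 2 (ℝ × E) →L[ℝ] WithLp 2 (ℝ × E)} {ε : ℝ}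
    (hT : (T : WithLp 2 (ℝ × E) →ₗ[ℝ] WithLp 2 (ℝ × E)).IsSymmetric)
    (hU : HasSecondOrderExpansion U q T X)
    (hZ : U X = v Z.fst Z.snd - ‖X - Z‖ ^ 2 / (2 * ε))
    (hle : ∀ X Y : WithLp 2 (ℝ × E), v Y.fst Y.snd - ‖X - Y‖ ^ 2 / (2 * ε) ≤ U X)
    (hI : Z.fst ∈ I) (hq : q.snd ≠ 0) :
    q.fst ≤ trCLM (DA q.snd ∘L spatialBlock T) + F := by
  have hs : ∀ x y, ⟪T x, y⟫ = ⟪x, T y⟫ := fun x y => hT x y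
  refine hv (x₀ := Z.snd) (a := (T (WithLp.toLp 2 (1, 0))).fst)
    (c := (T (WithLp.toLp 2 (1, 0))).snd) hI hq (fun x y => ?_) fun η hη => ?_
  · rw [inner_spatialBlock, hs, ← real_inner_comm, ← inner_spatialBlock, real_inner_comm]
  · have ht : Tendsto (fun k : ℝ × E => (WithLp.toLp 2 k : WithLp 2 (ℝ × E))) (𝓝 0) (𝓝 0) :=
      (WithLp.prodContinuousLinearEquiv 2 ℝ ℝ E).symm.continuous.tendsto' _ _ rfl
    filter_upwards [ht.eventually (hU.eventually_le_of_supConvolution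
      (V := fun X : WithLp 2 (ℝ × E) => v X.fst X.snd) hZ hle hη)] with k hk
    obtain ⟨r, y⟩ := k
    have hsplit : (WithLp.toLp 2 (r, y) : WithLp 2 (ℝ × E))
        = r • WithLp.toLp 2 (1, 0) + WithLp.toLp 2 (0, y) := by
      rw [← WithLp.toLp_smul, ← WithLp.toLp_add]
      simp
    have h1 : ⟪T (WithLp.toLp 2 (r, y)), WithLp.toLp 2 (r, y)⟫
        = (T (WithLp.toLp 2 (1, 0))).fst * r ^ 2 + 2 * r * ⟪(T (WithLp.toLp 2 (1, 0))).snd, y⟫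
          + ⟪spatialBlock T y, y⟫ := by
      have h2 : ⟪T (WithLp.toLp 2 (1, 0)), WithLp.toLp 2 (1, 0)⟫
          = (T (WithLp.toLp 2 ((1 : ℝ), (0 : E)))).fst := by
        simp [WithLp.prod_inner_apply]
      rw [hsplit, map_add, map_smul, inner_add_left, inner_add_right, inner_add_right,
        real_inner_smul_left, real_inner_smul_left, real_inner_smul_right, real_inner_smul_right,
        h2, inner_toLp_zero_pair, ← inner_spatialBlock, hs (WithLp.toLp 2 (0, y)),
        real_inner_comm (T (WithLp.toLp 2 (1, 0))) (WithLp.toLp 2 (0, y)), inner_toLp_zero_pair]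
      ring
    have h3 : ‖(WithLp.toLp 2 (r, y) : WithLp 2 (ℝ × E))‖ ^ 2 = r ^ 2 + ‖y‖ ^ 2 := by
      rw [WithLp.prod_norm_sq_eq_of_L2]
      simp
    have h4 : ⟪q, WithLp.toLp 2 (r, y)⟫ = q.fst * r + ⟪q.snd, y⟫ := by
      simp [WithLp.prod_inner_apply, mul_comm]
    rw [h1, h3, h4] at hk
    simp only [WithLp.add_fst, WithLp.add_snd, fst_toLp_pair, snd_toLp_pair] at hk
    linarith

variable [FiniteDimensional ℝ E]

theorem trCLM_comp_le_add {S B M : E →L[ℝ] E} {δ C : ℝ} (hS : ‖S - B‖ ≤ δ) (hM : ‖M‖ ≤ C) :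
    trCLM (S ∘L M) ≤ trCLM (B ∘L M) + Module.finrank ℝ E * (δ * C) := by
  have h1 : S ∘L M = B ∘L M + (S - B) ∘L M := by
    rw [ContinuousLinearMap.sub_comp, add_sub_cancel]
  rw [h1, trCLM_add]
  have h2 := (le_abs_self _).trans (abs_trCLM_le ((S - B) ∘L M))
  have h3 : ‖(S - B) ∘L M‖ ≤ δ * C :=
    (ContinuousLinearMap.opNorm_comp_le _ _).trans
      (mul_le_mul hS hM (norm_nonneg _) ((norm_nonneg _).trans hS))
  have h4 : (Module.finrank ℝ E : ℝ) * ‖(S - B) ∘L M‖ ≤ Module.finrank ℝ E * (δ * C) :=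
    mul_le_mul_of_nonneg_left h3 (by positivity)
  linarith

end IshiiLions

section ContactInequality

open Topology

variable {E : Type*} [NormedAddCommGroup E] [InnerProductSpace ℝ E]

theorem HasSecondOrderExpansion.norm_le_of_contact {U U' : WithLp 2 (ℝ × E) → ℝ}
    {X Y P Q q q' : WithLp 2 (ℝ × E)} {T T' : WithLp 2 (ℝ × E) →L[ℝ] WithLp 2 (ℝ × E)}
    {Ψ : WithLp 2 (ℝ × E) → WithLp 2 (ℝ × E) → ℝ} {l l' : WithLp 2 (ℝ × E)} {c CΨ : ℝ}
    (hU : HasSecondOrderExpansion U q T X) (hU' : HasSecondOrderExpansion U' q' T' Y)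
    (hT : (T : WithLp 2 (ℝ × E) →ₗ[ℝ] WithLp 2 (ℝ × E)).IsSymmetric)
    (hT' : (T' : WithLp 2 (ℝ × E) →ₗ[ℝ] WithLp 2 (ℝ × E)).IsSymmetric)
    (hlow : ∀ h, U X + ⟪q, h⟫ - c * ‖h‖ ^ 2 / 2 ≤ U (X + h))
    (hlow' : ∀ h, U' Y + ⟪q', h⟫ - c * ‖h‖ ^ 2 / 2 ≤ U' (Y + h)) (hc : 0 ≤ c) (hCΨ : 0 ≤ CΨ)
    (hΨ : ∀ h k, Ψ (X + h) (Y + k) ≤ Ψ X Y + ⟪l, h⟫ + ⟪l', k⟫ + CΨ * (‖h‖ ^ 2 + ‖k‖ ^ 2))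
    (hW : ∀ X' Y', U X' + U' Y' - Ψ X' Y' ≤ U X + U' Y - Ψ X Y + ⟪P, X' - X⟫ + ⟪Q, Y' - Y⟫) :
    ‖T‖ ≤ c + 2 * CΨ ∧ ‖T'‖ ≤ c + 2 * CΨ := by
  have hsum : ∀ h k, ⟪T h, h⟫ + ⟪T' k, k⟫ ≤ 2 * CΨ * (‖h‖ ^ 2 + ‖k‖ ^ 2) := fun h k => by
    refine hU.add_le hU' hW (l := ⟪l, h⟫ + ⟪l', k⟫) (Eventually.of_forall fun s => ?_)
    have := hΨ (s • h) (s • k)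
    rw [real_inner_smul_right, real_inner_smul_right, norm_smul, norm_smul, mul_pow, mul_pow,
      Real.norm_eq_abs, sq_abs] at this
    linarith
  constructor
  · refine opNorm_le_of_isSymmetric hT (by positivity) fun h => abs_le.2 ⟨?_, ?_⟩
    · have := hU.neg_mul_le hlow h
      nlinarith [mul_nonneg hCΨ (sq_nonneg ‖h‖)]
    · have := hsum h 0
      simp only [inner_zero_right, norm_zero] at this
      nlinarith [mul_nonneg hc (sq_nonneg ‖h‖)]
  · refine opNorm_le_of_isSymmetric hT' (by positivity) fun h => abs_le.2 ⟨?_, ?_⟩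
    · have := hU'.neg_mul_le hlow' h
      nlinarith [mul_nonneg hCΨ (sq_nonneg ‖h‖)]
    · have := hsum 0 h
      simp only [inner_zero_right, norm_zero] at this
      nlinarith [mul_nonneg hc (sq_nonneg ‖h‖)]

theorem supConvolution_lower_paraboloid {H : Type*} [NormedAddCommGroup H] [InnerProductSpace ℝ H]
    {V U : H → ℝ} {X Z : H} {ε : ℝ} (hZ : U X = V Z - ‖X - Z‖ ^ 2 / (2 * ε))
    (hle : ∀ X Y, V Y - ‖X - Y‖ ^ 2 / (2 * ε) ≤ U X) (h : H) :
    U X + ⟪ε⁻¹ • (Z - X), h⟫ - ε⁻¹ * ‖h‖ ^ 2 / 2 ≤ U (X + h) := by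
  have h1 := hle (X + h) Z
  have h2 : ‖X + h - Z‖ ^ 2 = ‖X - Z‖ ^ 2 - 2 * ⟪Z - X, h⟫ + ‖h‖ ^ 2 := by
    have : X + h - Z = (X - Z) + h := by abel
    rw [this, norm_add_sq_real, ← neg_sub Z X, inner_neg_left]
    ring
  rw [real_inner_smul_left, hZ]
  refine le_trans (le_of_eq ?_) h1
  rw [h2]
  simp only [div_eq_mul_inv, mul_inv]
  ring

variable [FiniteDimensional ℝ E]

/-- The inequality obtained from the two viscosity inequalities at a contact point. -/
theorem contact_inequality {I : Set ℝ} {v : ℝ → E → ℝ} {DA : E → E →L[ℝ] E} {F : ℝ}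
    (hv : IsViscositySub I v DA F) (hv' : IsViscositySub I (fun t x => -v t x) DA F)
    {U U' : WithLp 2 (ℝ × E) → ℝ} {X Y Z Z' P Q : WithLp 2 (ℝ × E)}
    {T T' : WithLp 2 (ℝ × E) →L[ℝ] WithLp 2 (ℝ × E)} {ε : ℝ} (hε : 0 < ε)
    (hT : (T : WithLp 2 (ℝ × E) →ₗ[ℝ] WithLp 2 (ℝ × E)).IsSymmetric)
    (hT' : (T' : WithLp 2 (ℝ × E) →ₗ[ℝ] WithLp 2 (ℝ × E)).IsSymmetric)
    (hU : HasSecondOrderExpansion U (ε⁻¹ • (Z - X)) T X)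
    (hU' : HasSecondOrderExpansion U' (ε⁻¹ • (Z' - Y)) T' Y)
    (hZ : U X = v Z.fst Z.snd - ‖X - Z‖ ^ 2 / (2 * ε))
    (hZ' : U' Y = -v Z'.fst Z'.snd - ‖Y - Z'‖ ^ 2 / (2 * ε))
    (hle : ∀ X Y : WithLp 2 (ℝ × E), v Y.fst Y.snd - ‖X - Y‖ ^ 2 / (2 * ε) ≤ U X)
    (hle' : ∀ X Y : WithLp 2 (ℝ × E), -v Y.fst Y.snd - ‖X - Y‖ ^ 2 / (2 * ε) ≤ U' X)
    (hI : Z.fst ∈ I) (hI' : Z'.fst ∈ I)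
    {D η α t₀ r₀ : ℝ} (hD : 0 < D) (hη : 0 < η) (hα : 0 ≤ α) (hr₀ : 0 < r₀)
    (h₀ : r₀ ≤ ‖X.snd - Y.snd‖) (h₁ : ‖X.snd - Y.snd‖ < 5 / D)
    (hW : ∀ X' Y', U X' + U' Y' - doublingPenalty D η α t₀ X' Y'
      ≤ U X + U' Y - doublingPenalty D η α t₀ X Y + ⟪P, X' - X⟫ + ⟪Q, Y' - Y⟫)
    {a₁ a₂ : ℝ → ℝ} (ha₁ : ∀ σ ∈ Icc (D / 2) D, 0 ≤ a₁ σ) (ha₂ : ∀ σ ∈ Icc (D / 2) D, 0 ≤ a₂ σ)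
    {δ δ' : ℝ} (hDA : ∀ σ ∈ Icc (D / 2) D, ∀ e : E, ‖e‖ = 1 → ∀ p, ‖p - σ • e‖ ≤ δ' →
      p ≠ 0 ∧ ‖DA p - uniaxial (a₁ σ) (a₂ σ) e‖ ≤ δ)
    (hX : 2 * α * ‖X.snd‖ + ‖P‖ ≤ δ') (hY : 2 * α * ‖Y.snd‖ + ‖Q‖ ≤ δ') :
    ∃ σ ∈ Icc (D / 2) D, 8 * (X.fst - t₀) + P.fst + Q.fst
      ≤ a₁ σ * (-(2 * D ^ 2 / 5) + 4 * α) + a₂ σ * (Module.finrank ℝ E * (4 * α))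
        + 2 * (Module.finrank ℝ E * (δ * (ε⁻¹ + 2 * (D / r₀ + 1 / η + 4 + α)))) + 2 * F := by
  set σ := D - D ^ 2 * ‖X.snd - Y.snd‖ / 10 with hσ
  set e := ‖X.snd - Y.snd‖⁻¹ • (X.snd - Y.snd) with he
  have hr : 0 < ‖X.snd - Y.snd‖ := hr₀.trans_le h₀
  have he1 : ‖e‖ = 1 := norm_smul_inv_norm (norm_pos_iff.1 hr)
  have hDr : D * ‖X.snd - Y.snd‖ < 5 := by
    rwa [lt_div_iff₀ hD, mul_comm] at h₁
  have hσI : σ ∈ Icc (D / 2) D := by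
    constructor
    · nlinarith
    · have : 0 ≤ D ^ 2 * ‖X.snd - Y.snd‖ / 10 := by positivity
      linarith
  have hlow := supConvolution_lower_paraboloid (V := fun X : WithLp 2 (ℝ × E) => v X.fst X.snd)
    hZ hle
  have hlow' := supConvolution_lower_paraboloid (V := fun X : WithLp 2 (ℝ × E) => -v X.fst X.snd)
    hZ' hle'
  have hΨ := doublingPenalty_add_le (T := t₀) hD hη hα hr₀ h₀ h₁.le
  have hΨ0 : 0 ≤ D / r₀ + 1 / η + 4 + α := by positivity
  obtain ⟨hq, hq'⟩ := slope_eq_of_contact hlow hlow' hΨ hW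
  obtain ⟨hTn, hTn'⟩ := hU.norm_le_of_contact hU' hT hT' hlow hlow' (inv_nonneg.2 hε.le) hΨ0 hΨ hW
  set q := ε⁻¹ • (Z - X) with hqd
  set q' := ε⁻¹ • (Z' - Y) with hqd'
  have hqs : q.snd - σ • e = (2 * α) • X.snd + P.snd := by
    rw [hq, WithLp.add_snd, doublingSlopeLeft, snd_toLp_pair]
    abel
  have hqs' : q'.snd - σ • -e = (2 * α) • Y.snd + Q.snd := by
    rw [hq', WithLp.add_snd, doublingSlopeRight, snd_toLp_pair, smul_neg]
    abel
  have hbd : ∀ (x : E) (R : WithLp 2 (ℝ × E)),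
      ‖(2 * α) • x + R.snd‖ ≤ 2 * α * ‖x‖ + ‖R‖ := fun x R => by
    refine (norm_add_le _ _).trans (add_le_add (le_of_eq ?_) (norm_snd_le_norm R))
    rw [norm_smul, Real.norm_of_nonneg (by positivity)]
  obtain ⟨hq0, hqδ⟩ := hDA σ hσI e he1 q.snd (by rw [hqs]; exact (hbd _ _).trans hX)
  obtain ⟨hq0', hqδ'⟩ := hDA σ hσI (-e) (by rw [norm_neg, he1]) q'.snd
    (by rw [hqs']; exact (hbd _ _).trans hY)
  rw [uniaxial_neg] at hqδ'
  have v1 := hv.le_of_supConvolution hT hU hZ hle hI hq0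
  have v2 := hv'.le_of_supConvolution hT' hU' hZ' hle' hI' hq0'
  have w1 := trCLM_comp_le_add hqδ ((norm_spatialBlock_le T).trans hTn)
  have w2 := trCLM_comp_le_add hqδ' ((norm_spatialBlock_le T').trans hTn')
  have hsum : ∀ w, ⟪(spatialBlock T + spatialBlock T') w, w⟫ ≤ 4 * α * ‖w‖ ^ 2 := fun w => by
    rw [add_apply, inner_add_left, inner_spatialBlock, inner_spatialBlock]
    exact hU.add_le hU' hW (Eventually.of_forall fun s =>
      doublingPenalty_add_diagonal_le D η α t₀ X Y w s)
  have hsum' : ⟪(spatialBlock T + spatialBlock T') e, e⟫ ≤ -(2 * D ^ 2 / 5) + 4 * α := by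
    have h3 := hU.add_le hU' hW (doublingPenalty_add_antidiagonal_le (η := η) (α := α) (T := t₀)
      hr h₁ he)
    have h4 : (WithLp.toLp 2 ((0 : ℝ), -e) : WithLp 2 (ℝ × E)) = -WithLp.toLp 2 (0, e) := by
      rw [← WithLp.toLp_neg]
      simp
    rw [h4, map_neg, inner_neg_neg] at h3
    rwa [add_apply, inner_add_left, inner_spatialBlock, inner_spatialBlock]
  have w3 := trCLM_uniaxial_comp_le (ha₁ σ hσI) (ha₂ σ hσI) he1 (by positivity) hsum hsum'
  rw [ContinuousLinearMap.comp_add, trCLM_add] at w3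
  have hf : q.fst + q'.fst = 8 * (X.fst - t₀) + P.fst + Q.fst := by
    rw [hq, hq']
    simp only [doublingSlopeLeft, doublingSlopeRight, WithLp.add_fst, fst_toLp_pair]
    ring
  exact ⟨σ, hσI, by linarith⟩

end ContactInequality

section DoublingVariables

open Topology

variable {E : Type*} [NormedAddCommGroup E] [InnerProductSpace ℝ E] [FiniteDimensional ℝ E]

theorem exists_forall_norm_sub_uniaxial_le {DA : E → E →L[ℝ] E} (hDA : ContinuousOn DA {0}ᶜ)
    {a₁ a₂ : ℝ → ℝ} (hu : ∀ σ : ℝ, 0 < σ → ∀ e : E, ‖e‖ = 1 →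
      DA (σ • e) = uniaxial (a₁ σ) (a₂ σ) e) {D δ : ℝ} (hD : 0 < D) (hδ : 0 < δ) :
    ∃ δ' > 0, ∀ σ ∈ Icc (D / 2) D, ∀ e : E, ‖e‖ = 1 → ∀ p, ‖p - σ • e‖ ≤ δ' →
      p ≠ 0 ∧ ‖DA p - uniaxial (a₁ σ) (a₂ σ) e‖ ≤ δ := by
  set K : Set E := {p | D / 4 ≤ ‖p‖ ∧ ‖p‖ ≤ 2 * D} with hK
  have hKc : IsCompact K := by
    refine (isCompact_closedBall (0 : E) (2 * D)).of_isClosed_subset ?_ fun p hp => by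
      simpa using hp.2
    exact (isClosed_le continuous_const continuous_norm).inter
      (isClosed_le continuous_norm continuous_const)
  have hK0 : ∀ p ∈ K, p ≠ 0 := fun p hp h => by
    have := hp.1
    rw [h, norm_zero] at this
    linarith
  obtain ⟨δ₁, hδ₁, h1⟩ := Metric.uniformContinuousOn_iff.1
    (hKc.uniformContinuousOn_of_continuous (hDA.mono hK0)) δ hδ
  refine ⟨min (δ₁ / 2) (D / 4), by positivity, fun σ hσ e he p hp => ?_⟩
  have hσ0 : 0 < σ := by linarith [hσ.1]
  have hσe : ‖σ • e‖ = σ := by rw [norm_smul, he, mul_one, Real.norm_of_nonneg hσ0.le]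
  have hσK : σ • e ∈ K := ⟨by linarith [hσ.1], by linarith [hσ.2]⟩
  have hp1 := hp.trans (min_le_left _ _)
  have hp2 := hp.trans (min_le_right _ _)
  have hpK : p ∈ K := by
    have h3 := norm_sub_norm_le p (σ • e)
    have h4 := norm_sub_norm_le (σ • e) p
    rw [norm_sub_rev] at h4
    exact ⟨by linarith [hσ.1], by linarith [hσ.2]⟩
  refine ⟨hK0 p hpK, ?_⟩
  rw [← hu σ hσ0 e he, ← dist_eq_norm]
  exact (h1 p hpK _ hσK (by rw [dist_eq_norm]; linarith)).le

set_option maxHeartbeats 1000000 in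
/-- The concave modulus `concaveModulus D` controls the spatial oscillation of a function which is
a viscosity solution with bounded source on a unit-size time window, when `D` is large. -/
theorem sub_le_concaveModulus {v : ℝ → E → ℝ} (hb : ∀ t x, |v t x| ≤ 1)
    (huc : UniformContinuous fun X : WithLp 2 (ℝ × E) => v X.fst X.snd) {T F : ℝ}
    {DA : E → E →L[ℝ] E} (hv : IsViscositySub (Ioo (T - 2) (T + 2)) v DA F)
    (hv' : IsViscositySub (Ioo (T - 2) (T + 2)) (fun t x => -v t x) DA F)
    (hDA : ContinuousOn DA {0}ᶜ) {a₁ a₂ : ℝ → ℝ} (hu : ∀ σ : ℝ, 0 < σ → ∀ e : E, ‖e‖ = 1 →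
      DA (σ • e) = uniaxial (a₁ σ) (a₂ σ) e) {D m B : ℝ} (hD : 0 < D) (hm : 0 ≤ m)
    (ha₁ : ∀ σ ∈ Icc (D / 2) D, m ≤ a₁ σ ∧ a₁ σ ≤ B)
    (ha₂ : ∀ σ ∈ Icc (D / 2) D, 0 ≤ a₂ σ ∧ a₂ σ ≤ B)
    (hDm : 11 + 2 * F < 2 * D ^ 2 / 5 * m) (x₀ y₀ : E) :
    v T x₀ - v T y₀ ≤ concaveModulus D ‖x₀ - y₀‖ := by
  by_contra! hcon
  let : MeasurableSpace E := borel E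
  have : BorelSpace E := ⟨rfl⟩
  set V : WithLp 2 (ℝ × E) → ℝ := fun X => v X.fst X.snd with hV
  set κ := (v T x₀ - v T y₀ - concaveModulus D ‖x₀ - y₀‖) / 3 with hκd
  have hκ : 0 < κ := by linarith
  obtain ⟨θ, hθ, hθV⟩ := Metric.uniformContinuous_iff.1 huc κ hκ
  set ε := min (1 / 64) (θ ^ 2 / 64) with hεd
  have hε : 0 < ε := by positivity
  have hε1 : ε ≤ 1 / 64 := min_le_left _ _
  have hε2 : ε ≤ θ ^ 2 / 64 := min_le_right _ _
  have hr₀ : 0 < θ / 4 := by positivity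
  set n : ℝ := ((Module.finrank ℝ E : ℕ) : ℝ) with hn
  have hn0 : 0 ≤ n := Nat.cast_nonneg _
  set C := ε⁻¹ + 2 * (D / (θ / 4) + 1 / ε + 5) with hC
  have hC0 : 0 < C := by positivity
  set δ := 1 / (2 * (n * C + 1)) with hδd
  have hδ : 0 < δ := by positivity
  obtain ⟨δ', hδ', hann⟩ := exists_forall_norm_sub_uniaxial_le hDA hu hD hδ
  have hB : 0 ≤ B := (ha₂ D ⟨by linarith, le_rfl⟩).1.trans (ha₂ D ⟨by linarith, le_rfl⟩).2
  obtain ⟨α, hα, hα1, hαx, hαB, hαδ⟩ : ∃ α > 0, α ≤ 1 ∧ α * (‖x₀‖ ^ 2 + ‖y₀‖ ^ 2) ≤ min κ 1 ∧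
      α * (4 * B * (n + 1)) ≤ 1 ∧ 128 * α ≤ δ' ^ 2 := by
    have hs : 0 ≤ ‖x₀‖ ^ 2 + ‖y₀‖ ^ 2 := by positivity
    have hs' : 0 ≤ 4 * B * (n + 1) := by positivity
    set c := min (min κ 1) (δ' ^ 2) with hc
    have hc0 : 0 < c := by positivity
    have hc1 : c ≤ min κ 1 := min_le_left _ _
    have hc2 : min κ 1 ≤ 1 := min_le_right _ _
    have hc3 : c ≤ δ' ^ 2 := min_le_right _ _
    set K := (‖x₀‖ ^ 2 + ‖y₀‖ ^ 2) + 4 * B * (n + 1) + 128 with hK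
    have hK0 : 0 < K := by positivity
    have hKα : c / K * K = c := div_mul_cancel₀ _ hK0.ne'
    have hα : 0 < c / K := by positivity
    refine ⟨c / K, hα, ?_, ?_, ?_, ?_⟩ <;>
      nlinarith [mul_nonneg hα.le hs, mul_nonneg hα.le hs']
  obtain ⟨U, Z, hUc, hUZ, hUle, hUd, hUae⟩ := exists_supConvolution
    (Measure.addHaar : Measure (WithLp 2 (ℝ × E))) huc.continuous (fun X => hb X.fst X.snd) hε
  obtain ⟨U', Z', hUc', hUZ', hUle', hUd', hUae'⟩ := exists_supConvolution
    (v := fun X => -v X.fst X.snd)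
    (Measure.addHaar : Measure (WithLp 2 (ℝ × E))) huc.continuous.neg
    (fun X => by rw [abs_neg]; exact hb X.fst X.snd) hε
  have hUV : ∀ X, U X ≤ V (Z X) := fun X => by
    rw [hUZ]
    exact sub_le_self _ (by positivity)
  have hUV' : ∀ X, U' X ≤ -V (Z' X) := fun X => by
    rw [hUZ']
    exact sub_le_self _ (by positivity)
  have hd : ∀ W W' : WithLp 2 (ℝ × E), ‖W - W'‖ ^ 2 ≤ 4 * ε → ‖W - W'‖ ≤ θ / 4 ∧
      ‖W - W'‖ ≤ 1 / 4 := fun W W' h =>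
    ⟨le_of_sq_le_sq (by linarith) (by positivity), le_of_sq_le_sq (by linarith) (by norm_num)⟩
  have hΨ0 : ∀ X Y : WithLp 2 (ℝ × E), 0 ≤ doublingPenalty D ε α T X Y := fun X Y => by
    have := concaveModulus_nonneg hD (norm_nonneg (X.snd - Y.snd))
    rw [doublingPenalty]
    positivity
  set X₀ : WithLp 2 (ℝ × E) := WithLp.toLp 2 (T, x₀) with hX₀
  set Y₀ : WithLp 2 (ℝ × E) := WithLp.toLp 2 (T, y₀) with hY₀
  have hW₀ : 2 * κ ≤ U X₀ + U' Y₀ - doublingPenalty D ε α T X₀ Y₀ := by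
    have h1 : v T x₀ ≤ U X₀ := by
      have := hUle X₀ X₀
      rwa [sub_self, norm_zero, zero_pow two_ne_zero, zero_div, sub_zero] at this
    have h2 : -v T y₀ ≤ U' Y₀ := by
      have := hUle' Y₀ Y₀
      rwa [sub_self, norm_zero, zero_pow two_ne_zero, zero_div, sub_zero] at this
    have h3 : doublingPenalty D ε α T X₀ Y₀
        = concaveModulus D ‖x₀ - y₀‖ + α * (‖x₀‖ ^ 2 + ‖y₀‖ ^ 2) := by
      simp [doublingPenalty, hX₀, hY₀]
    have h4 : α * (‖x₀‖ ^ 2 + ‖y₀‖ ^ 2) ≤ κ := hαx.trans (min_le_left _ _)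
    rw [h3]
    linarith
  have hloc : ∀ X Y : WithLp 2 (ℝ × E), U X₀ + U' Y₀ - doublingPenalty D ε α T X₀ Y₀ - κ
      ≤ U X + U' Y - doublingPenalty D ε α T X Y →
      doublingPenalty D ε α T X Y < 2 ∧ θ / 4 ≤ ‖X.snd - Y.snd‖ := fun X Y h => by
    have h1 := hUV X
    have h2 := hUV' Y
    have h3 := abs_le.1 (hb (Z X).fst (Z X).snd)
    have h4 := abs_le.1 (hb (Z' Y).fst (Z' Y).snd)
    have hlt : doublingPenalty D ε α T X Y < 2 := by
      simp only [hV] at h1 h2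
      linarith
    refine ⟨hlt, ?_⟩
    have h5 : θ ≤ dist (Z X) (Z' Y) := by
      by_contra! h6
      have h7 := hθV h6
      rw [Real.dist_eq] at h7
      have h8 := le_abs_self (V (Z X) - V (Z' Y))
      have h9 := hΨ0 X Y
      simp only [hV] at h1 h2 h8
      linarith
    have h6 : |X.fst - Y.fst| ≤ θ / 4 := by
      refine abs_le_of_sq_le_sq ?_ (by positivity)
      linarith [(bounds_of_doublingPenalty_lt hD hε hα hlt).2.2.1]
    have h7 : dist (Z X) (Z' Y) ≤ ‖X - Z X‖ + ‖X - Y‖ + ‖Y - Z' Y‖ := by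
      rw [dist_eq_norm, ← norm_sub_rev (Z X)]
      have : Z X - Z' Y = (Z X - X) + (X - Y) + (Y - Z' Y) := by abel
      rw [this]
      exact norm_add₃_le
    have h8 : ‖X - Y‖ ≤ |X.fst - Y.fst| + ‖X.snd - Y.snd‖ := by
      refine le_of_sq_le_sq ?_ (by positivity)
      rw [WithLp.prod_norm_sq_eq_of_L2, WithLp.sub_fst, WithLp.sub_snd, Real.norm_eq_abs]
      nlinarith [mul_nonneg (abs_nonneg (X.fst - Y.fst)) (norm_nonneg (X.snd - Y.snd))]
    linarith [(hd _ _ (hUd X)).1, (hd _ _ (hUd' Y)).1]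
  have hpar := fun X => supConvolution_lower_paraboloid (V := V) (hUZ X) hUle
  have hpar' := fun X => supConvolution_lower_paraboloid (V := fun X => -V X) (hUZ' X) hUle'
  set ρ := min (1 / 2) (δ' / 4) with hρd
  have hρ : 0 < ρ := by positivity
  set CΨ := D / (θ / 4) + 1 / ε + 4 + α with hCΨ
  have hCΨ0 : 0 < CΨ := by positivity
  obtain ⟨X, Y, P, Q, ⟨S, hS, hSX⟩, ⟨S', hS', hSY⟩, hP, hQ, hκW, hW⟩ := exists_contact_prod
    (Measure.addHaar : Measure (WithLp 2 (ℝ × E)))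
    (W := fun X Y => U X + U' Y - doublingPenalty D ε α T X Y) (X₀ := X₀) (Y₀ := Y₀)
    (R := 16 / α) (lam := ε⁻¹ / 2 + CΨ)
    (((hUc.comp continuous_fst).add (hUc'.comp continuous_snd)).sub
      (continuous_doublingPenalty D ε α T)) hκ (by positivity)
    (fun X Y h => by
      have h1 := le_sub_of_doublingPenalty hD hε (by linarith) hα hα1
        (hαx.trans (min_le_right _ _)) h hκ.le
      have h3 := abs_le.1 (hb (Z X).fst (Z X).snd)
      have h4 := abs_le.1 (hb (Z' Y).fst (Z' Y).snd)
      have h5 := hUV X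
      have h6 := hUV' Y
      simp only [hV] at h5 h6
      linarith)
    (fun X Y P Q _ _ h hc X' Y' => by
      obtain ⟨hlt, hθ4⟩ := hloc X Y h
      have h1 := (bounds_of_doublingPenalty_lt hD hε hα hlt).1
      have hΨ := doublingPenalty_add_le (T := T) hD hε hα.le hr₀ hθ4 h1.le
      obtain ⟨hq, hq'⟩ := slope_eq_of_contact (hpar X) (hpar' Y) hΨ hc
      have e1 := hpar X (X' - X)
      have e2 := hpar' Y (Y' - Y)
      have e3 := hΨ (X' - X) (Y' - Y)
      rw [hq, inner_add_left] at e1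
      rw [hq', inner_add_left] at e2
      rw [add_sub_cancel] at e1 e2
      rw [add_sub_cancel, add_sub_cancel, ← hCΨ] at e3
      linarith)
    hUae hUae' hρ
  obtain ⟨hlt, hθ4⟩ := hloc X Y hκW
  obtain ⟨hb1, hb2, hb3, hb4, hb5⟩ := bounds_of_doublingPenalty_lt hD hε hα hlt
  have hXZ := (abs_fst_le_norm _).trans (hd _ _ (hUd X)).2
  have hYZ := (abs_fst_le_norm _).trans (hd _ _ (hUd' Y)).2
  have hXY : |X.fst - Y.fst| ≤ 1 / 4 := abs_le_of_sq_le_sq (by linarith) (by norm_num)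
  rw [WithLp.sub_fst, abs_le] at hXZ hYZ
  rw [abs_le] at hXY
  rw [abs_lt] at hb2
  have hρ1 : ρ ≤ 1 / 2 := min_le_left _ _
  have hρ2 : ρ ≤ δ' / 4 := min_le_right _ _
  have hslope : ∀ x : E, α * ‖x‖ ^ 2 < 2 → 2 * α * ‖x‖ ≤ δ' / 4 := fun x hx => by
    refine le_of_sq_le_sq ?_ (by positivity)
    have : (2 * α * ‖x‖) ^ 2 = 4 * α * (α * ‖x‖ ^ 2) := by ring
    rw [this]
    linarith only [mul_le_mul_of_nonneg_left hx.le (by positivity : 0 ≤ 4 * α), hαδ]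
  obtain ⟨σ, hσ, hfin⟩ := contact_inequality hv hv' hε hS hS' hSX hSY (hUZ X) (hUZ' Y) hUle hUle'
    ⟨by linarith, by linarith⟩ ⟨by linarith, by linarith⟩ hD hε hα.le hr₀ hθ4 hb1 hW
    (fun σ hσ => hm.trans (ha₁ σ hσ).1) (fun σ hσ => (ha₂ σ hσ).1) hann
    (by linarith [hslope _ hb4]) (by linarith [hslope _ hb5])
  have hP1 := (abs_le.1 ((abs_fst_le_norm P).trans hP)).1
  have hQ1 := (abs_le.1 ((abs_fst_le_norm Q).trans hQ)).1
  have t1 : a₁ σ * (-(2 * D ^ 2 / 5) + 4 * α) + a₂ σ * (n * (4 * α))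
      ≤ -(2 * D ^ 2 / 5 * m) + 1 := by
    have h1 := mul_le_mul_of_nonneg_left (ha₁ σ hσ).1 (by positivity : 0 ≤ 2 * D ^ 2 / 5)
    have h2 := mul_le_mul_of_nonneg_right (ha₁ σ hσ).2 (by positivity : 0 ≤ 4 * α)
    have h3 := mul_le_mul_of_nonneg_right (ha₂ σ hσ).2 (by positivity : 0 ≤ n * (4 * α))
    have h4 : a₁ σ * (-(2 * D ^ 2 / 5) + 4 * α) = -(2 * D ^ 2 / 5 * a₁ σ) + a₁ σ * (4 * α) := by
      ring
    have h5 : B * (4 * α) + B * (n * (4 * α)) = α * (4 * B * (n + 1)) := by ring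
    rw [h4]
    linarith only [h1, h2, h3, h5, hαB]
  have t2 : 2 * (n * (δ * (ε⁻¹ + 2 * CΨ))) ≤ 1 := by
    have h1 : ε⁻¹ + 2 * CΨ ≤ C := by rw [hC, hCΨ]; linarith
    have h2 : δ * (2 * (n * C + 1)) = 1 := by
      rw [hδd]
      field_simp
    have h3 := mul_le_mul_of_nonneg_left h1 (mul_nonneg hn0 hδ.le)
    linarith only [h2, h3, hδ]
  rw [← hCΨ, ← hn] at hfin
  linarith only [hfin, t1, t2, hP1, hQ1, hρ1, hDm, hb2.1]

end DoublingVariables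

section RadialFlux

open Topology

theorem strictMonoOn_Ici_of_deriv_pos {d : ℝ → ℝ} (h0 : d 0 = 0) (hpos : ∀ z, 0 < z → 0 < d z)
    (hdiff : ∀ z, 0 < z → DifferentiableAt ℝ d z) (hd : ∀ z, 0 < z → 0 < deriv d z) :
    StrictMonoOn d (Ici 0) := by
  have h1 : StrictMonoOn d (Ioi 0) := by
    refine strictMonoOn_of_deriv_pos (convex_Ioi 0)
      (fun z hz => (hdiff z hz).continuousAt.continuousWithinAt) fun z hz => hd z ?_
    rwa [interior_Ioi] at hz
  intro x hx y hy hxy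
  rcases (mem_Ici.1 hx).eq_or_lt with rfl | hx'
  · rw [h0]
    exact hpos y hxy
  · exact h1 hx' (hx'.trans hxy) hxy

theorem continuousAt_of_relative_modulus {k ω : ℝ → ℝ} (hω : Continuous ω) (hω0 : ω 0 = 0) {y : ℝ}
    (hy : 0 < y) (h : ∀ s, |s - y| < y / 2 → |k s - k y| ≤ ω (|s - y| / y) * k y) :
    ContinuousAt k y := by
  have h1 : Tendsto (fun s => ω (|s - y| / y) * k y) (𝓝 y) (𝓝 0) := by
    have : Continuous fun s => ω (|s - y| / y) * k y := by fun_prop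
    have h2 := this.tendsto y
    simpa [hω0] using h2
  refine tendsto_iff_dist_tendsto_zero.2
    (tendsto_of_tendsto_of_tendsto_of_le_of_le' tendsto_const_nhds h1
      (Eventually.of_forall fun _ => dist_nonneg) ?_)
  filter_upwards [Metric.ball_mem_nhds y (half_pos hy)] with s hs
  rw [Real.dist_eq]
  exact h s hs

variable {E : Type*} [NormedAddCommGroup E] [InnerProductSpace ℝ E]

/-- The derivative of the radial field `Z ↦ (d ‖Z‖ / ‖Z‖) • Z` away from the origin. -/
noncomputable def radialDeriv (d : ℝ → ℝ) (z : E) : E →L[ℝ] E :=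
  uniaxial (deriv d ‖z‖) (d ‖z‖ / ‖z‖) (‖z‖⁻¹ • z)

theorem radialDeriv_smul (d : ℝ → ℝ) {σ : ℝ} (hσ : 0 < σ) {e : E} (he : ‖e‖ = 1) :
    radialDeriv d (σ • e) = uniaxial (deriv d σ) (d σ / σ) e := by
  rw [radialDeriv, norm_smul, he, mul_one, Real.norm_of_nonneg hσ.le, inv_smul_smul₀ hσ.ne']

theorem continuousOn_radialDeriv {d : ℝ → ℝ} (hd : ∀ z, 0 < z → ContinuousAt d z)
    (hd' : ∀ z, 0 < z → ContinuousAt (deriv d) z) :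
    ContinuousOn (radialDeriv (E := E) d) {0}ᶜ := by
  intro z hz
  have hz' : 0 < ‖z‖ := norm_pos_iff.2 hz
  refine ContinuousAt.continuousWithinAt ?_
  have hn : ContinuousAt (fun z : E => ‖z‖) z := continuous_norm.continuousAt
  have h1 : ContinuousAt (fun z : E => deriv d ‖z‖) z := (hd' _ hz').comp hn
  have h2 : ContinuousAt (fun z : E => d ‖z‖ / ‖z‖) z :=
    (ContinuousAt.comp (g := d) (hd _ hz') hn).div hn hz'.ne'
  have h3 : ContinuousAt (fun z : E => ‖z‖⁻¹ • z) z := (hn.inv₀ hz'.ne').smul continuousAt_id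
  have h4 : Continuous fun e : E => (innerSL ℝ e).smulRight e :=
    ((ContinuousLinearMap.smulRightL ℝ E E).continuous₂).comp
      ((innerSL ℝ).continuous.prodMk continuous_id)
  exact (h2.smul continuousAt_const).add
    ((h1.sub h2).smul (ContinuousAt.comp (g := fun e : E => (innerSL ℝ e).smulRight e)
      h4.continuousAt h3))

section Field

variable {d : ℝ → ℝ} {A : E → E} (hA : ∀ Z, A Z = (d ‖Z‖ / ‖Z‖) • Z)
include hA

theorem hasFDerivAt_radial {z : E} (hz : z ≠ 0) (hd : DifferentiableAt ℝ d ‖z‖) :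
    HasFDerivAt A (radialDeriv d z) z := by
  have hz' : 0 < ‖z‖ := norm_pos_iff.2 hz
  have h1 : HasFDerivAt (fun z : E => ‖z‖) (‖z‖⁻¹ • innerSL ℝ z) z := by
    have h2 := (hasStrictFDerivAt_norm_sq z).hasFDerivAt.sqrt (by positivity)
    simp only [Real.sqrt_sq (norm_nonneg _)] at h2
    convert h2 using 1
    ext w
    simp
    field_simp
  have h2 : HasDerivAt (fun r => d r / r) ((deriv d ‖z‖ * ‖z‖ - d ‖z‖ * 1) / ‖z‖ ^ 2) ‖z‖ :=
    hd.hasDerivAt.div (hasDerivAt_id _) hz'.ne'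
  have h3 := (h2.comp_hasFDerivAt z h1).smul (hasFDerivAt_id z)
  have h4 : A = fun z => (d ‖z‖ / ‖z‖) • z := funext hA
  rw [h4]
  refine h3.congr_fderiv ?_
  ext w
  simp only [radialDeriv, uniaxial, add_apply, smul_apply, ContinuousLinearMap.smulRight_apply,
    innerSL_apply_apply, Function.comp_apply, ContinuousLinearMap.id_apply, id_eq, smul_eq_mul,
    real_inner_smul_left, smul_smul]
  congr 2
  field_simp

theorem norm_radial (h0 : d 0 = 0) (hd : ∀ z, 0 < z → 0 < d z) (z : E) : ‖A z‖ = d ‖z‖ := by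
  rcases eq_or_ne z 0 with rfl | hz
  · simp [hA, h0]
  · have hz' : 0 < ‖z‖ := norm_pos_iff.2 hz
    rw [hA, norm_smul, Real.norm_of_nonneg (div_nonneg (hd _ hz').le hz'.le),
      div_mul_cancel₀ _ hz'.ne']

theorem radial_neg (z : E) : A (-z) = -A z := by
  rw [hA, hA, norm_neg, smul_neg]

theorem inner_radial_sub_nonneg (h0 : d 0 = 0) (hd : StrictMonoOn d (Ici 0)) (y z : E) :
    0 ≤ ⟪A y - A z, y - z⟫ := by
  have hm : ∀ r : ℝ, 0 ≤ r → 0 ≤ d r / r ∧ d r / r * r = d r := fun r hr => by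
    rcases hr.eq_or_lt with rfl | hr'
    · simp [h0]
    · refine ⟨div_nonneg ?_ hr, div_mul_cancel₀ _ hr'.ne'⟩
      rw [← h0]
      exact (hd self_mem_Ici hr hr').le
  obtain ⟨hk, hk'⟩ := hm ‖y‖ (norm_nonneg _)
  obtain ⟨hl, hl'⟩ := hm ‖z‖ (norm_nonneg _)
  have hmul : 0 ≤ (d ‖y‖ - d ‖z‖) * (‖y‖ - ‖z‖) := by
    rcases le_total ‖y‖ ‖z‖ with h | h
    · exact mul_nonneg_of_nonpos_of_nonpos
        (sub_nonpos.2 (hd.monotoneOn (norm_nonneg _) (norm_nonneg _) h)) (sub_nonpos.2 h)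
    · exact mul_nonneg (sub_nonneg.2 (hd.monotoneOn (norm_nonneg _) (norm_nonneg _) h))
        (sub_nonneg.2 h)
  have hyz := real_inner_le_norm y z
  rw [hA, hA, inner_sub_left, inner_sub_right, inner_sub_right]
  simp only [real_inner_smul_left, real_inner_self_eq_norm_sq, real_inner_comm y z]
  rw [real_inner_comm] at hyz ⊢
  rw [← hk', ← hl'] at hmul
  linarith [mul_le_mul_of_nonneg_left hyz (add_nonneg hk hl)]

end Field

end RadialFlux

section TimeModulus

open Topology

variable {E : Type*} [NormedAddCommGroup E] [InnerProductSpace ℝ E] [FiniteDimensional ℝ E]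
  [MeasurableSpace E] [BorelSpace E]

theorem exists_contDiff_mollifier {δ : ℝ} (hδ : 0 < δ) : ∃ (φ : E → ℝ) (Z : E → E),
    ContDiff ℝ (⊤ : ℕ∞) φ ∧ HasCompactSupport φ ∧ (∀ x, HasGradientAt φ (Z x) x) ∧
    Continuous Z ∧ HasCompactSupport Z ∧ (∀ x, 0 ≤ φ x) ∧ ∫ x, φ x = 1 ∧
    ∀ x, δ ≤ ‖x‖ → φ x = 0 := by
  let b : ContDiffBump (0 : E) := ⟨δ / 2, δ, half_pos hδ, half_lt_self hδ⟩
  have hc : ContDiff ℝ (⊤ : ℕ∞) (b.normed volume) := b.contDiff_normed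
  have hcs : HasCompactSupport (b.normed volume) := b.hasCompactSupport_normed
  refine ⟨b.normed volume,
    fun x => (InnerProductSpace.toDual ℝ E).symm (fderiv ℝ (b.normed volume) x), hc, hcs,
    fun x => ?_, ?_, ?_, b.nonneg_normed, b.integral_normed, fun x hx => ?_⟩
  · exact (hc.differentiable (by simp) x).hasGradientAt
  · exact (InnerProductSpace.toDual ℝ E).symm.continuous.comp (hc.continuous_fderiv (by simp))
  · exact (hcs.fderiv ℝ).comp_left (map_zero _)
  · refine Function.notMem_support.1 fun h => ?_
    rw [b.support_normed_eq, mem_ball_zero_iff] at h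
    exact absurd h (not_lt.2 hx)

theorem abs_integral_mul_sub_le {w φ : E → ℝ} {K δ : ℝ} (hw : Continuous w)
    (hK : ∀ x y, |w x - w y| ≤ K * ‖x - y‖) (hK0 : 0 ≤ K) (hφ : Continuous φ)
    (hφc : HasCompactSupport φ) (hφ0 : ∀ x, 0 ≤ φ x) (hφ1 : ∫ x, φ x = 1)
    (hφδ : ∀ x, δ ≤ ‖x‖ → φ x = 0) (x₀ : E) :
    |(∫ x, w x * φ (x - x₀)) - w x₀| ≤ K * δ := by
  have hc : Continuous fun x => φ (x - x₀) := by fun_prop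
  have hcs : HasCompactSupport fun x => φ (x - x₀) :=
    hφc.comp_homeomorph (Homeomorph.subRight x₀)
  have h1 : ∫ x, φ (x - x₀) = 1 := by rw [integral_sub_right_eq_self, hφ1]
  have hi : Integrable fun x => w x * φ (x - x₀) :=
    (hw.mul hc).integrable_of_hasCompactSupport hcs.mul_left
  have hi' : Integrable fun x => φ (x - x₀) := hc.integrable_of_hasCompactSupport hcs
  have h2 : (∫ x, w x * φ (x - x₀)) - w x₀ = ∫ x, (w x - w x₀) * φ (x - x₀) := by
    simp only [sub_mul]
    rw [integral_sub hi (hi'.const_mul _), integral_const_mul, h1, mul_one]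
  rw [h2, ← Real.norm_eq_abs]
  refine (norm_integral_le_of_norm_le (hi'.const_mul (K * δ))
    (Eventually.of_forall fun x => ?_)).trans_eq (by rw [integral_const_mul, h1, mul_one])
  rw [norm_mul, Real.norm_eq_abs, Real.norm_of_nonneg (hφ0 _)]
  rcases le_or_gt δ ‖x - x₀‖ with h | h
  · simp [hφδ _ h]
  · exact mul_le_mul_of_nonneg_right
      ((hK x x₀).trans (mul_le_mul_of_nonneg_left h.le hK0)) (hφ0 _)

theorem continuous_uncurry_of_continuous_integral_mul {v : ℝ → E → ℝ} {K : ℝ} (hK0 : 0 ≤ K)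
    (hK : ∀ t x y, |v t x - v t y| ≤ K * ‖x - y‖)
    (hv : ∀ φ : E → ℝ, Continuous φ → HasCompactSupport φ → Continuous fun t => ∫ x, v t x * φ x) :
    Continuous fun p : ℝ × E => v p.1 p.2 := by
  have hlip : ∀ t, LipschitzWith K.toNNReal (v t) := fun t =>
    LipschitzWith.of_dist_le_mul fun x y => by
      rw [Real.coe_toNNReal _ hK0, Real.dist_eq, dist_eq_norm]
      exact hK t x y
  refine continuous_prod_of_continuous_lipschitzWith' (fun p : ℝ × E => v p.1 p.2) _ hlip
    fun x₀ => ?_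
  refine continuous_iff_continuousAt.2 fun t => Metric.continuousAt_iff'.2 fun κ hκ => ?_
  have hδ : 0 < κ / (4 * (K + 1)) := by positivity
  obtain ⟨φ, Z, hφ, hφc, -, -, -, hφ0, hφ1, hφδ⟩ := exists_contDiff_mollifier (E := E) hδ
  have hKδ : K * (κ / (4 * (K + 1))) ≤ κ / 4 := by
    rw [mul_div_assoc', div_le_div_iff₀ (by positivity) (by norm_num)]
    nlinarith
  have hc := (hv (fun x => φ (x - x₀)) (hφ.continuous.comp (by fun_prop))
    (hφc.comp_homeomorph (Homeomorph.subRight x₀))).continuousAt (x := t)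
  filter_upwards [Metric.continuousAt_iff'.1 hc (κ / 2) (half_pos hκ)] with s hs
  have h1 := abs_integral_mul_sub_le (hlip s).continuous (hK s) hK0 hφ.continuous hφc hφ0 hφ1 hφδ x₀
  have h2 := abs_integral_mul_sub_le (hlip t).continuous (hK t) hK0 hφ.continuous hφc hφ0 hφ1 hφδ x₀
  rw [Real.dist_eq, abs_lt] at hs ⊢
  rw [abs_le] at h1 h2
  constructor <;> linarith

/-- Spatially Lipschitz solutions are uniformly continuous in time, uniformly in space. -/
theorem IsDivFormSol.exists_time_modulus {I : Set ℝ} {v : ℝ → E → ℝ} {a : ℝ → E → E}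
    {g : ℝ → E → ℝ} {C K : ℝ} (h : IsDivFormSol I v a g C) (hK0 : 0 ≤ K)
    (hK : ∀ t x y, |v t x - v t y| ≤ K * ‖x - y‖) {κ : ℝ} (hκ : 0 < κ) :
    ∃ θ > 0, ∀ s ∈ I, ∀ t ∈ I, |t - s| < θ → ∀ x, |v t x - v s x| < κ := by
  have hδ : 0 < κ / (4 * (K + 1)) := by positivity
  obtain ⟨φ, Z, hφ, hφc, hφZ, hZ, hZc, hφ0, hφ1, hφδ⟩ := exists_contDiff_mollifier (E := E) hδ
  have hKδ : K * (κ / (4 * (K + 1))) ≤ κ / 4 := by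
    rw [mul_div_assoc', div_le_div_iff₀ (by positivity) (by norm_num)]
    nlinarith
  have hC0 : 0 ≤ C := (abs_nonneg _).trans (h.abs_value_le 0 0)
  set B := ∫ x, (C * ‖Z x‖ + C * φ x) with hB
  have hBi : Integrable fun x => C * ‖Z x‖ + C * φ x :=
    ((hZ.norm.integrable_of_hasCompactSupport hZc.norm).const_mul _).add
      ((hφ.continuous.integrable_of_hasCompactSupport hφc).const_mul _)
  have hB0 : 0 ≤ B := integral_nonneg fun x => by
    have := hφ0 x
    positivity
  have hvc : ∀ t, Continuous (v t) := fun t => h.continuous.comp (by fun_prop : Continuous fun x => (t, x))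
  have key : ∀ s ∈ I, ∀ t ∈ I, s ≤ t → |t - s| < κ / (4 * (B + 1)) → ∀ x, |v t x - v s x| < κ := by
    intro s hs t ht hst hts x₀
    have hcs : HasCompactSupport fun x => φ (x - x₀) :=
      hφc.comp_homeomorph (Homeomorph.subRight x₀)
    have hc : Continuous fun x => φ (x - x₀) := hφ.continuous.comp (by fun_prop)
    have hw := h.weak s hs t ht hst (fun x => φ (x - x₀)) (fun x => Z (x - x₀))
      (hφ.comp (by fun_prop)) hcs fun x => by
        have h2 := (hφZ (x - x₀)).hasFDerivAt.comp x ((hasFDerivAt_id x).sub_const x₀)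
        exact hasGradientAt_iff_hasFDerivAt.2 h2
    have hb : |∫ τ in s..t, ∫ x, (-⟪a τ x, Z (x - x₀)⟫ + g τ x * φ (x - x₀))| ≤ B * |t - s| := by
      rw [← Real.norm_eq_abs]
      refine intervalIntegral.norm_integral_le_of_norm_le_const fun τ _ => ?_
      refine (norm_integral_le_of_norm_le (hBi.comp_sub_right x₀)
        (Eventually.of_forall fun x => ?_)).trans_eq
        (integral_sub_right_eq_self (fun x => C * ‖Z x‖ + C * φ x) x₀)
      refine (norm_add_le _ _).trans (add_le_add ?_ ?_)
      · rw [norm_neg]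
        exact (norm_inner_le_norm _ _).trans
          (mul_le_mul_of_nonneg_right (h.norm_flux_le τ x) (norm_nonneg _))
      · rw [norm_mul, Real.norm_of_nonneg (hφ0 _), Real.norm_eq_abs]
        exact mul_le_mul_of_nonneg_right (h.abs_source_le τ x) (hφ0 _)
    have hBt : B * |t - s| < κ / 2 := by
      rw [lt_div_iff₀ (by positivity)] at hts
      nlinarith [abs_nonneg (t - s)]
    have h1 := abs_integral_mul_sub_le (hvc s) (hK s) hK0 hφ.continuous hφc hφ0 hφ1 hφδ x₀
    have h2 := abs_integral_mul_sub_le (hvc t) (hK t) hK0 hφ.continuous hφc hφ0 hφ1 hφδ x₀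
    simp only [sub_mul] at hw
    have hi : ∀ τ, Integrable fun x => v τ x * φ (x - x₀) := fun τ =>
      ((hvc τ).mul hc).integrable_of_hasCompactSupport hcs.mul_left
    rw [integral_sub (hi t) (hi s)] at hw
    rw [← hw] at hb
    rw [abs_lt]
    rw [abs_le] at h1 h2 hb
    constructor <;> linarith
  refine ⟨κ / (4 * (B + 1)), by positivity, fun s hs t ht hts x => ?_⟩
  rcases le_total s t with hst | hst
  · exact key s hs t ht hst hts x
  · rw [abs_sub_comm] at hts ⊢
    exact key t ht s hs hst hts x

end TimeModulus

section ClampedSolution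

open Topology

section Algebra

variable {E : Type*} [NormedAddCommGroup E] [InnerProductSpace ℝ E] [FiniteDimensional ℝ E]
  [MeasurableSpace E] [BorelSpace E] {I : Set ℝ} {v : ℝ → E → ℝ} {a : ℝ → E → E} {g : ℝ → E → ℝ}
  {C : ℝ}

theorem IsDivFormSol.mono (h : IsDivFormSol I v a g C) {J : Set ℝ} (hJ : J ⊆ I) :
    IsDivFormSol J v a g C :=
  { h with weak := fun s hs t ht => h.weak s (hJ hs) t (hJ ht) }

theorem IsDivFormSol.neg (h : IsDivFormSol I v a g C) :
    IsDivFormSol I (fun t x => -v t x) (fun t x => -a t x) (fun t x => -g t x) C where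
  continuous := h.continuous.neg
  measurable_flux := h.measurable_flux.neg
  measurable_source := h.measurable_source.neg
  abs_value_le t x := by rw [abs_neg]; exact h.abs_value_le t x
  norm_flux_le t x := by rw [norm_neg]; exact h.norm_flux_le t x
  abs_source_le t x := by rw [abs_neg]; exact h.abs_source_le t x
  weak s hs t ht hst ζ Z hζ hζc hZ := by
    have h1 := congrArg Neg.neg (h.weak s hs t ht hst ζ Z hζ hζc hZ)
    rw [← integral_neg, ← intervalIntegral.integral_neg] at h1
    simp only [← integral_neg] at h1
    convert h1 using 5
    · ring
    · rw [inner_neg_left]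
      ring

end Algebra

/-- The projection of the real line onto `[0, S]`. -/
noncomputable def clampTime (S t : ℝ) : ℝ := max 0 (min t S)

theorem clampTime_mem {S : ℝ} (hS : 0 ≤ S) (t : ℝ) : clampTime S t ∈ Icc 0 S :=
  ⟨le_max_left _ _, max_le hS (min_le_right _ _)⟩

theorem clampTime_of_mem {S t : ℝ} (ht : t ∈ Icc 0 S) : clampTime S t = t := by
  rw [clampTime, min_eq_left ht.2, max_eq_right ht.1]

theorem abs_clampTime_sub_le (S t s : ℝ) : |clampTime S t - clampTime S s| ≤ |t - s| := by
  refine (abs_max_sub_max_le_max _ _ _ _).trans ?_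
  rw [sub_self, abs_zero, max_eq_right (abs_nonneg _)]
  refine (abs_min_sub_min_le_max _ _ _ _).trans ?_
  rw [sub_self, abs_zero, max_eq_left (abs_nonneg _)]

theorem continuous_clampTime (S : ℝ) : Continuous (clampTime S) :=
  continuous_const.max (continuous_id.min continuous_const)

theorem abs_sub_le_of_hasGradientAt {E : Type*} [NormedAddCommGroup E] [InnerProductSpace ℝ E]
    [CompleteSpace E] {w : E → ℝ} {G : E → E} {K : ℝ} (hw : ∀ x, HasGradientAt w (G x) x)
    (hK : ∀ x, ‖G x‖ ≤ K) (x y : E) : |w x - w y| ≤ K * ‖x - y‖ := by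
  rw [← Real.norm_eq_abs]
  refine convex_univ.norm_image_sub_le_of_norm_hasFDerivWithin_le (𝕜 := ℝ)
    (fun z _ => (hw z).hasFDerivAt.hasFDerivWithinAt) (fun z _ => ?_) (mem_univ y) (mem_univ x)
  rw [LinearIsometryEquiv.norm_map]
  exact hK z

theorem measurable_uncurry_of_hasGradientAt {E : Type*} [NormedAddCommGroup E]
    [InnerProductSpace ℝ E] [FiniteDimensional ℝ E] [MeasurableSpace E] [BorelSpace E]
    {v : ℝ → E → ℝ} {G : ℝ → E → E} (hv : Continuous fun p : ℝ × E => v p.1 p.2)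
    (hG : ∀ t x, HasGradientAt (v t) (G t x) x) : Measurable fun p : ℝ × E => G p.1 p.2 := by
  have h : (fun p : ℝ × E => G p.1 p.2)
      = fun p => (InnerProductSpace.toDual ℝ E).symm (fderiv ℝ (v p.1) p.2) := funext fun p => by
    rw [(hG p.1 p.2).hasFDerivAt.fderiv, LinearIsometryEquiv.symm_apply_apply]
  rw [h]
  exact (InnerProductSpace.toDual ℝ E).symm.continuous.measurable.comp
    (measurable_fderiv_with_param ℝ hv)

variable {N : ℕ} {A : EuclideanSpace ℝ (Fin N) → EuclideanSpace ℝ (Fin N)} {f : ℝ → ℝ}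
  {u : ℝ → EuclideanSpace ℝ (Fin N) → ℝ}
  {gr : ℝ → EuclideanSpace ℝ (Fin N) → EuclideanSpace ℝ (Fin N)}
  {u₀ : EuclideanSpace ℝ (Fin N) → ℝ} {S K C : ℝ}

theorem IsWeakSol.continuous_clampTime (hu : IsWeakSol A f u gr u₀)
    (hgr : ∀ t, 0 ≤ t → ∀ x, HasGradientAt (u t) (gr t x) x) (hS : 0 ≤ S)
    (hK : ∀ t ∈ Icc 0 S, ∀ x, ‖gr t x‖ ≤ K) :
    Continuous fun p : ℝ × EuclideanSpace ℝ (Fin N) => u (clampTime S p.1) p.2 :=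
  continuous_uncurry_of_continuous_integral_mul (v := fun t x => u (clampTime S t) x)
    ((norm_nonneg _).trans (hK 0 ⟨le_rfl, hS⟩ 0))
    (fun t => abs_sub_le_of_hasGradientAt (hgr _ (clampTime_mem hS t).1)
      (hK _ (clampTime_mem hS t)))
    fun φ hφ hφc => (hu.2.1 φ hφ hφc).comp (_root_.continuous_clampTime S)

/-- The weak formulation tested with time-independent functions. -/
theorem IsWeakSol.integral_mul_sub (hu : IsWeakSol A f u gr u₀) (hS : 0 ≤ S)
    {ζ : EuclideanSpace ℝ (Fin N) → ℝ}
    {Z : EuclideanSpace ℝ (Fin N) → EuclideanSpace ℝ (Fin N)} (hζ : ContDiff ℝ (⊤ : ℕ∞) ζ)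
    (hζc : HasCompactSupport ζ) (hZ : ∀ x, HasGradientAt ζ (Z x) x) {T : ℝ} (hT : T ∈ Icc 0 S) :
    (∫ x, u T x * ζ x) - ∫ x, u₀ x * ζ x
      = ∫ τ in (0 : ℝ)..T, ∫ x, (-⟪A (gr (clampTime S τ) x), Z x⟫
        + f (u (clampTime S τ) x) * ζ x) := by
  let χ : ContDiffBump (0 : ℝ) := ⟨S + 1, S + 2, by positivity, by linarith⟩
  have hχ : ∀ t ∈ Icc 0 S, χ t = 1 := fun t ht => χ.one_of_mem_closedBall (by
    rw [mem_closedBall_zero_iff, Real.norm_of_nonneg ht.1]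
    change t ≤ S + 1
    linarith [ht.2])
  have hχ' : ∀ t ∈ Icc 0 S, (fun τ => χ τ) =ᶠ[𝓝 t] fun _ => 1 := fun t ht => by
    refine χ.eventuallyEq_one_of_mem_ball (by
      rw [mem_ball_zero_iff, Real.norm_of_nonneg ht.1]
      change t < S + 1
      linarith [ht.2])
  have h := hu.2.2.2.2 (fun t x => χ t * ζ x)
    ((χ.contDiff.comp contDiff_fst).mul (hζ.comp contDiff_snd))
    (HasCompactSupport.of_support_subset_isCompact
      (χ.hasCompactSupport.isCompact.prod hζc.isCompact) fun p hp =>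
        ⟨subset_tsupport _ (left_ne_zero_of_mul hp), subset_tsupport _ (right_ne_zero_of_mul hp)⟩)
    T hT.1
  rw [hχ T hT, hχ 0 ⟨le_rfl, hS⟩] at h
  simp only [one_mul] at h
  rw [h]
  refine intervalIntegral.integral_congr fun t ht => integral_congr_ae (Eventually.of_forall
    fun x => ?_)
  rw [uIcc_of_le hT.1] at ht
  have htS : t ∈ Icc 0 S := ⟨ht.1, ht.2.trans hT.2⟩
  have h1 : deriv (fun τ => χ τ * ζ x) t = 0 := by
    have h2 : (fun τ => χ τ * ζ x) =ᶠ[𝓝 t] fun _ => ζ x := by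
      filter_upwards [hχ' t htS] with τ hτ
      rw [hτ, one_mul]
    rw [h2.deriv_eq, deriv_const]
  have h3 : gradient (fun x => χ t * ζ x) x = Z x := by
    simp only [hχ t htS, one_mul]
    exact (hZ x).gradient
  simp only [h1, clampTime_of_mem htS]
  rw [h3, hχ t htS]
  ring

theorem IsWeakSol.isDivFormSol (hu : IsWeakSol A f u gr u₀)
    (hgr : ∀ t, 0 ≤ t → ∀ x, HasGradientAt (u t) (gr t x) x) (hS : 0 ≤ S)
    (hK : ∀ t ∈ Icc 0 S, ∀ x, ‖gr t x‖ ≤ K) (hA : Measurable A) (hf : Continuous f)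
    (hAC : ∀ t ∈ Icc 0 S, ∀ x, ‖A (gr t x)‖ ≤ C) (huC : ∀ t ∈ Icc 0 S, ∀ x, |u t x| ≤ C)
    (hfC : ∀ t ∈ Icc 0 S, ∀ x, |f (u t x)| ≤ C) :
    IsDivFormSol (Icc 0 S) (fun t x => u (clampTime S t) x) (fun t x => A (gr (clampTime S t) x))
      (fun t x => f (u (clampTime S t) x)) C := by
  have hc := hu.continuous_clampTime hgr hS hK
  have hmem := clampTime_mem hS
  have hmA : Measurable fun p : ℝ × EuclideanSpace ℝ (Fin N) => A (gr (clampTime S p.1) p.2) :=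
    hA.comp (measurable_uncurry_of_hasGradientAt (G := fun t x => gr (clampTime S t) x) hc
      fun t x => hgr _ (hmem t).1 x)
  have hmf : Measurable fun p : ℝ × EuclideanSpace ℝ (Fin N) => f (u (clampTime S p.1) p.2) :=
    (hf.comp hc).measurable
  refine ⟨hc, hmA, hmf, fun t => huC _ (hmem t), fun t => hAC _ (hmem t), fun t => hfC _ (hmem t),
    fun s hs t ht hst ζ Z hζ hζc hZ => ?_⟩
  have hZm : Measurable Z := measurable_of_hasGradientAt hZ
  have hZe : Z = fun x => (InnerProductSpace.toDual ℝ _).symm (fderiv ℝ ζ x) := funext fun x => by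
    rw [(hZ x).hasFDerivAt.fderiv, LinearIsometryEquiv.symm_apply_apply]
  have hZc : Continuous Z := by
    rw [hZe]
    exact (InnerProductSpace.toDual ℝ _).symm.continuous.comp (hζ.continuous_fderiv (by simp))
  have hZs : HasCompactSupport Z := by
    rw [hZe]
    exact (hζc.fderiv ℝ).comp_left (map_zero _)
  set I : ℝ → ℝ := fun τ => ∫ x, (-⟪A (gr (clampTime S τ) x), Z x⟫
        + f (u (clampTime S τ) x) * ζ x) with hI
  have hIm : AEStronglyMeasurable I := by
    refine (Measurable.stronglyMeasurable ?_).integral_prod_right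
      (f := fun τ x => -⟪A (gr (clampTime S τ) x), Z x⟫
        + f (u (clampTime S τ) x) * ζ x).aestronglyMeasurable
    exact ((hmA.inner (hZm.comp measurable_snd)).neg).add
      (hmf.mul (hζ.continuous.measurable.comp measurable_snd))
  have hbi : Integrable fun x => C * ‖Z x‖ + C * ‖ζ x‖ :=
    ((hZc.norm.integrable_of_hasCompactSupport hZs.norm).const_mul _).add
      ((hζ.continuous.norm.integrable_of_hasCompactSupport hζc.norm).const_mul _)
  have hIb : ∀ τ, ‖I τ‖ ≤ ∫ x, (C * ‖Z x‖ + C * ‖ζ x‖) := fun τ => by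
    refine norm_integral_le_of_norm_le hbi (Eventually.of_forall fun x => ?_)
    refine (norm_add_le _ _).trans (add_le_add ?_ ?_)
    · rw [norm_neg]
      exact (norm_inner_le_norm _ _).trans
        (mul_le_mul_of_nonneg_right (hAC _ (hmem τ) x) (norm_nonneg _))
    · rw [norm_mul, Real.norm_eq_abs]
      exact mul_le_mul_of_nonneg_right (hfC _ (hmem τ) x) (norm_nonneg _)
  have hIi : ∀ r, IntervalIntegrable I volume 0 r := fun r =>
    (intervalIntegrable_const (c := ∫ x, (C * ‖Z x‖ + C * ‖ζ x‖))).mono_fun' hIm.restrict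
      (Eventually.of_forall hIb)
  have h1 := hu.integral_mul_sub hS hζ hζc hZ hs
  have h2 := hu.integral_mul_sub hS hζ hζc hZ ht
  have h3 := intervalIntegral.integral_interval_sub_left (hIi t) (hIi s)
  have hui : ∀ r ∈ Icc 0 S, Integrable fun x => u r x * ζ x := fun r hr => by
    have h4 : Continuous (u r) := by
      have := hc.comp (by fun_prop : Continuous fun x : EuclideanSpace ℝ (Fin N) => (r, x))
      simpa only [Function.comp_def, clampTime_of_mem hr] using this
    exact (h4.mul hζ.continuous).integrable_of_hasCompactSupport hζc.mul_left
  simp only [clampTime_of_mem hs, clampTime_of_mem ht, sub_mul]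
  rw [integral_sub (hui t ht) (hui s hs), ← h3, ← h1, ← h2]
  ring

end ClampedSolution

section GradientBound

open Topology

theorem uniformContinuous_clampTime {E : Type*} [NormedAddCommGroup E] [InnerProductSpace ℝ E]
    [FiniteDimensional ℝ E] [MeasurableSpace E] [BorelSpace E] {v : ℝ → E → ℝ} {a : ℝ → E → E}
    {g : ℝ → E → ℝ} {C K S : ℝ} (hS : 0 ≤ S)
    (h : IsDivFormSol (Icc 0 S) (fun t x => v (clampTime S t) x) a g C) (hK0 : 0 ≤ K)
    (hK : ∀ t x y, |v (clampTime S t) x - v (clampTime S t) y| ≤ K * ‖x - y‖) :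
    UniformContinuous fun X : WithLp 2 (ℝ × E) => v (clampTime S X.fst) X.snd := by
  refine Metric.uniformContinuous_iff.2 fun κ hκ => ?_
  obtain ⟨θ, hθ, hm⟩ := h.exists_time_modulus hK0 hK (half_pos hκ)
  refine ⟨min θ (κ / (2 * (K + 1))), by positivity, fun X Y hXY => ?_⟩
  rw [dist_eq_norm, lt_min_iff] at hXY
  have h1 := hm _ (clampTime_mem hS Y.fst) _ (clampTime_mem hS X.fst)
    ((abs_clampTime_sub_le S _ _).trans_lt ((abs_fst_le_norm (X - Y)).trans_lt hXY.1)) X.snd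
  have h2 := hK Y.fst X.snd Y.snd
  have h3 : K * ‖X.snd - Y.snd‖ ≤ κ / 2 := by
    have h4 : ‖X.snd - Y.snd‖ < κ / (2 * (K + 1)) := (norm_snd_le_norm (X - Y)).trans_lt hXY.2
    rw [lt_div_iff₀ (by positivity)] at h4
    nlinarith [norm_nonneg (X.snd - Y.snd)]
  simp only [clampTime_of_mem (clampTime_mem hS _)] at h1
  rw [Real.dist_eq]
  have h5 := abs_sub_le (v (clampTime S X.fst) X.snd) (v (clampTime S Y.fst) X.snd)
    (v (clampTime S Y.fst) Y.snd)
  linarith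

theorem concaveModulus_le_mul {D r : ℝ} (hD : 0 ≤ D) : concaveModulus D r ≤ D * r := by
  have h1 := mul_le_mul_of_nonneg_left (min_le_left r (5 / D)) hD
  have h2 : 0 ≤ D ^ 2 * min r (5 / D) ^ 2 / 20 := by positivity
  rw [concaveModulus]
  linarith

variable {N : ℕ} {A : EuclideanSpace ℝ (Fin N) → EuclideanSpace ℝ (Fin N)} {f : ℝ → ℝ}
  {u : ℝ → EuclideanSpace ℝ (Fin N) → ℝ}
  {gr : ℝ → EuclideanSpace ℝ (Fin N) → EuclideanSpace ℝ (Fin N)}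
  {u₀ : EuclideanSpace ℝ (Fin N) → ℝ}

theorem IsWeakSol.norm_gradient_le (hu : IsWeakSol A f u gr u₀)
    (hgr : ∀ t, 0 ≤ t → ∀ x, HasGradientAt (u t) (gr t x) x)
    (hgrloc : ∀ T : ℝ, 0 < T → ∃ C : ℝ, ∀ t ∈ Icc 0 T, ∀ x, ‖gr t x‖ ≤ C)
    (hur : ∀ t, 0 ≤ t → ∀ x, u t x ∈ Icc (-1 : ℝ) 1) (hf : Continuous f) {F : ℝ}
    (hF : ∀ s ∈ Icc (-1 : ℝ) 1, |f s| ≤ F) {d : ℝ → ℝ} (hA : ∀ Z, A Z = (d ‖Z‖ / ‖Z‖) • Z)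
    (hd0 : d 0 = 0) (hd : StrictMonoOn d (Ici 0)) (hdiff : ∀ z, 0 < z → DifferentiableAt ℝ d z)
    (hd' : ∀ z, 0 < z → ContinuousAt (deriv d) z) {D m B : ℝ} (hD : 0 < D) (hm : 0 ≤ m)
    (hdm : ∀ σ ∈ Icc (D / 2) D, m ≤ deriv d σ ∧ deriv d σ ≤ B)
    (hdB : ∀ σ ∈ Icc (D / 2) D, d σ / σ ≤ B) (hDm : 11 + 2 * F < 2 * D ^ 2 / 5 * m)
    {T : ℝ} (hT : 2 ≤ T) (x : EuclideanSpace ℝ (Fin N)) : ‖gr T x‖ ≤ D := by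
  have hdpos : ∀ z, 0 < z → 0 < d z := fun z hz => hd0 ▸ hd self_mem_Ici hz.le hz
  set S := T + 3 with hSd
  have hS : 0 ≤ S := by linarith
  obtain ⟨K, hK⟩ := hgrloc S (by linarith)
  have hK0 : 0 ≤ K := (norm_nonneg _).trans (hK 0 ⟨le_rfl, hS⟩ 0)
  have hF0 : 0 ≤ F := (abs_nonneg _).trans (hF 0 (by norm_num))
  have hdK : 0 ≤ d K := hd0 ▸ hd.monotoneOn self_mem_Ici hK0 hK0
  have hmem := clampTime_mem hS
  have hu1 : ∀ t ∈ Icc 0 S, ∀ x, |u t x| ≤ 1 := fun t ht x => abs_le.2 (hur t ht.1 x)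
  have hDA : ContinuousOn (radialDeriv (E := EuclideanSpace ℝ (Fin N)) d) {0}ᶜ :=
    continuousOn_radialDeriv (fun z hz => (hdiff z hz).continuousAt) hd'
  have hAd : ∀ z ≠ 0, HasFDerivAt A (radialDeriv d z) z := fun z hz =>
    hasFDerivAt_radial hA hz (hdiff _ (norm_pos_iff.2 hz))
  have hAm : Measurable A := measurable_of_continuousOn_compl_singleton 0
    fun z hz => (hAd z hz).continuousAt.continuousWithinAt
  have hmono := inner_radial_sub_nonneg hA hd0 hd
  have hsol := hu.isDivFormSol (C := K + d K + 1 + F) hgr hS hK hAm hf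
    (fun t ht x => by
      rw [norm_radial hA hd0 hdpos]
      linarith [hd.monotoneOn (norm_nonneg (gr t x)) hK0 (hK t ht x)])
    (fun t ht x => (hu1 t ht x).trans (by linarith))
    (fun t ht x => (hF _ (hur t ht.1 x)).trans (by linarith))
  have hG : ∀ t x, HasGradientAt (u (clampTime S t)) (gr (clampTime S t) x) x := fun t =>
    hgr _ (hmem t).1
  have hGm := measurable_uncurry_of_hasGradientAt (v := fun t x => u (clampTime S t) x)
    (G := fun t x => gr (clampTime S t) x) hsol.continuous hG
  have hGC : ∀ t x, ‖gr (clampTime S t) x‖ ≤ K + d K + 1 + F := fun t x =>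
    (hK _ (hmem t) x).trans (by linarith)
  have hsub : Ioo (T - 2) (T + 2) ⊆ Icc 0 S := fun t ht => ⟨by linarith [ht.1], by linarith [ht.2]⟩
  have hv : IsViscositySub (Ioo (T - 2) (T + 2)) (fun t x => u (clampTime S t) x)
      (radialDeriv d) F := by
    intro t₀ b a x₀ c p M ht₀ hp hM htouch
    exact (hsol.mono hsub).le_of_expansion hG hGm hGC
      (fun t x => (le_abs_self _).trans (hF _ (hur _ (hmem t).1 x))) hmono hAd hDA ht₀ hp hM htouch
  have hsol' : IsDivFormSol (Ioo (T - 2) (T + 2)) (fun t x => -u (clampTime S t) x)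
      (fun t x => A (-gr (clampTime S t) x)) (fun t x => -f (u (clampTime S t) x))
      (K + d K + 1 + F) := by
    simp only [radial_neg hA]
    exact (hsol.mono hsub).neg
  have hv' : IsViscositySub (Ioo (T - 2) (T + 2)) (fun t x => -u (clampTime S t) x)
      (radialDeriv d) F := by
    intro t₀ b a x₀ c p M ht₀ hp hM htouch
    refine hsol'.le_of_expansion (G := fun t x => -gr (clampTime S t) x) (fun t x => ?_) hGm.neg
      (fun t x => by rw [norm_neg]; exact hGC t x)
      (fun t x => (neg_le_abs _).trans (hF _ (hur _ (hmem t).1 x))) hmono hAd hDA ht₀ hp hM htouch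
    rw [hasGradientAt_iff_hasFDerivAt, map_neg]
    exact (hG t x).hasFDerivAt.neg
  have hlip := fun t => abs_sub_le_of_hasGradientAt (hG t) (hK _ (hmem t))
  have hfin := sub_le_concaveModulus (v := fun t x => u (clampTime S t) x)
    (fun t x => hu1 _ (hmem t) x) (uniformContinuous_clampTime hS hsol hK0 hlip) hv hv' hDA
    (a₁ := deriv d) (a₂ := fun σ => d σ / σ) (fun σ hσ e he => radialDeriv_smul d hσ he) hD hm hdm
    (fun σ hσ => ⟨div_nonneg (hdpos σ (by linarith [hσ.1])).le (by linarith [hσ.1]), hdB σ hσ⟩) hDm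
  simp only [clampTime_of_mem (show T ∈ Icc 0 S from ⟨by linarith, by linarith⟩)] at hfin
  rw [← LinearIsometryEquiv.norm_map (InnerProductSpace.toDual ℝ _)]
  refine (hgr T (by linarith) x).hasFDerivAt.le_of_lip' hD.le (Eventually.of_forall fun y => ?_)
  rw [Real.norm_eq_abs, abs_le]
  have h1 := (hfin y x).trans (concaveModulus_le_mul hD.le)
  have h2 := (hfin x y).trans (concaveModulus_le_mul hD.le)
  rw [norm_sub_rev x y] at h2
  constructor <;> linarith

end GradientBound

/-- Corollary 2.2 / `cor-int_reg`: a priori gradient bound.  If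
`u` is a weak solution valued in `[-1,1]` with initial datum in the stated
regularity class, then `|∇ₓ u(t,x)| ≤ M` for all `x ∈ ℝ^N`, `t ≥ 0`. -/
theorem stmt_16
    (N : ℕ) (hN : 1 ≤ N)
    -- KPP nonlinearity
    (f : ℝ → ℝ) (μ : ℝ) (hμ : μ ∈ Ioo (-1:ℝ) 1)
    (hfLip : ∃ K : NNReal, LipschitzWith K f)
    (hfm1 : f (-1) = 0) (hfμ : f μ = 0) (hf1 : f 1 = 0)
    (hfneg : ∀ s ∈ Ioo (-1:ℝ) μ, f s < 0)
    (hfpos : ∀ s ∈ Ioo μ (1:ℝ), 0 < f s)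
    (hF : ∀ r ∈ Ioo (-1:ℝ) 1, 0 < ∫ s in r..(1:ℝ), f s)
    -- the diffusion potential Φ(Z) = φ₀(|Z|), with A = ∂Φ
    (Λ₁ Λ₂ : ℝ) (hΛ₁ : 0 < Λ₁) (hΛ₂ : 0 < Λ₂)
    (ω : ℝ → ℝ) (hωcont : Continuous ω) (hω0 : ω 0 = 0)
    (φ₀ dφ₀ : ℝ → ℝ)
    (hφ₀0 : φ₀ 0 = 0) (hdφ₀0 : dφ₀ 0 = 0)
    (hφ₀d : ∀ z ∈ Ici (0:ℝ), HasDerivWithinAt φ₀ (dφ₀ z) (Ici 0) z)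
    (hdφ₀pos : ∀ z : ℝ, 0 < z → 0 < dφ₀ z)
    (hdφ₀diff : ∀ z : ℝ, 0 < z → DifferentiableAt ℝ dφ₀ z)
    (hΛ₀ : ∀ z : ℝ, 0 < z →
      Λ₁ * dφ₀ z ≤ z * deriv dφ₀ z ∧ z * deriv dφ₀ z ≤ Λ₂ * dφ₀ z)
    (hmod₀ : ∀ s y : ℝ, 0 < y → |s - y| < y / 2 →
      |deriv dφ₀ s - deriv dφ₀ y| ≤ ω (|s - y| / y) * deriv dφ₀ y)
    (A : EuclideanSpace ℝ (Fin N) → EuclideanSpace ℝ (Fin N))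
    (hA0 : A 0 = 0)
    (hA : ∀ Z : EuclideanSpace ℝ (Fin N), Z ≠ 0 → A Z = (dφ₀ ‖Z‖ / ‖Z‖) • Z)
    -- the initial datum: BUC, valued in [-1,1], with BUC β-Hölder gradient
    (u₀ : EuclideanSpace ℝ (Fin N) → ℝ)
    (g₀ : EuclideanSpace ℝ (Fin N) → EuclideanSpace ℝ (Fin N))
    (L β : ℝ) (hβ : β ∈ Ioc (0:ℝ) 1) (hL : 0 ≤ L)
    (hu₀c : UniformContinuous u₀)
    (hu₀r : ∀ x : EuclideanSpace ℝ (Fin N), u₀ x ∈ Icc (-1:ℝ) 1)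
    (hg₀ : ∀ x : EuclideanSpace ℝ (Fin N), HasGradientAt u₀ (g₀ x) x)
    (hg₀c : UniformContinuous g₀)
    (hg₀b : ∃ C : ℝ, ∀ x : EuclideanSpace ℝ (Fin N), ‖g₀ x‖ ≤ C)
    (hg₀hold : ∀ x y : EuclideanSpace ℝ (Fin N),
      ‖g₀ x - g₀ y‖ ≤ L * ‖x - y‖ ^ β)
    -- the weak solution and its spatial gradient
    (u : ℝ → EuclideanSpace ℝ (Fin N) → ℝ)
    (gr : ℝ → EuclideanSpace ℝ (Fin N) → EuclideanSpace ℝ (Fin N))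
    (hu : IsWeakSol A f u gr u₀)
    (hur : ∀ t : ℝ, 0 ≤ t → ∀ x : EuclideanSpace ℝ (Fin N),
      u t x ∈ Icc (-1:ℝ) 1)
    (hinit : ∀ x : EuclideanSpace ℝ (Fin N), u 0 x = u₀ x)
    (hgr0 : ∀ x : EuclideanSpace ℝ (Fin N), HasGradientAt (u 0) (gr 0 x) x)
    (hgrloc : ∀ T : ℝ, 0 < T → ∃ C : ℝ, ∀ t ∈ Icc (0:ℝ) T,
      ∀ x : EuclideanSpace ℝ (Fin N), ‖gr t x‖ ≤ C) :
    ∃ M : ℝ, 0 ≤ M ∧ ∀ t : ℝ, 0 ≤ t → ∀ x : EuclideanSpace ℝ (Fin N),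
      ‖gr t x‖ ≤ M := by
  obtain ⟨Kf, hKf⟩ := hfLip
  have hgr : ∀ t, 0 ≤ t → ∀ x, HasGradientAt (u t) (gr t x) x := fun t ht x => by
    rcases ht.eq_or_lt with rfl | ht'
    · exact hgr0 x
    · exact hu.2.2.1 t ht' x
  have hfF : ∀ s ∈ Icc (-1 : ℝ) 1, |f s| ≤ 2 * Kf := fun s hs => by
    have h := hKf.dist_le_mul s (-1)
    rw [Real.dist_eq, Real.dist_eq, hfm1, sub_zero, sub_neg_eq_add,
      abs_of_nonneg (by linarith [hs.1] : 0 ≤ s + 1)] at h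
    nlinarith [hs.2, Kf.coe_nonneg]
  have hA' : ∀ Z, A Z = (dφ₀ ‖Z‖ / ‖Z‖) • Z := fun Z => by
    rcases eq_or_ne Z 0 with rfl | hZ
    · rw [hA0, smul_zero]
    · exact hA Z hZ
  have hder : ∀ z, 0 < z → 0 < deriv dφ₀ z := fun z hz =>
    pos_of_mul_pos_right ((mul_pos hΛ₁ (hdφ₀pos z hz)).trans_le (hΛ₀ z hz).1) hz.le
  have hmono := strictMonoOn_Ici_of_deriv_pos hdφ₀0 hdφ₀pos hdφ₀diff hder
  have h1 : 0 < Λ₁ * dφ₀ 1 := mul_pos hΛ₁ (hdφ₀pos 1 one_pos)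
  set F : ℝ := 2 * Kf with hFd
  have hF0 : 0 ≤ F := by positivity
  set D := 2 + 5 * (12 + 2 * F) / (2 * (Λ₁ * dφ₀ 1)) with hDd
  have hD2 : 2 ≤ D := le_add_of_nonneg_right (by positivity)
  have hD : 0 < D := by linarith
  have hDB : 0 ≤ dφ₀ D / (D / 2) := div_nonneg (hdφ₀pos D hD).le (by linarith)
  have hquot : ∀ σ ∈ Icc (D / 2) D, dφ₀ σ / σ ≤ dφ₀ D / (D / 2) := fun σ hσ => by
    have hσ0 : 0 < σ := by linarith [hσ.1]
    exact div_le_div₀ (hdφ₀pos D hD).le (hmono.monotoneOn hσ0.le hD.le hσ.2) (by linarith) hσ.1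
  have hDm : 11 + 2 * F < 2 * D ^ 2 / 5 * (Λ₁ * dφ₀ 1 / D) := by
    have h2 : 2 * D ^ 2 / 5 * (Λ₁ * dφ₀ 1 / D) = 2 * (Λ₁ * dφ₀ 1) * D / 5 := by
      field_simp
    have h3 : 2 * (Λ₁ * dφ₀ 1) * D = 4 * (Λ₁ * dφ₀ 1) + 5 * (12 + 2 * F) := by
      rw [hDd, mul_add, mul_div_cancel₀ _ (mul_pos two_pos h1).ne']
      ring
    rw [h2, h3]
    linarith
  obtain ⟨C, hC⟩ := hgrloc 2 two_pos
  refine ⟨max C D, le_max_of_le_right hD.le, fun t ht x => ?_⟩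
  rcases le_total t 2 with ht2 | ht2
  · exact (hC t ⟨ht, ht2⟩ x).trans (le_max_left _ _)
  refine le_max_of_le_right (hu.norm_gradient_le hgr hgrloc hur hKf.continuous hfF hA' hdφ₀0 hmono
    hdφ₀diff (fun z hz => continuousAt_of_relative_modulus hωcont hω0 hz fun s => hmod₀ s z hz)
    (m := Λ₁ * dφ₀ 1 / D) (B := (Λ₂ + 1) * (dφ₀ D / (D / 2))) hD (div_pos h1 hD).le
    (fun σ hσ => ?_) (fun σ hσ => ?_) hDm ht2 x)
  · have hσ0 : 0 < σ := by linarith [hσ.1]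
    have hσ1 : dφ₀ 1 ≤ dφ₀ σ := hmono.monotoneOn (mem_Ici.2 zero_le_one) hσ0.le (by linarith [hσ.1])
    obtain ⟨hl, hr⟩ := hΛ₀ σ hσ0
    constructor
    · rw [div_le_iff₀ hD]
      nlinarith [mul_le_mul_of_nonneg_left hσ1 hΛ₁.le,
        mul_le_mul_of_nonneg_left hσ.2 (hder σ hσ0).le]
    · have h2 : deriv dφ₀ σ ≤ Λ₂ * (dφ₀ σ / σ) := by
        rw [mul_div_assoc', le_div_iff₀ hσ0]
        linarith
      nlinarith [mul_le_mul_of_nonneg_left (hquot σ hσ) hΛ₂.le]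
  · nlinarith [hquot σ hσ, mul_nonneg hΛ₂.le hDB]
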